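/- Let n ≥ 1, N ≥ 1, let a₁, …, a_N be nonnegative real numbers and p₁, …, p_N real numbers with pᵢ ≤ 1 for all i. Let u : ℝⁿ × (0,∞) → ℝ be a positive function which is C² in the space variable and C¹ in the time variable and solves ∂ₜu(x,t) = Δₓu(x,t) + Σ_{i=1}^{N} aᵢ·u(x,t)^{pᵢ} on ℝⁿ × (0,∞). Then for every x ∈ ℝⁿ and t > 0 one has Δₓ(ln u(·,t))(x) + n/(2t) ≥ 0. -/

import Mathlib

/-- The Laplacian of a function on Euclidean space: the sum of its second
partial derivatives (the trace of its second derivative). -/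
noncomputable def laplacian {n : ℕ} (v : EuclideanSpace ℝ (Fin n) → ℝ)
    (x : EuclideanSpace ℝ (Fin n)) : ℝ :=
  ∑ i : Fin n, fderiv ℝ (fun y => fderiv ℝ v y (EuclideanSpace.single i 1)) x
    (EuclideanSpace.single i 1)

open MeasureTheory Set Filter Topology
open scoped ENNReal NNReal

noncomputable section

/-- heat kernel -/
def hk {n : ℕ} (t : ℝ) (z : EuclideanSpace ℝ (Fin n)) : ℝ :=
  (4 * Real.pi * t) ^ (-(n : ℝ) / 2) * Real.exp (-‖z‖ ^ 2 / (4 * t))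

/-- heat kernel, extended nonnegative version -/
def hke {n : ℕ} (t : ℝ) (z : EuclideanSpace ℝ (Fin n)) : ℝ≥0∞ := ENNReal.ofReal (hk t z)

/-- heat semigroup on nonnegative functions -/
def hS {n : ℕ} (t : ℝ) (f : EuclideanSpace ℝ (Fin n) → ℝ≥0∞) (x : EuclideanSpace ℝ (Fin n)) :
    ℝ≥0∞ := ∫⁻ z, hke t (x - z) * f z

section kernel

variable {n : ℕ}

lemma hk_pos {t : ℝ} (ht : 0 < t) (z : EuclideanSpace ℝ (Fin n)) : 0 < hk t z := by
  unfold hk; positivity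

lemma hk_neg (t : ℝ) (z : EuclideanSpace ℝ (Fin n)) : hk t (-z) = hk t z := by
  simp [hk]

lemma hk_sub_comm (t : ℝ) (x z : EuclideanSpace ℝ (Fin n)) : hk t (x - z) = hk t (z - x) := by
  rw [← hk_neg, neg_sub]

lemma hke_sub_comm (t : ℝ) (x z : EuclideanSpace ℝ (Fin n)) : hke t (x - z) = hke t (z - x) := by
  simp only [hke, hk_sub_comm]

@[fun_prop]
lemma hk_continuous (t : ℝ) : Continuous (fun z : EuclideanSpace ℝ (Fin n) => hk t z) := by
  unfold hk; fun_prop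

lemma hk_measurable : Measurable (fun q : ℝ × EuclideanSpace ℝ (Fin n) => hk q.1 q.2) := by
  unfold hk; fun_prop

lemma hke_measurable : Measurable (fun q : ℝ × EuclideanSpace ℝ (Fin n) => hke q.1 q.2) :=
  hk_measurable.ennreal_ofReal

@[fun_prop]
lemma hke_measurable_comp {α : Type*} [MeasurableSpace α] {f : α → ℝ}
    {g : α → EuclideanSpace ℝ (Fin n)} (hf : Measurable f) (hg : Measurable g) :
    Measurable (fun a => hke (f a) (g a)) :=
  hke_measurable.comp (hf.prodMk hg)

lemma hk_integral {t : ℝ} (ht : 0 < t) : ∫ z : EuclideanSpace ℝ (Fin n), hk t z = 1 := by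
  have h := GaussianFourier.integral_rexp_neg_mul_sq_norm (V := EuclideanSpace ℝ (Fin n))
    (b := 1 / (4 * t)) (by positivity)
  have h2 : ∀ z : EuclideanSpace ℝ (Fin n),
      hk t z = (4 * Real.pi * t) ^ (-(n : ℝ) / 2) * Real.exp (-(1 / (4 * t)) * ‖z‖ ^ 2) := by
    intro z; unfold hk; congr 2; field_simp
  simp_rw [h2]
  rw [integral_const_mul, h]
  have : Real.pi / (1 / (4 * t)) = 4 * Real.pi * t := by field_simp
  rw [this, ← Real.rpow_add (by positivity)]
  simp only [finrank_euclideanSpace, Fintype.card_fin]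
  rw [show -(n : ℝ) / 2 + (n : ℝ) / 2 = 0 by ring, Real.rpow_zero]

lemma hk_integrable {t : ℝ} (ht : 0 < t) :
    Integrable (fun z : EuclideanSpace ℝ (Fin n) => hk t z) := by
  by_contra h
  have := integral_undef h
  rw [hk_integral ht] at this
  exact one_ne_zero this

lemma hke_lintegral {t : ℝ} (ht : 0 < t) : ∫⁻ z : EuclideanSpace ℝ (Fin n), hke t z = 1 := by
  unfold hke
  rw [← ofReal_integral_eq_lintegral_ofReal (hk_integrable ht)
    (Eventually.of_forall fun z => (hk_pos ht z).le), hk_integral ht, ENNReal.ofReal_one]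

lemma hk_prod {a b : ℝ} (ha : 0 < a) (hb : 0 < b) (x y z : EuclideanSpace ℝ (Fin n)) :
    hk a (x - y) * hk b (y - z) =
      hk (a + b) (x - z) * hk (a * b / (a + b)) (y - ((b / (a + b)) • x + (a / (a + b)) • z)) := by
  have hab : 0 < a + b := by positivity
  have hc : (4 * Real.pi * a) * (4 * Real.pi * b) =
      (4 * Real.pi * (a + b)) * (4 * Real.pi * (a * b / (a + b))) := by field_simp
  have key : -‖x - y‖ ^ 2 / (4 * a) + -‖y - z‖ ^ 2 / (4 * b) =
      -‖x - z‖ ^ 2 / (4 * (a + b)) +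
      -‖y - ((b / (a + b)) • x + (a / (a + b)) • z)‖ ^ 2 / (4 * (a * b / (a + b))) := by
    obtain ⟨p, hp⟩ : ∃ p, p = x - y := ⟨_, rfl⟩
    obtain ⟨q, hq⟩ : ∃ q, q = y - z := ⟨_, rfl⟩
    have h1 : x - z = p + q := by rw [hp, hq]; abel
    have h2 : y - ((b / (a + b)) • x + (a / (a + b)) • z) =
        (a / (a + b)) • q - (b / (a + b)) • p := by
      have : y = (a / (a + b)) • y + (b / (a + b)) • y := by
        rw [← add_smul, ← add_div, div_self hab.ne', one_smul]
      rw [hp, hq, smul_sub, smul_sub]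
      nth_rewrite 1 [this]
      abel
    rw [h1, h2, ← hp, ← hq, norm_add_sq_real, norm_sub_sq_real, norm_smul, norm_smul,
      inner_smul_left, inner_smul_right, real_inner_comm]
    simp only [Real.norm_eq_abs, mul_pow, sq_abs, conj_trivial]
    field_simp
    ring
  unfold hk
  rw [mul_mul_mul_comm, mul_mul_mul_comm _ (Real.exp _), ← Real.exp_add, ← Real.exp_add, key,
    ← Real.mul_rpow (by positivity) (by positivity), hc,
    Real.mul_rpow (by positivity) (by positivity)]

lemma hke_semigroup {a b : ℝ} (ha : 0 < a) (hb : 0 < b) (x z : EuclideanSpace ℝ (Fin n)) :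
    ∫⁻ y, hke a (x - y) * hke b (y - z) = hke (a + b) (x - z) := by
  have hab : 0 < a + b := by positivity
  have : ∀ y, hke a (x - y) * hke b (y - z) = hke (a + b) (x - z) *
      hke (a * b / (a + b)) (y - ((b / (a + b)) • x + (a / (a + b)) • z)) := by
    intro y
    unfold hke
    rw [← ENNReal.ofReal_mul (hk_pos ha _).le, hk_prod ha hb,
      ENNReal.ofReal_mul (hk_pos hab _).le]
  simp_rw [this]
  rw [lintegral_const_mul _ (by fun_prop),
    lintegral_sub_right_eq_self (fun y => hke (a * b / (a + b)) y), hke_lintegral (by positivity),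
    mul_one]

lemma hS_hS {a b : ℝ} (ha : 0 < a) (hb : 0 < b) {f : EuclideanSpace ℝ (Fin n) → ℝ≥0∞}
    (hf : Measurable f) (x : EuclideanSpace ℝ (Fin n)) :
    hS a (hS b f) x = hS (a + b) f x := by
  unfold hS
  have : ∀ y, hke a (x - y) * ∫⁻ z, hke b (y - z) * f z =
      ∫⁻ z, hke a (x - y) * (hke b (y - z) * f z) := by
    intro y; rw [lintegral_const_mul _ (by fun_prop)]
  simp_rw [this]
  rw [lintegral_lintegral_swap (by fun_prop)]
  congr 1; ext z
  simp_rw [← mul_assoc]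
  rw [lintegral_mul_const _ (by fun_prop), hke_semigroup ha hb]

lemma hS_mono {t : ℝ} {f g : EuclideanSpace ℝ (Fin n) → ℝ≥0∞} (h : ∀ z, f z ≤ g z)
    (x : EuclideanSpace ℝ (Fin n)) : hS t f x ≤ hS t g x :=
  lintegral_mono fun z => mul_le_mul_right (h z) _

lemma hS_const {t : ℝ} (ht : 0 < t) (c : ℝ≥0∞) (x : EuclideanSpace ℝ (Fin n)) :
    hS t (fun _ => c) x = c := by
  unfold hS
  rw [lintegral_mul_const _ (by fun_prop)]
  simp_rw [hke_sub_comm t x]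
  rw [lintegral_sub_right_eq_self (fun y => hke t y), hke_lintegral ht, one_mul]

lemma hS_add {t : ℝ} {f g : EuclideanSpace ℝ (Fin n) → ℝ≥0∞} (hf : Measurable f)
    (x : EuclideanSpace ℝ (Fin n)) : hS t (fun z => f z + g z) x = hS t f x + hS t g x := by
  unfold hS
  simp_rw [mul_add]
  rw [lintegral_add_left (by fun_prop)]

lemma hS_const_mul {t : ℝ} (c : ℝ≥0∞) {f : EuclideanSpace ℝ (Fin n) → ℝ≥0∞} (hf : Measurable f)
    (x : EuclideanSpace ℝ (Fin n)) : hS t (fun z => c * f z) x = c * hS t f x := by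
  unfold hS
  rw [← lintegral_const_mul _ (by fun_prop)]
  congr 1; ext z; ring

lemma hk_scale {τ : ℝ} (hτ : 0 < τ) (ζ : EuclideanSpace ℝ (Fin n)) :
    hk τ (Real.sqrt τ • ζ) = (Real.sqrt τ ^ n)⁻¹ * hk 1 ζ := by
  unfold hk
  rw [norm_smul, Real.norm_eq_abs, abs_of_nonneg (Real.sqrt_nonneg _), mul_pow,
    Real.sq_sqrt hτ.le]
  rw [Real.mul_rpow (by positivity) hτ.le, mul_one]
  have : τ ^ (-(n : ℝ) / 2) = (Real.sqrt τ ^ n)⁻¹ := by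
    rw [Real.sqrt_eq_rpow, ← Real.rpow_natCast, ← Real.rpow_mul hτ.le, ← Real.rpow_neg hτ.le]
    congr 1; ring
  rw [this]
  have : -(τ * ‖ζ‖ ^ 2) / (4 * τ) = -‖ζ‖ ^ 2 / (4 * 1) := by field_simp
  rw [this]; ring

lemma hS_scale {τ : ℝ} (hτ : 0 < τ) (f : EuclideanSpace ℝ (Fin n) → ℝ≥0∞)
    (x : EuclideanSpace ℝ (Fin n)) :
    hS τ f x = ∫⁻ ζ, hke 1 ζ * f (x + Real.sqrt τ • ζ) := by
  have hs : 0 < Real.sqrt τ := Real.sqrt_pos.2 hτ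
  unfold hS
  have e1 : ∫⁻ z, hke τ (x - z) * f z = ∫⁻ z, hke τ z * f (x + z) := by
    rw [← lintegral_add_left_eq_self _ x]
    congr 1; ext z
    rw [hke_sub_comm, add_sub_cancel_left]
  rw [e1]
  have emb : MeasurableEmbedding (fun z : EuclideanSpace ℝ (Fin n) => Real.sqrt τ • z) :=
    (Homeomorph.smulOfNeZero (Real.sqrt τ) hs.ne').measurableEmbedding
  have e2 := emb.lintegral_map (μ := volume) (fun z => hke τ z * f (x + z))
  rw [Measure.map_addHaar_smul volume hs.ne', lintegral_smul_measure, finrank_euclideanSpace,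
    Fintype.card_fin, abs_of_pos (by positivity)] at e2
  have e3 : ∀ ζ : EuclideanSpace ℝ (Fin n), hke τ (Real.sqrt τ • ζ) * f (x + Real.sqrt τ • ζ) =
      ENNReal.ofReal (Real.sqrt τ ^ n)⁻¹ * (hke 1 ζ * f (x + Real.sqrt τ • ζ)) := by
    intro ζ
    rw [hke, hk_scale hτ, ENNReal.ofReal_mul (by positivity), mul_assoc, hke]
  simp_rw [e3] at e2
  rw [lintegral_const_mul' _ _ ENNReal.ofReal_ne_top, smul_eq_mul] at e2
  exact (ENNReal.mul_right_inj (by simp; positivity) ENNReal.ofReal_ne_top).1 e2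

lemma hk_sq_le {t : ℝ} (ht : 0 < t) (z : EuclideanSpace ℝ (Fin n)) :
    ‖z‖ ^ 2 * hk t z ≤ 8 * t * 2 ^ ((n : ℝ) / 2) * hk (2 * t) z := by
  have h1 : ‖z‖ ^ 2 / (8 * t) ≤ Real.exp (‖z‖ ^ 2 / (8 * t)) := by
    have := Real.add_one_le_exp (‖z‖ ^ 2 / (8 * t)); linarith
  have h2 : ‖z‖ ^ 2 ≤ 8 * t * Real.exp (‖z‖ ^ 2 / (8 * t)) := by
    rw [div_le_iff₀ (by positivity)] at h1; linarith
  have h3 : hk t z * Real.exp (‖z‖ ^ 2 / (8 * t)) = 2 ^ ((n : ℝ) / 2) * hk (2 * t) z := by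
    unfold hk
    rw [show 4 * Real.pi * (2 * t) = 2 * (4 * Real.pi * t) by ring,
      Real.mul_rpow (x := 2) (by positivity) (by positivity), mul_assoc, ← Real.exp_add,
      ← mul_assoc, ← mul_assoc, ← Real.rpow_add (by positivity : (0:ℝ) < 2)]
    rw [show (n : ℝ) / 2 + -(n : ℝ) / 2 = 0 by ring, Real.rpow_zero, one_mul]
    congr 2
    field_simp
    ring
  calc ‖z‖ ^ 2 * hk t z ≤ (8 * t * Real.exp (‖z‖ ^ 2 / (8 * t))) * hk t z :=
        mul_le_mul_of_nonneg_right h2 (hk_pos ht z).le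
    _ = 8 * t * (hk t z * Real.exp (‖z‖ ^ 2 / (8 * t))) := by ring
    _ = _ := by rw [h3]; ring

lemma hk_sq_integrable {t : ℝ} (ht : 0 < t) :
    Integrable (fun z : EuclideanSpace ℝ (Fin n) => ‖z‖ ^ 2 * hk t z) := by
  refine ((hk_integrable (n := n) (t := 2 * t) (by positivity)).const_mul
    (8 * t * 2 ^ ((n : ℝ) / 2))).mono' (by fun_prop) (Eventually.of_forall fun z => ?_)
  rw [Real.norm_of_nonneg (by have := (hk_pos ht z).le; positivity)]
  exact hk_sq_le ht z

lemma hk_norm_integrable {t : ℝ} (ht : 0 < t) :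
    Integrable (fun z : EuclideanSpace ℝ (Fin n) => ‖z‖ * hk t z) := by
  refine ((hk_integrable (n := n) ht).add (hk_sq_integrable ht)).mono' (by fun_prop)
    (Eventually.of_forall fun z => ?_)
  have := (hk_pos ht z).le
  rw [Real.norm_of_nonneg (by positivity)]
  simp only [Pi.add_apply]
  nlinarith [sq_nonneg (‖z‖ - 1), norm_nonneg z]

/-- second moment constant -/
def mtwo (n : ℕ) : ℝ := ∫ z : EuclideanSpace ℝ (Fin n), ‖z‖ ^ 2 * hk 1 z

lemma mtwo_nonneg : 0 ≤ mtwo n :=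
  integral_nonneg fun z => mul_nonneg (by positivity) (hk_pos one_pos z).le

lemma ofReal_integral_le_aux {α : Type*} [MeasurableSpace α] {μ : Measure α} {f : α → ℝ}
    (hf : Integrable f μ) : ENNReal.ofReal (∫ x, f x ∂μ) ≤ ∫⁻ x, ENNReal.ofReal (f x) ∂μ := by
  have h1 : ∫ x, f x ∂μ ≤ ∫ x, max (f x) 0 ∂μ :=
    integral_mono hf hf.pos_part fun x => le_max_left _ _
  refine (ENNReal.ofReal_le_ofReal h1).trans ?_
  rw [ofReal_integral_eq_lintegral_ofReal hf.pos_part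
    (Eventually.of_forall fun x => le_max_right _ _)]
  refine lintegral_mono fun x => ?_
  simp

lemma hS_lower {c δ τ : ℝ} (hc : 0 ≤ c) (hδ : 0 < δ) (hτ : 0 < τ)
    {f : EuclideanSpace ℝ (Fin n) → ℝ≥0∞} {x : EuclideanSpace ℝ (Fin n)}
    (hf : ∀ z, dist z x < δ → ENNReal.ofReal c ≤ f z) :
    ENNReal.ofReal (c * (1 - mtwo n * τ / δ ^ 2)) ≤ hS τ f x := by
  rw [hS_scale hτ]
  have hInteg : Integrable (fun ζ : EuclideanSpace ℝ (Fin n) =>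
      c * hk 1 ζ - c * τ / δ ^ 2 * (‖ζ‖ ^ 2 * hk 1 ζ)) :=
    ((hk_integrable one_pos).const_mul c).sub ((hk_sq_integrable one_pos).const_mul _)
  have hval : ∫ ζ : EuclideanSpace ℝ (Fin n),
      (c * hk 1 ζ - c * τ / δ ^ 2 * (‖ζ‖ ^ 2 * hk 1 ζ)) = c * (1 - mtwo n * τ / δ ^ 2) := by
    rw [integral_sub ((hk_integrable one_pos).const_mul c)
      ((hk_sq_integrable one_pos).const_mul _), integral_const_mul, integral_const_mul,
      hk_integral one_pos, mtwo]
    ring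
  rw [← hval]
  refine (ofReal_integral_le_aux hInteg).trans (lintegral_mono fun ζ => ?_)
  by_cases h : dist (x + Real.sqrt τ • ζ) x < δ
  · refine le_trans ?_ (mul_le_mul_right (hf _ h) _)
    rw [hke, ← ENNReal.ofReal_mul (hk_pos one_pos _).le]
    apply ENNReal.ofReal_le_ofReal
    have := (hk_pos one_pos ζ).le
    have h2 : 0 ≤ c * τ / δ ^ 2 * (‖ζ‖ ^ 2 * hk 1 ζ) := by positivity
    linarith
  · have h1 : c * hk 1 ζ - c * τ / δ ^ 2 * (‖ζ‖ ^ 2 * hk 1 ζ) ≤ 0 := by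
      rw [dist_eq_norm, add_sub_cancel_left, norm_smul, Real.norm_of_nonneg (Real.sqrt_nonneg _),
        not_lt] at h
      have h2 : δ ^ 2 ≤ τ * ‖ζ‖ ^ 2 := by
        calc δ ^ 2 ≤ (Real.sqrt τ * ‖ζ‖) ^ 2 := by gcongr
          _ = _ := by rw [mul_pow, Real.sq_sqrt hτ.le]
      have h3 : 1 ≤ τ * ‖ζ‖ ^ 2 / δ ^ 2 := by rwa [one_le_div (by positivity)]
      have := mul_nonneg hc (hk_pos one_pos ζ).le
      calc c * hk 1 ζ - c * τ / δ ^ 2 * (‖ζ‖ ^ 2 * hk 1 ζ)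
          = (c * hk 1 ζ) * (1 - τ * ‖ζ‖ ^ 2 / δ ^ 2) := by ring
        _ ≤ 0 := mul_nonpos_of_nonneg_of_nonpos this (by linarith)
    rw [ENNReal.ofReal_of_nonpos h1]
    exact zero_le

lemma hk_fderiv {t : ℝ} (ht : 0 < t) (z v : EuclideanSpace ℝ (Fin n)) :
    HasFDerivAt (fun z => hk t z) ((-(hk t z / (2 * t))) • innerSL ℝ z) z := by
  have h1 : HasFDerivAt (fun z : EuclideanSpace ℝ (Fin n) => ‖z‖ ^ 2) (2 • innerSL ℝ z) z :=
    (hasStrictFDerivAt_norm_sq z).hasFDerivAt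
  have h2 := (((h1.neg.mul_const (4 * t)⁻¹).exp).const_mul ((4 * Real.pi * t) ^ (-(n : ℝ) / 2)))
  refine HasFDerivAt.congr_fderiv (f := fun z => hk t z) h2 ?_
  ext w
  unfold hk
  simp [div_eq_mul_inv]
  field_simp
  ring

lemma hk_moment (i j : Fin n) :
    ∫ z : EuclideanSpace ℝ (Fin n), z i * z j * hk 1 z = if i = j then 2 else 0 := by
  have hfd : ∀ z : EuclideanSpace ℝ (Fin n),
      fderiv ℝ (fun z : EuclideanSpace ℝ (Fin n) => hk 1 z) z (EuclideanSpace.single i 1) =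
      -(1 / 2) * (z i * hk 1 z) := by
    intro z
    rw [(hk_fderiv one_pos z z).fderiv]
    simp [EuclideanSpace.inner_single_right]
    ring
  have hlin : ∀ z : EuclideanSpace ℝ (Fin n),
      HasFDerivAt (fun z : EuclideanSpace ℝ (Fin n) => z j)
      (EuclideanSpace.proj j : EuclideanSpace ℝ (Fin n) →L[ℝ] ℝ) z :=
    fun z => (EuclideanSpace.proj j : EuclideanSpace ℝ (Fin n) →L[ℝ] ℝ).hasFDerivAt
  have hli : ∀ z : EuclideanSpace ℝ (Fin n),
      fderiv ℝ (fun z : EuclideanSpace ℝ (Fin n) => z j) z (EuclideanSpace.single i 1) =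
      if i = j then 1 else 0 := by
    intro z
    rw [(hlin z).fderiv]
    simp [eq_comm]
  have hij : Integrable (fun z : EuclideanSpace ℝ (Fin n) => z j * (-(1 / 2) * (z i * hk 1 z))) := by
    refine (hk_sq_integrable (n := n) one_pos).mono' (by fun_prop)
      (Eventually.of_forall fun z => ?_)
    have h1 := PiLp.norm_apply_le z i
    have h2 := PiLp.norm_apply_le z j
    have h0 := (hk_pos one_pos z).le
    rw [norm_mul, norm_mul, norm_mul, Real.norm_of_nonneg h0]
    have : ‖(-(1 / 2) : ℝ)‖ ≤ 1 := by norm_num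
    calc ‖z j‖ * (‖(-(1 / 2) : ℝ)‖ * (‖z i‖ * hk 1 z)) ≤ ‖z‖ * (1 * (‖z‖ * hk 1 z)) := by gcongr
      _ = _ := by ring
  have hj : Integrable (fun z : EuclideanSpace ℝ (Fin n) => z j * hk 1 z) := by
    refine (hk_norm_integrable (n := n) one_pos).mono' (by fun_prop)
      (Eventually.of_forall fun z => ?_)
    have h2 := PiLp.norm_apply_le z j
    have h0 := (hk_pos one_pos z).le
    rw [norm_mul, Real.norm_of_nonneg h0]
    gcongr
  have := integral_mul_fderiv_eq_neg_fderiv_mul_of_integrable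
    (μ := (volume : Measure (EuclideanSpace ℝ (Fin n))))
    (f := fun z : EuclideanSpace ℝ (Fin n) => z j) (g := fun z => hk 1 z)
    (v := EuclideanSpace.single i 1)
    (by simp_rw [hli]; exact (hk_integrable one_pos).const_mul _)
    (by simp_rw [hfd]; exact hij) hj
    (fun z _ => (hlin z).differentiableAt) (fun z _ => (hk_fderiv one_pos z z).differentiableAt)
  simp_rw [hli, hfd] at this
  rw [integral_const_mul, hk_integral one_pos] at this
  have e : ∀ z : EuclideanSpace ℝ (Fin n), z i * z j * hk 1 z =
      (-2) * (z j * (-(1 / 2) * (z i * hk 1 z))) := by intro z; ring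
  simp_rw [e]
  rw [integral_const_mul, this]
  split_ifs <;> ring

end kernel
end

open MeasureTheory Set Filter Topology
open scoped ENNReal NNReal

noncomputable section

/-- `c` is the second derivative of `g` at `x` in the direction `e` -/
def LineSecond {n : ℕ} (g : EuclideanSpace ℝ (Fin n) → ℝ) (x e : EuclideanSpace ℝ (Fin n))
    (c : ℝ) : Prop :=
  ∃ g' : ℝ → ℝ, (∀ᶠ s in 𝓝 (0 : ℝ), HasDerivAt (fun s : ℝ => g (x + s • e)) (g' s) s) ∧
    HasDerivAt g' c 0

/-- heat extension of a continuous compactly supported function -/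
def hE {n : ℕ} (φ : EuclideanSpace ℝ (Fin n) → ℝ) (x : EuclideanSpace ℝ (Fin n)) (τ : ℝ) : ℝ :=
  ∫ ζ, hk 1 ζ * φ (x + Real.sqrt τ • ζ)

section heatext
variable {n : ℕ}

lemma LineSecond.sub {f g : EuclideanSpace ℝ (Fin n) → ℝ} {x e : EuclideanSpace ℝ (Fin n)}
    {c d : ℝ} (hf : LineSecond f x e c) (hg : LineSecond g x e d) :
    LineSecond (fun y => f y - g y) x e (c - d) := by
  obtain ⟨f', hf1, hf2⟩ := hf
  obtain ⟨g', hg1, hg2⟩ := hg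
  refine ⟨fun s => f' s - g' s, ?_, hf2.sub hg2⟩
  filter_upwards [hf1, hg1] with s h1 h2 using h1.sub h2

lemma LineSecond.add_const {f : EuclideanSpace ℝ (Fin n) → ℝ} {x e : EuclideanSpace ℝ (Fin n)}
    {c : ℝ} (hf : LineSecond f x e c) (k : ℝ) :
    LineSecond (fun y => f y + k) x e c := by
  obtain ⟨f', hf1, hf2⟩ := hf
  exact ⟨f', hf1.mono fun s hs => hs.add_const k, hf2⟩

lemma LineSecond.of_contDiff {f : EuclideanSpace ℝ (Fin n) → ℝ} (hf : ContDiff ℝ 2 f)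
    (x e : EuclideanSpace ℝ (Fin n)) :
    LineSecond f x e (fderiv ℝ (fun y => fderiv ℝ f y e) x e) := by
  have hl : ∀ s : ℝ, HasDerivAt (fun s : ℝ => x + s • e) e s := fun s => by
    simpa using ((hasDerivAt_id s).smul_const e).const_add x
  refine ⟨fun s => fderiv ℝ f (x + s • e) e, Eventually.of_forall fun s => ?_, ?_⟩
  · have := (hf.differentiable (by norm_num) (x + s • e)).hasFDerivAt
    exact this.comp_hasDerivAt s (hl s)
  · have h1 : ContDiff ℝ 1 (fun y => fderiv ℝ f y e) :=
      (hf.fderiv_right (m := 1) (by norm_num)).clm_apply contDiff_const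
    have h2 := (h1.differentiable (by norm_num) (x + (0 : ℝ) • e)).hasFDerivAt
    have h3 := h2.comp_hasDerivAt (0 : ℝ) (hl 0)
    rw [zero_smul, add_zero] at h3
    exact h3

lemma LineSecond.nonneg_of_min {f : EuclideanSpace ℝ (Fin n) → ℝ} {x e : EuclideanSpace ℝ (Fin n)}
    {c : ℝ} (hf : LineSecond f x e c) (hm : IsLocalMin f x) : 0 ≤ c := by
  obtain ⟨f', h1, h2⟩ := hf
  by_contra hc
  push Not at hc
  have hcont : Tendsto (fun s : ℝ => x + s • e) (𝓝 0) (𝓝 x) := by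
    have : Continuous (fun s : ℝ => x + s • e) := by fun_prop
    simpa using this.tendsto 0
  have hm' : IsLocalMin (fun s : ℝ => f (x + s • e)) 0 := by
    have := hcont.eventually hm
    filter_upwards [this] with s hs
    simpa using hs
  have h0 : f' 0 = 0 := hm'.hasDerivAt_eq_zero h1.self_of_nhds
  have hlt : ∀ᶠ s in 𝓝[>] (0 : ℝ), f' s < 0 := by
    have := (hasDerivAt_iff_tendsto_slope.1 h2).eventually (gt_mem_nhds hc)
    have h3 : ∀ᶠ s in 𝓝[>] (0 : ℝ), slope f' 0 s < 0 :=
      this.filter_mono (nhdsWithin_mono _ fun s hs => (ne_of_gt hs))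
    filter_upwards [h3, self_mem_nhdsWithin] with s hs hs0
    rw [slope_def_field, h0, sub_zero, sub_zero] at hs
    have hs0' : 0 < s := hs0
    by_contra hcon
    push Not at hcon
    exact absurd hs (not_lt.2 (div_nonneg hcon hs0'.le))
  obtain ⟨δ, hδ, hδ'⟩ := mem_nhdsGT_iff_exists_Ioo_subset.1 hlt
  obtain ⟨η, hη, hη'⟩ := Metric.eventually_nhds_iff.1 (h1.and hm')
  have hδ0 : (0 : ℝ) < δ := hδ
  set r := min (δ / 2) (η / 2) with hr
  have hr0 : 0 < r := by positivity
  have hanti : StrictAntiOn (fun s : ℝ => f (x + s • e)) (Icc 0 r) := by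
    have hder : ∀ s ∈ Icc 0 r, HasDerivAt (fun s : ℝ => f (x + s • e)) (f' s) s := by
      intro s hs
      refine (hη' ?_).1
      rw [Real.dist_eq, sub_zero, abs_of_nonneg hs.1]
      have := min_le_right (δ / 2) (η / 2)
      linarith [hs.2]
    refine strictAntiOn_of_deriv_neg (convex_Icc _ _)
      (fun s hs => (hder s hs).continuousAt.continuousWithinAt) fun s hs => ?_
    rw [interior_Icc] at hs
    rw [(hder s ⟨hs.1.le, hs.2.le⟩).deriv]
    refine hδ' ⟨hs.1, ?_⟩
    have := min_le_left (δ / 2) (η / 2)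
    linarith [hs.2]
  have h4 := hanti ⟨le_rfl, hr0.le⟩ ⟨hr0.le, le_rfl⟩ hr0
  have h5 : f (x + (0 : ℝ) • e) ≤ f (x + r • e) := by
    refine (hη' (y := r) ?_).2
    rw [Real.dist_eq, sub_zero, abs_of_nonneg hr0.le]
    have := min_le_right (δ / 2) (η / 2)
    linarith
  exact absurd h4 (not_lt.2 h5)

lemma hasDerivAt_integral_compact {G G' : ℝ → EuclideanSpace ℝ (Fin n) → ℝ} {s0 r : ℝ}
    (hr : 0 < r) {φ : EuclideanSpace ℝ (Fin n) → ℝ} (hφ : Continuous φ)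
    (hφc : HasCompactSupport φ)
    (hG : ∀ s ∈ Metric.closedBall s0 r, Continuous (G s))
    (hder : ∀ s ∈ Metric.closedBall s0 r, ∀ z, HasDerivAt (fun s => G s z) (G' s z) s)
    (hG' : ContinuousOn (fun q : ℝ × EuclideanSpace ℝ (Fin n) => G' q.1 q.2)
      (Metric.closedBall s0 r ×ˢ univ)) :
    HasDerivAt (fun s => ∫ z, G s z * φ z) (∫ z, G' s0 z * φ z) s0 := by
  have hs0 : s0 ∈ Metric.closedBall s0 r := Metric.mem_closedBall_self hr.le
  have hcomp : IsCompact (Metric.closedBall s0 r ×ˢ tsupport φ) :=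
    (isCompact_closedBall s0 r).prod hφc
  obtain ⟨C, hC⟩ := hcomp.exists_bound_of_continuousOn
    (hG'.mono (prod_mono_right (subset_univ _)))
  have hcz : ∀ s ∈ Metric.closedBall s0 r, Continuous (G' s) := by
    intro s hs
    have : ContinuousOn (fun z => G' s z) univ :=
      hG'.comp (f := fun z => (s, z)) (by fun_prop) (fun z _ => ⟨hs, mem_univ _⟩)
    exact continuousOn_univ.1 this
  refine (hasDerivAt_integral_of_dominated_loc_of_deriv_le (F := fun s z => G s z * φ z)
    (F' := fun s z => G' s z * φ z) (s := Metric.ball s0 r)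
    (bound := fun z => C * ‖φ z‖) (Metric.ball_mem_nhds _ hr) ?_ ?_ ?_ ?_ ?_ ?_).2
  · filter_upwards [Metric.ball_mem_nhds s0 hr] with s hs
    exact ((hG s (Metric.ball_subset_closedBall hs)).mul hφ).aestronglyMeasurable
  · exact ((hG s0 hs0).mul hφ).integrable_of_hasCompactSupport hφc.mul_left
  · exact ((hcz s0 hs0).mul hφ).aestronglyMeasurable
  · refine Eventually.of_forall fun z s hs => ?_
    rw [norm_mul]
    by_cases hz : z ∈ tsupport φ
    · exact mul_le_mul_of_nonneg_right
        (hC (s, z) ⟨Metric.ball_subset_closedBall hs, hz⟩) (norm_nonneg _)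
    · rw [image_eq_zero_of_notMem_tsupport hz]; simp
  · exact ((continuous_const.mul hφ.norm).integrable_of_hasCompactSupport hφc.norm.mul_left)
  · exact Eventually.of_forall fun z s hs =>
      (hder s (Metric.ball_subset_closedBall hs) z).mul_const _

lemma hE_continuous {φ : EuclideanSpace ℝ (Fin n) → ℝ} (hφ : Continuous φ)
    (hφc : HasCompactSupport φ) :
    Continuous (fun q : EuclideanSpace ℝ (Fin n) × ℝ => hE φ q.1 q.2) := by
  obtain ⟨C, hC⟩ := hφ.bounded_above_of_compact_support hφc
  unfold hE
  refine continuous_of_dominated (bound := fun ζ => hk 1 ζ * C) (fun q => ?_) (fun q => ?_)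
    ((hk_integrable one_pos).mul_const C) ?_
  · exact (by fun_prop : Continuous _).aestronglyMeasurable
  · refine Eventually.of_forall fun ζ => ?_
    rw [norm_mul, Real.norm_of_nonneg (hk_pos one_pos ζ).le]
    exact mul_le_mul_of_nonneg_left (hC _) (hk_pos one_pos ζ).le
  · refine Eventually.of_forall fun ζ => ?_
    fun_prop

lemma hE_zero (φ : EuclideanSpace ℝ (Fin n) → ℝ) (x : EuclideanSpace ℝ (Fin n)) :
    hE φ x 0 = φ x := by
  simp [hE, integral_mul_const, hk_integral one_pos]

lemma hE_eq (φ : EuclideanSpace ℝ (Fin n) → ℝ) (x : EuclideanSpace ℝ (Fin n)) {τ : ℝ}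
    (hτ : 0 < τ) : hE φ x τ = ∫ z, hk τ (x - z) * φ z := by
  have hs : 0 < Real.sqrt τ := Real.sqrt_pos.2 hτ
  have e1 : ∫ z, hk τ (x - z) * φ z = ∫ z, hk τ z * φ (x + z) := by
    rw [← integral_add_left_eq_self _ x]
    congr 1; ext z
    rw [hk_sub_comm, add_sub_cancel_left]
  have e2 := Measure.integral_comp_smul (μ := (volume : Measure (EuclideanSpace ℝ (Fin n))))
    (fun z => hk τ z * φ (x + z)) (Real.sqrt τ)
  rw [finrank_euclideanSpace, Fintype.card_fin, abs_of_pos (by positivity)] at e2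
  have e3 : ∀ ζ : EuclideanSpace ℝ (Fin n), hk τ (Real.sqrt τ • ζ) * φ (x + Real.sqrt τ • ζ) =
      (Real.sqrt τ ^ n)⁻¹ * (hk 1 ζ * φ (x + Real.sqrt τ • ζ)) := by
    intro ζ
    rw [hk_scale hτ, mul_assoc]
  simp_rw [e3] at e2
  rw [integral_const_mul, smul_eq_mul] at e2
  rw [e1]
  exact mul_left_cancel₀ (by positivity) e2

lemma hk_time_deriv {τ : ℝ} (hτ : 0 < τ) (y : EuclideanSpace ℝ (Fin n)) :
    HasDerivAt (fun τ => hk τ y) ((‖y‖ ^ 2 / (4 * τ ^ 2) - n / (2 * τ)) * hk τ y) τ := by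
  have h1 : HasDerivAt (fun τ : ℝ => 4 * Real.pi * τ) (4 * Real.pi) τ := by
    simpa using (hasDerivAt_id τ).const_mul (4 * Real.pi)
  have h2 := h1.rpow_const (p := -(n : ℝ) / 2) (Or.inl (by positivity))
  have h3 : HasDerivAt (fun τ : ℝ => 4 * τ) 4 τ := by
    simpa using (hasDerivAt_id τ).const_mul 4
  have h4 := ((hasDerivAt_const τ (-‖y‖ ^ 2)).div h3 (by positivity)).exp
  refine (h2.mul h4).congr_deriv ?_
  unfold hk
  rw [Real.rpow_sub_one (by positivity)]
  simp only [Pi.div_apply]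
  field_simp
  ring

lemma hk_line_deriv {τ : ℝ} (hτ : 0 < τ) (y e : EuclideanSpace ℝ (Fin n)) (s : ℝ) :
    HasDerivAt (fun s : ℝ => hk τ (y + s • e))
      (-(inner ℝ (y + s • e) e / (2 * τ)) * hk τ (y + s • e)) s := by
  have hl : HasDerivAt (fun s : ℝ => y + s • e) e s := by
    simpa using ((hasDerivAt_id s).smul_const e).const_add y
  refine ((hk_fderiv hτ (y + s • e) e).comp_hasDerivAt s hl).congr_deriv ?_
  rw [_root_.smul_apply, innerSL_apply_apply, smul_eq_mul]
  ring

lemma hk_line_deriv2 {τ : ℝ} (hτ : 0 < τ) (y e : EuclideanSpace ℝ (Fin n)) (s : ℝ) :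
    HasDerivAt (fun s : ℝ => -(inner ℝ (y + s • e) e / (2 * τ)) * hk τ (y + s • e))
      ((inner ℝ (y + s • e) e ^ 2 / (4 * τ ^ 2) - ‖e‖ ^ 2 / (2 * τ)) * hk τ (y + s • e)) s := by
  have hl : HasDerivAt (fun s : ℝ => inner ℝ (y + s • e) e) (‖e‖ ^ 2) s := by
    have h : ∀ s : ℝ, inner ℝ (y + s • e) e = inner ℝ y e + s * ‖e‖ ^ 2 := by
      intro s; rw [inner_add_left, inner_smul_left, real_inner_self_eq_norm_sq]; simp
    simp_rw [h]
    simpa using ((hasDerivAt_id s).mul_const (‖e‖ ^ 2)).const_add (inner ℝ y e)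
  refine (((hl.div_const (2 * τ)).neg).mul (hk_line_deriv hτ y e s)).congr_deriv ?_
  simp only [Pi.neg_apply]
  field_simp
  ring

lemma hk_continuousOn : ContinuousOn (fun q : ℝ × EuclideanSpace ℝ (Fin n) => hk q.1 q.2)
    (Ioi 0 ×ˢ univ) := by
  unfold hk
  refine ContinuousOn.mul ?_ ?_
  · refine ContinuousOn.rpow_const (by fun_prop) fun q hq => Or.inl ?_
    have : 0 < q.1 := hq.1
    positivity
  · refine Real.continuous_exp.comp_continuousOn ?_
    refine ContinuousOn.div (by fun_prop) (by fun_prop) fun q hq => ?_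
    have : 0 < q.1 := hq.1
    positivity

lemma hE_deriv {φ : EuclideanSpace ℝ (Fin n) → ℝ} (hφ : Continuous φ)
    (hφc : HasCompactSupport φ) (x : EuclideanSpace ℝ (Fin n)) {τ : ℝ} (hτ : 0 < τ) :
    ∃ (d : ℝ) (c : Fin n → ℝ), HasDerivAt (fun τ => hE φ x τ) d τ ∧
      (∀ i, LineSecond (fun y => hE φ y τ) x (EuclideanSpace.single i 1) (c i)) ∧
      d = ∑ i, c i := by
  refine ⟨∫ z, ((‖x - z‖ ^ 2 / (4 * τ ^ 2) - n / (2 * τ)) * hk τ (x - z)) * φ z,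
    fun i => ∫ z, ((inner ℝ (x - z) (EuclideanSpace.single i 1) ^ 2 / (4 * τ ^ 2) -
      1 / (2 * τ)) * hk τ (x - z)) * φ z, ?_, ?_, ?_⟩
  · have h1 : (fun τ => hE φ x τ) =ᶠ[𝓝 τ] fun τ => ∫ z, hk τ (x - z) * φ z := by
      filter_upwards [lt_mem_nhds hτ] with s hs using hE_eq φ x hs
    refine HasDerivAt.congr_of_eventuallyEq ?_ h1
    have hb : ∀ s ∈ Metric.closedBall τ (τ / 2), 0 < s := by
      intro s hs
      rw [Real.closedBall_eq_Icc] at hs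
      linarith [hs.1]
    refine hasDerivAt_integral_compact (G := fun s z => hk s (x - z))
      (G' := fun s z => (‖x - z‖ ^ 2 / (4 * s ^ 2) - n / (2 * s)) * hk s (x - z))
      (r := τ / 2) (by positivity) hφ hφc ?_ ?_ ?_
    · intro s hs; fun_prop
    · intro s hs z; exact hk_time_deriv (hb s hs) _
    · refine ContinuousOn.mul ?_ ?_
      · refine ContinuousOn.sub (ContinuousOn.div (by fun_prop) (by fun_prop) ?_)
          (ContinuousOn.div (by fun_prop) (by fun_prop) ?_)
        · intro q hq; have := hb q.1 hq.1; positivity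
        · intro q hq; have := hb q.1 hq.1; positivity
      · exact hk_continuousOn.comp (f := fun q : ℝ × EuclideanSpace ℝ (Fin n) => (q.1, x - q.2))
          (by fun_prop) (fun q hq => ⟨hb q.1 hq.1, mem_univ _⟩)
  · intro i
    set e : EuclideanSpace ℝ (Fin n) := EuclideanSpace.single i 1 with he
    have he1 : ‖e‖ = 1 := by simp [he]
    refine ⟨fun s => ∫ z, (-(inner ℝ ((x - z) + s • e) e / (2 * τ)) * hk τ ((x - z) + s • e)) * φ z,
      Eventually.of_forall fun s => ?_, ?_⟩
    · have h1 : (fun s : ℝ => hE φ (x + s • e) τ) = fun s : ℝ => ∫ z, hk τ ((x - z) + s • e) * φ z := by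
        ext s; rw [hE_eq _ _ hτ]; congr 1; ext z; rw [add_sub_right_comm]
      rw [h1]
      refine hasDerivAt_integral_compact (G := fun s z => hk τ ((x - z) + s • e))
        (G' := fun s z => -(inner ℝ ((x - z) + s • e) e / (2 * τ)) * hk τ ((x - z) + s • e))
        (r := 1) one_pos hφ hφc ?_ ?_ ?_
      · intro s hs; fun_prop
      · intro s hs z; exact hk_line_deriv hτ _ _ _
      · fun_prop
    · have := hasDerivAt_integral_compact (s0 := (0 : ℝ))
        (G := fun s z => -(inner ℝ ((x - z) + s • e) e / (2 * τ)) * hk τ ((x - z) + s • e))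
        (G' := fun s z => (inner ℝ ((x - z) + s • e) e ^ 2 / (4 * τ ^ 2) - ‖e‖ ^ 2 / (2 * τ)) *
          hk τ ((x - z) + s • e))
        (r := 1) one_pos hφ hφc (fun s hs => by fun_prop)
        (fun s hs z => hk_line_deriv2 hτ _ _ _) (by fun_prop)
      simpa [he1] using this
  · rw [← integral_finsetSum]
    · congr 1; ext z
      rw [← Finset.sum_mul, ← Finset.sum_mul, Finset.sum_sub_distrib, ← Finset.sum_div]
      congr 3
      · simp [EuclideanSpace.norm_sq_eq, EuclideanSpace.inner_single_right]
      · simp; ring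
    · intro i _
      exact (by fun_prop : Continuous _).integrable_of_hasCompactSupport hφc.mul_left

lemma hE_nonneg {φ : EuclideanSpace ℝ (Fin n) → ℝ} (hφ : ∀ z, 0 ≤ φ z)
    (x : EuclideanSpace ℝ (Fin n)) (τ : ℝ) : 0 ≤ hE φ x τ :=
  integral_nonneg fun ζ => mul_nonneg (hk_pos one_pos ζ).le (hφ _)

lemma hE_le {φ : EuclideanSpace ℝ (Fin n) → ℝ} {C : ℝ} (hφ : ∀ z, φ z ≤ C) (hC : 0 ≤ C)
    (x : EuclideanSpace ℝ (Fin n)) (τ : ℝ) : hE φ x τ ≤ C := by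
  by_cases h : Integrable (fun ζ => hk 1 ζ * φ (x + Real.sqrt τ • ζ))
  · calc hE φ x τ ≤ ∫ ζ : EuclideanSpace ℝ (Fin n), hk 1 ζ * C :=
        integral_mono h ((hk_integrable one_pos).mul_const C)
          fun ζ => mul_le_mul_of_nonneg_left (hφ _) (hk_pos one_pos ζ).le
      _ = C := by rw [integral_mul_const, hk_integral one_pos, one_mul]
  · rw [hE, integral_undef h]; exact hC

end heatext
end

open MeasureTheory Set Filter Topology
open scoped ENNReal NNReal

noncomputable section

/-- positive supersolutions of the heat equation, with separate regularity only -/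
structure Supers {n : ℕ} (v : EuclideanSpace ℝ (Fin n) → ℝ → ℝ) : Prop where
  pos : ∀ x t, 0 < t → 0 < v x t
  space : ∀ t, 0 < t → ContDiff ℝ 2 (fun x => v x t)
  time : ∀ x t, 0 < t → DifferentiableAt ℝ (v x) t
  sup : ∀ x t, 0 < t → laplacian (fun y => v y t) x ≤ deriv (v x) t

/-- comparison functions -/
structure SubC {n : ℕ} (R r s : ℝ) (ψ : EuclideanSpace ℝ (Fin n) → ℝ → ℝ) : Prop where
  cont : ContinuousOn (fun q : EuclideanSpace ℝ (Fin n) × ℝ => ψ q.1 q.2)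
    (Metric.closedBall 0 R ×ˢ Icc r s)
  bdry : ∀ x, ‖x‖ = R → ∀ t ∈ Icc r s, ψ x t ≤ 0
  eqn : ∀ x, ‖x‖ < R → ∀ t ∈ Ioc r s, ∃ (d : ℝ) (c : Fin n → ℝ), HasDerivAt (ψ x) d t ∧
    (∀ i, LineSecond (fun y => ψ y t) x (EuclideanSpace.single i 1) (c i)) ∧ d ≤ ∑ i, c i

/-- comparison holds from time r to time s -/
def Cmp {n : ℕ} (v : EuclideanSpace ℝ (Fin n) → ℝ → ℝ) (R r s : ℝ) : Prop :=
  ∀ ψ : EuclideanSpace ℝ (Fin n) → ℝ → ℝ, SubC R r s ψ →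
    (∀ x, ‖x‖ ≤ R → ψ x r ≤ v x r) → ∀ x, ‖x‖ ≤ R → ψ x s ≤ v x s

section comparison
variable {n : ℕ} {v : EuclideanSpace ℝ (Fin n) → ℝ → ℝ} {R : ℝ}

lemma SubC.mono {r s r' s' : ℝ} {ψ : EuclideanSpace ℝ (Fin n) → ℝ → ℝ} (h : SubC R r s ψ)
    (hr : r ≤ r') (hs : s' ≤ s) : SubC R r' s' ψ where
  cont := h.cont.mono (prod_mono_right (Icc_subset_Icc hr hs))
  bdry := fun x hx t ht => h.bdry x hx t (Icc_subset_Icc hr hs ht)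
  eqn := fun x hx t ht => h.eqn x hx t (Ioc_subset_Ioc hr hs ht)

lemma SubC.add_const {r s c : ℝ} {ψ : EuclideanSpace ℝ (Fin n) → ℝ → ℝ} (h : SubC R r s ψ)
    (hc : c ≤ 0) : SubC R r s (fun x t => ψ x t + c) where
  cont := h.cont.add continuousOn_const
  bdry := fun x hx t ht => by have := h.bdry x hx t ht; linarith
  eqn := fun x hx t ht => by
    obtain ⟨d, c', h1, h2, h3⟩ := h.eqn x hx t ht
    exact ⟨d, c', h1.add_const c, fun i => (h2 i).add_const c, h3⟩

lemma SubC.cont_x {r s : ℝ} {ψ : EuclideanSpace ℝ (Fin n) → ℝ → ℝ} (h : SubC R r s ψ)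
    {t : ℝ} (ht : t ∈ Icc r s) : ContinuousOn (fun x => ψ x t) (Metric.closedBall 0 R) :=
  h.cont.comp (f := fun x => (x, t)) (by fun_prop) fun x hx => ⟨hx, ht⟩

lemma SubC.cont_t {r s : ℝ} {ψ : EuclideanSpace ℝ (Fin n) → ℝ → ℝ} (h : SubC R r s ψ)
    {x : EuclideanSpace ℝ (Fin n)} (hx : ‖x‖ ≤ R) : ContinuousOn (fun t => ψ x t) (Icc r s) :=
  h.cont.comp (f := fun t => (x, t)) (by fun_prop) fun t ht => ⟨by simpa using hx, ht⟩

lemma mp_strict (hv : Supers v) (hR : 0 < R) {r s : ℝ} (hr : 0 < r) (hrs : r ≤ s)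
    {ψ : EuclideanSpace ℝ (Fin n) → ℝ → ℝ}
    (hcont : ∀ t ∈ Icc r s, ContinuousOn (fun x => ψ x t) (Metric.closedBall 0 R))
    (hbd : ∀ x, ‖x‖ = R → ∀ t ∈ Icc r s, ψ x t ≤ 0)
    (heqn : ∀ x, ‖x‖ < R → ∀ t ∈ Ioc r s, ∃ (d : ℝ) (c : Fin n → ℝ), HasDerivAt (ψ x) d t ∧
      (∀ i, LineSecond (fun y => ψ y t) x (EuclideanSpace.single i 1) (c i)) ∧ d < ∑ i, c i)
    (hRL : ∀ t ∈ Ico r s, ∀ c' ≤ 0, (∀ x, ‖x‖ ≤ R → c' ≤ v x t - ψ x t) → ∀ c < c',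
      ∀ᶠ t' in 𝓝[>] t, ∀ x, ‖x‖ ≤ R → c ≤ v x t' - ψ x t')
    (hinit : ∀ x, ‖x‖ ≤ R → ψ x r ≤ v x r) : ∀ x, ‖x‖ ≤ R → ψ x s ≤ v x s := by
  intro x1 hx1
  by_contra hlt
  push Not at hlt
  set c0 := v x1 s - ψ x1 s with hc0
  have hc0neg : c0 < 0 := by linarith
  set A : Set ℝ := {t | t ∈ Icc r s ∧ ∀ t' ∈ Icc t s, ∃ x, ‖x‖ ≤ R ∧ v x t' - ψ x t' ≤ c0} with hA
  have hsA : s ∈ A := by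
    refine ⟨⟨hrs, le_rfl⟩, fun t' ht' => ?_⟩
    obtain rfl : t' = s := le_antisymm ht'.2 ht'.1
    exact ⟨x1, hx1, le_rfl⟩
  have hbdd : BddBelow A := ⟨r, fun t ht => ht.1.1⟩
  set t1 := sInf A with ht1
  have hrt1 : r ≤ t1 := le_csInf ⟨s, hsA⟩ fun t ht => ht.1.1
  have ht1s : t1 ≤ s := csInf_le hbdd hsA
  have habove : ∀ t', t1 < t' → t' ≤ s → ∃ x, ‖x‖ ≤ R ∧ v x t' - ψ x t' ≤ c0 := by
    intro t' h1 h2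
    obtain ⟨a, ha, hat⟩ := exists_lt_of_csInf_lt ⟨s, hsA⟩ h1
    exact ha.2 t' ⟨hat.le, h2⟩
  have hcompact : IsCompact (Metric.closedBall (0 : EuclideanSpace ℝ (Fin n)) R) :=
    isCompact_closedBall _ _
  have hne : (Metric.closedBall (0 : EuclideanSpace ℝ (Fin n)) R).Nonempty :=
    ⟨0, Metric.mem_closedBall_self hR.le⟩
  have ht1pos : 0 < t1 := lt_of_lt_of_le hr hrt1
  obtain ⟨xm, hxm, hmin⟩ := hcompact.exists_isMinOn hne
    (((hv.space t1 ht1pos).continuous.continuousOn).sub (hcont t1 ⟨hrt1, ht1s⟩))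
  have hxm' : ‖xm‖ ≤ R := by simpa using hxm
  have hmin' : ∀ x, ‖x‖ ≤ R → v xm t1 - ψ xm t1 ≤ v x t1 - ψ x t1 := fun x hx =>
    hmin (by simpa using hx)
  have hmle : v xm t1 - ψ xm t1 ≤ c0 := by
    rcases ht1s.eq_or_lt with h | h
    · rw [hc0, ← h]; exact hmin' x1 hx1
    · by_contra hgt
      push Not at hgt
      set c' := min (v xm t1 - ψ xm t1) 0 with hc'
      have hc'c : c0 < c' := lt_min hgt hc0neg
      have h1 := hRL t1 ⟨hrt1, h⟩ c' (min_le_right _ _)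
        (fun x hx => (min_le_left _ _).trans (hmin' x hx)) ((c0 + c') / 2) (by linarith)
      have h2 : ∀ᶠ t' in 𝓝[>] t1, t' ∈ Ioc t1 s := Ioc_mem_nhdsGT h
      obtain ⟨t', h3, h4⟩ := (h1.and h2).exists
      obtain ⟨x, hx, hx'⟩ := habove t' h4.1 h4.2
      have := h3 x hx
      linarith
  have hrlt : r < t1 := by
    rcases hrt1.eq_or_lt with h | h
    · have := hinit xm hxm'
      rw [← h] at hmle
      linarith
    · exact h
  have hInteg : ‖xm‖ < R := by
    rcases hxm'.eq_or_lt with h | h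
    · have h1 := hbd xm h t1 ⟨hrt1, ht1s⟩
      have h2 := hv.pos xm t1 ht1pos
      linarith
    · exact h
  obtain ⟨d, c, hd, hc, hdc⟩ := heqn xm hInteg t1 ⟨hrlt, ht1s⟩
  have hloc : IsLocalMin (fun y => v y t1 - ψ y t1) xm := by
    have : ∀ᶠ y in 𝓝 xm, ‖y‖ < R := (continuous_norm.tendsto xm).eventually (gt_mem_nhds hInteg)
    filter_upwards [this] with y hy using hmin' y hy.le
  have hlap : ∑ i, c i ≤ laplacian (fun y => v y t1) xm := by
    unfold laplacian
    refine Finset.sum_le_sum fun i _ => ?_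
    have := ((LineSecond.of_contDiff (hv.space t1 ht1pos) xm
      (EuclideanSpace.single i 1)).sub (hc i)).nonneg_of_min hloc
    linarith
  have hderiv : HasDerivAt (fun t => v xm t - ψ xm t) (deriv (v xm) t1 - d) t1 :=
    (hv.time xm t1 ht1pos).hasDerivAt.sub hd
  have hdp : 0 < deriv (v xm) t1 - d := by
    have := hv.sup xm t1 ht1pos
    linarith
  have hleft : ∀ᶠ t' in 𝓝[<] t1, v xm t' - ψ xm t' < v xm t1 - ψ xm t1 := by
    have h1 := (hasDerivAt_iff_tendsto_slope.1 hderiv).eventually (lt_mem_nhds hdp)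
    have h2 := h1.filter_mono (nhdsWithin_mono t1 (s := Iio t1) fun s hs => ne_of_lt hs)
    filter_upwards [h2, self_mem_nhdsWithin] with t' h3 h4
    have h4' : t' < t1 := h4
    rw [slope_def_field] at h3
    by_contra hcon
    push Not at hcon
    exact absurd h3 (not_lt.2 (div_nonpos_of_nonneg_of_nonpos (by linarith) (by linarith)))
  obtain ⟨l, hl, hl'⟩ := mem_nhdsLT_iff_exists_Ioo_subset.1 hleft
  have hl0 : l < t1 := hl
  set t2 := max ((l + t1) / 2) ((r + t1) / 2) with ht2
  have h21 : t2 < t1 := max_lt (by linarith) (by linarith)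
  have h2l : l < t2 := lt_of_lt_of_le (by linarith) (le_max_left _ _)
  have h2r : r < t2 := lt_of_lt_of_le (by linarith) (le_max_right _ _)
  have ht2A : t2 ∈ A := by
    refine ⟨⟨h2r.le, h21.le.trans ht1s⟩, fun t' ht' => ?_⟩
    rcases lt_trichotomy t' t1 with h | h | h
    · have : v xm t' - ψ xm t' < v xm t1 - ψ xm t1 := hl' ⟨lt_of_lt_of_le h2l ht'.1, h⟩
      exact ⟨xm, hxm', this.le.trans hmle⟩
    · exact ⟨xm, hxm', by rw [h]; exact hmle⟩
    · exact habove t' h ht'.2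
  exact absurd (csInf_le hbdd ht2A) (not_le.2 h21)

lemma mp_weak (hv : Supers v) (hR : 0 < R) {r s : ℝ} (hr : 0 < r) (hrs : r ≤ s)
    {ψ : EuclideanSpace ℝ (Fin n) → ℝ → ℝ} (hψ : SubC R r s ψ)
    (hRL : ∀ t ∈ Ico r s, ∀ c' ≤ 0, (∀ x, ‖x‖ ≤ R → c' ≤ v x t - ψ x t) → ∀ c < c',
      ∀ᶠ t' in 𝓝[>] t, ∀ x, ‖x‖ ≤ R → c ≤ v x t' - ψ x t')
    (hinit : ∀ x, ‖x‖ ≤ R → ψ x r ≤ v x r) : ∀ x, ‖x‖ ≤ R → ψ x s ≤ v x s := by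
  have key : ∀ ε > 0, ∀ x, ‖x‖ ≤ R → ψ x s - ε * (s - r) ≤ v x s := by
    intro ε hε
    refine mp_strict hv hR hr hrs (ψ := fun x t => ψ x t - ε * (t - r)) ?_ ?_ ?_ ?_ ?_
    · intro t ht
      exact (hψ.cont_x ht).sub continuousOn_const
    · intro x hx t ht
      have h1 := hψ.bdry x hx t ht
      have h2 : 0 ≤ ε * (t - r) := mul_nonneg hε.le (by linarith [ht.1])
      linarith
    · intro x hx t ht
      obtain ⟨d, c, h1, h2, h3⟩ := hψ.eqn x hx t ht
      refine ⟨d - ε, c, ?_, fun i => ?_, by linarith⟩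
      · have : HasDerivAt (fun t : ℝ => ε * (t - r)) ε t := by
          simpa using ((hasDerivAt_id t).sub_const r).const_mul ε
        exact h1.sub this
      · simpa [sub_eq_add_neg] using (h2 i).add_const (-(ε * (t - r)))
    · intro t ht c' hc' h c hc
      have h0 : 0 ≤ ε * (t - r) := mul_nonneg hε.le (by linarith [ht.1])
      have := hRL t ht (c' - ε * (t - r)) (by linarith)
        (fun x hx => by have := h x hx; linarith) (c - ε * (t - r)) (by linarith)
      filter_upwards [this, self_mem_nhdsWithin] with t' h1 h2 x hx
      have h3 := h1 x hx
      have h4 : ε * (t - r) ≤ ε * (t' - r) :=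
        mul_le_mul_of_nonneg_left (by have : t < t' := h2; linarith) hε.le
      linarith
    · intro x hx
      simpa using hinit x hx
  intro x hx
  have h1 : Tendsto (fun ε : ℝ => ψ x s - ε * (s - r)) (𝓝[>] 0) (𝓝 (ψ x s - 0 * (s - r))) :=
    ((by fun_prop : Continuous fun ε : ℝ => ψ x s - ε * (s - r)).tendsto 0).mono_left
      nhdsWithin_le_nhds
  have h2 := le_of_tendsto h1 (eventually_of_mem self_mem_nhdsWithin fun ε hε => key ε hε x hx)
  simpa using h2

/-- chaining of local comparison -/
lemma cmp_chain (hv : Supers v) {a b : ℝ} (ha : 0 < a) (hab : a ≤ b)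
    (hloc : ∀ t ∈ Ico a b, ∃ ε > 0, ∀ t', t < t' → t' < t + ε → Cmp v R t t') : Cmp v R a b := by
  intro ψ hψ hinit
  have hclosed : IsClosed ({t | ∀ x, ‖x‖ ≤ R → ψ x t ≤ v x t} ∩ Icc a b) := by
    have : {t | ∀ x, ‖x‖ ≤ R → ψ x t ≤ v x t} ∩ Icc a b =
        Icc a b ∩ ⋂ (x : EuclideanSpace ℝ (Fin n)) (_ : ‖x‖ ≤ R),
          {t | t ∈ Icc a b ∧ ψ x t ≤ v x t} := by
      ext t
      simp only [mem_inter_iff, mem_setOf_eq, mem_iInter]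
      exact ⟨fun h => ⟨h.2, fun x hx => ⟨h.2, h.1 x hx⟩⟩, fun h => ⟨fun x hx => (h.2 x hx).2, h.1⟩⟩
    rw [this]
    refine isClosed_Icc.inter (isClosed_iInter fun x => isClosed_iInter fun hx => ?_)
    exact isClosed_Icc.isClosed_le (hψ.cont_t hx) fun t ht =>
      (hv.time x t (lt_of_lt_of_le ha ht.1)).continuousAt.continuousWithinAt
  have := hclosed.Icc_subset_of_forall_exists_gt (a := a) (b := b) hinit ?_
  · exact this ⟨hab, le_rfl⟩
  · intro t ht y hy
    obtain ⟨ε, hε, hcmp⟩ := hloc t ht.2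
    have hy' : t < y := hy
    set t' := min (min y b) (t + ε / 2) with ht'
    have h1 : t < t' := lt_min (lt_min hy' ht.2.2) (by linarith)
    have h2 : t' < t + ε := lt_of_le_of_lt (min_le_right _ _) (by linarith)
    have h3 : t' ≤ y := (min_le_left _ _).trans (min_le_left _ _)
    have h4 : t' ≤ b := (min_le_left _ _).trans (min_le_right _ _)
    exact ⟨t', hcmp t' h1 h2 ψ (hψ.mono ht.2.1 h4) ht.1, h1, h3⟩

end comparison
end

open MeasureTheory Set Filter Topology
open scoped ENNReal NNReal

noncomputable section

section comparison2
variable {n : ℕ} {v : EuclideanSpace ℝ (Fin n) → ℝ → ℝ} {R : ℝ}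

lemma hk_le {τ0 τ : ℝ} (h0 : 0 < τ0) (h : τ0 ≤ τ) (z : EuclideanSpace ℝ (Fin n)) :
    hk τ z ≤ (4 * Real.pi * τ0) ^ (-(n : ℝ) / 2) := by
  unfold hk
  have h1 : (4 * Real.pi * τ) ^ (-(n : ℝ) / 2) ≤ (4 * Real.pi * τ0) ^ (-(n : ℝ) / 2) :=
    Real.rpow_le_rpow_of_nonpos (by positivity) (by gcongr)
      (by rw [neg_div]; exact neg_nonpos.2 (by positivity))
  have h2 : Real.exp (-‖z‖ ^ 2 / (4 * τ)) ≤ 1 := by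
    rw [Real.exp_le_one_iff, neg_div]
    have : 0 < τ := by linarith
    exact neg_nonpos.2 (by positivity)
  calc _ ≤ (4 * Real.pi * τ0) ^ (-(n : ℝ) / 2) * 1 := by gcongr
    _ = _ := mul_one _

lemma hk_tendsto_time {r0 s : ℝ} (hs : r0 < s) (w : EuclideanSpace ℝ (Fin n)) :
    Tendsto (fun r => hk (s - r) w) (𝓝 r0) (𝓝 (hk (s - r0) w)) := by
  have h1 := (hk_time_deriv (n := n) (τ := s - r0) (by linarith) w).continuousAt.tendsto
  have h2 : Tendsto (fun r : ℝ => s - r) (𝓝 r0) (𝓝 (s - r0)) :=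
    (by fun_prop : Continuous fun r : ℝ => s - r).tendsto r0
  exact h1.comp h2

/-- radial projection onto the ball -/
def rproj {n : ℕ} (R : ℝ) (z : EuclideanSpace ℝ (Fin n)) : EuclideanSpace ℝ (Fin n) :=
  (R / max ‖z‖ R) • z

lemma rproj_continuous (hR : 0 < R) :
    Continuous (fun z : EuclideanSpace ℝ (Fin n) => rproj R z) := by
  unfold rproj
  have : Continuous fun z : EuclideanSpace ℝ (Fin n) => R / max ‖z‖ R :=
    continuous_const.div (continuous_norm.max continuous_const)
      fun z => (lt_of_lt_of_le hR (le_max_right _ _)).ne'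
  exact this.smul continuous_id

lemma rproj_of_le (hR : 0 < R) {z : EuclideanSpace ℝ (Fin n)} (hz : ‖z‖ ≤ R) : rproj R z = z := by
  unfold rproj
  rw [max_eq_right hz, div_self hR.ne', one_smul]

lemma rproj_of_ge (hR : 0 < R) {z : EuclideanSpace ℝ (Fin n)} (hz : R ≤ ‖z‖) :
    ‖rproj R z‖ = R := by
  unfold rproj
  have : 0 < ‖z‖ := by linarith
  rw [max_eq_left hz, norm_smul, Real.norm_of_nonneg (by positivity)]
  field_simp

lemma rproj_norm_le (hR : 0 < R) (z : EuclideanSpace ℝ (Fin n)) : ‖rproj R z‖ ≤ R := by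
  rcases le_total ‖z‖ R with h | h
  · rwa [rproj_of_le hR h]
  · exact (rproj_of_ge hR h).le

lemma SubC.sub_hE {r s : ℝ} {ψ : EuclideanSpace ℝ (Fin n) → ℝ → ℝ} (hψ : SubC R r s ψ)
    {k : EuclideanSpace ℝ (Fin n) → ℝ} (hk1 : Continuous k) (hk2 : HasCompactSupport k)
    (hk3 : ∀ z, 0 ≤ k z) : SubC R r s (fun x t => ψ x t - hE k x (t - r)) where
  cont := hψ.cont.sub (((hE_continuous hk1 hk2).comp
    (by fun_prop : Continuous fun q : EuclideanSpace ℝ (Fin n) × ℝ => (q.1, q.2 - r))).continuousOn)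
  bdry := fun x hx t ht => by
    have h1 := hψ.bdry x hx t ht
    have h2 := hE_nonneg hk3 x (t - r)
    linarith
  eqn := fun x hx t ht => by
    obtain ⟨d, c, h1, h2, h3⟩ := hψ.eqn x hx t ht
    obtain ⟨d', c', h1', h2', h3'⟩ := hE_deriv hk1 hk2 x (τ := t - r) (by linarith [ht.1])
    refine ⟨d - d', fun i => c i - c' i, ?_, fun i => (h2 i).sub (h2' i), ?_⟩
    · have : HasDerivAt (fun t : ℝ => hE k x (t - r)) d' t := by
        have h4 : HasDerivAt (fun t : ℝ => t - r) 1 t := (hasDerivAt_id t).sub_const r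
        exact (HasDerivAt.comp t h1' h4).congr_deriv (mul_one _)
      exact h1.sub this
    · rw [Finset.sum_sub_distrib]; linarith

lemma cmp_left (hv : Supers v) (hR : 0 < R) {r0 s : ℝ} (hr0 : 0 < r0) (hs : r0 < s)
    (h : ∀ r ∈ Ioo r0 s, Cmp v R r s) : Cmp v R r0 s := by
  intro ψ hψ hinit x hx
  set k : ℝ → EuclideanSpace ℝ (Fin n) → ℝ :=
    fun r z => max (ψ (rproj R z) r - v (rproj R z) r) 0 with hkd
  have hk0 : ∀ r z, 0 ≤ k r z := fun r z => le_max_right _ _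
  have hkc : ∀ r ∈ Icc r0 s, Continuous (k r) := by
    intro r hr
    have hrp : 0 < r := lt_of_lt_of_le hr0 hr.1
    refine Continuous.max (Continuous.sub ?_ ?_) continuous_const
    · exact (hψ.cont_x hr).comp_continuous (rproj_continuous hR)
        fun z => by simpa using rproj_norm_le hR z
    · exact (hv.space r hrp).continuous.comp (rproj_continuous hR)
  have hkout : ∀ r ∈ Icc r0 s, ∀ z, R < ‖z‖ → k r z = 0 := by
    intro r hr z hz
    have hrp : 0 < r := lt_of_lt_of_le hr0 hr.1
    have h1 := hψ.bdry _ (rproj_of_ge hR hz.le) r hr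
    have h2 := hv.pos (rproj R z) r hrp
    exact max_eq_right (by linarith)
  have hkcs : ∀ r ∈ Icc r0 s, HasCompactSupport (k r) := by
    intro r hr
    refine HasCompactSupport.intro (isCompact_closedBall (0 : EuclideanSpace ℝ (Fin n)) R) ?_
    intro z hz
    exact hkout r hr z (by simpa using hz)
  have hineq : ∀ r ∈ Ioo r0 s, ψ x s - hE (k r) x (s - r) ≤ v x s := by
    intro r hr
    have hr' : r ∈ Icc r0 s := ⟨hr.1.le, hr.2.le⟩
    refine h r hr _ ((hψ.mono hr.1.le le_rfl).sub_hE (hkc r hr') (hkcs r hr') (hk0 r)) ?_ x hx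
    intro y hy
    simp only [sub_self, hE_zero]
    have : k r y = max (ψ y r - v y r) 0 := by simp only [hkd, rproj_of_le hR hy]
    rw [this]
    linarith [le_max_left (ψ y r - v y r) 0]
  obtain ⟨C, hC⟩ := ((isCompact_closedBall (0 : EuclideanSpace ℝ (Fin n)) R).prod
    (isCompact_Icc (a := r0) (b := s))).exists_bound_of_continuousOn hψ.cont
  set τ0 := (s - r0) / 2 with hτ0
  have hτpos : 0 < τ0 := by rw [hτ0]; linarith
  set K := (4 * Real.pi * τ0) ^ (-(n : ℝ) / 2) with hK
  have hev : ∀ᶠ r in 𝓝[>] r0, r ∈ Ioo r0 (r0 + τ0) := Ioo_mem_nhdsGT (by linarith)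
  have hlim : Tendsto (fun r => hE (k r) x (s - r)) (𝓝[>] r0) (𝓝 0) := by
    have h1 : Tendsto (fun r => ∫ z, hk (s - r) (x - z) * k r z) (𝓝[>] r0)
        (𝓝 (∫ z : EuclideanSpace ℝ (Fin n), (0 : ℝ))) := by
      refine tendsto_integral_filter_of_dominated_convergence
        ((Metric.closedBall (0 : EuclideanSpace ℝ (Fin n)) R).indicator fun _ => K * C) ?_ ?_ ?_ ?_
      · filter_upwards [hev] with r hr
        have := hkc r ⟨hr.1.le, by linarith [hr.2]⟩
        exact (by fun_prop : Continuous _).aestronglyMeasurable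
      · filter_upwards [hev] with r hr
        refine Eventually.of_forall fun z => ?_
        have hr' : r ∈ Icc r0 s := ⟨hr.1.le, by linarith [hr.2]⟩
        have hsr : τ0 ≤ s - r := by linarith [hr.2]
        by_cases hz : z ∈ Metric.closedBall (0 : EuclideanSpace ℝ (Fin n)) R
        · rw [indicator_of_mem hz, norm_mul, Real.norm_of_nonneg (hk_pos (show 0 < s - r by linarith) _).le,
            Real.norm_of_nonneg (hk0 r z)]
          have hz' : ‖z‖ ≤ R := by simpa using hz
          have h2 : k r z ≤ C := by
            have h3 := hC (z, r) ⟨hz, hr'⟩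
            have h4 := hv.pos z r (by linarith [hr.1])
            have h5 : k r z = max (ψ z r - v z r) 0 := by simp only [hkd, rproj_of_le hR hz']
            rw [h5]
            have h6 := (le_abs_self _).trans h3
            simp only at h6
            exact max_le (by linarith) ((norm_nonneg _).trans h3)
          exact mul_le_mul (hk_le hτpos hsr _) h2 (hk0 r z) (by positivity)
        · rw [indicator_of_notMem hz, hkout r hr' z (by simpa using hz)]
          simp
      · rw [integrable_indicator_iff Metric.isClosed_closedBall.measurableSet]
        exact integrableOn_const (isCompact_closedBall _ _).measure_lt_top.ne
      · refine Eventually.of_forall fun z => ?_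
        have hz := rproj_norm_le hR z
        have h2 : Tendsto (fun r => ψ (rproj R z) r) (𝓝[>] r0) (𝓝 (ψ (rproj R z) r0)) := by
          have := (hψ.cont_t hz) r0 ⟨le_rfl, hs.le⟩
          refine this.tendsto.mono_left ?_
          rw [← nhdsWithin_Ioo_eq_nhdsGT hs]
          exact nhdsWithin_mono _ Ioo_subset_Icc_self
        have h3 : Tendsto (fun r => v (rproj R z) r) (𝓝[>] r0) (𝓝 (v (rproj R z) r0)) :=
          (hv.time _ r0 hr0).continuousAt.tendsto.mono_left nhdsWithin_le_nhds
        have h4 : Tendsto (fun r => k r z) (𝓝[>] r0) (𝓝 0) := by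
          have h5 := (h2.sub h3).max (tendsto_const_nhds (x := (0 : ℝ)))
          rwa [max_eq_right (by linarith [hinit _ hz])] at h5
        have h5 : Tendsto (fun r => hk (s - r) (x - z)) (𝓝[>] r0) (𝓝 (hk (s - r0) (x - z))) := by
          exact (hk_tendsto_time hs (x - z)).mono_left nhdsWithin_le_nhds
        simpa using h5.mul h4
    rw [integral_zero] at h1
    refine h1.congr' ?_
    filter_upwards [hev] with r hr
    rw [hE_eq _ _ (by linarith [hr.2])]
  have hfin : Tendsto (fun r => ψ x s - hE (k r) x (s - r)) (𝓝[>] r0) (𝓝 (ψ x s - 0)) :=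
    tendsto_const_nhds.sub hlim
  rw [sub_zero] at hfin
  refine le_of_tendsto hfin ?_
  filter_upwards [hev] with r hr
  exact hineq r ⟨hr.1, by linarith [hr.2]⟩

/-- times with local comparison -/
def OkT {n : ℕ} (v : EuclideanSpace ℝ (Fin n) → ℝ → ℝ) (R : ℝ) : Set ℝ :=
  {t | ∃ ε > 0, ∀ r s, t - ε < r → r ≤ s → s < t + ε → 0 < r → Cmp v R r s}

lemma OkT_open : IsOpen (OkT v R) := by
  rw [Metric.isOpen_iff]
  rintro t ⟨ε, hε, h⟩
  refine ⟨ε / 2, by positivity, fun t' ht' => ⟨ε / 2, by positivity, fun r s h1 h2 h3 h4 => ?_⟩⟩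
  rw [Metric.mem_ball, Real.dist_eq, abs_lt] at ht'
  exact h r s (by linarith [ht'.1]) h2 (by linarith [ht'.2]) h4

lemma cmp_of_Ok (hv : Supers v) {a b : ℝ} (ha : 0 < a) (hab : a ≤ b) (h : Ico a b ⊆ OkT v R) :
    Cmp v R a b := by
  refine cmp_chain hv ha hab fun t ht => ?_
  obtain ⟨ε, hε, h'⟩ := h ht
  exact ⟨ε, hε, fun t' h1 h2 => h' t t' (by linarith) h1.le h2 (lt_of_lt_of_le ha ht.1)⟩

lemma cmp_of_Ok' (hv : Supers v) (hR : 0 < R) {a b : ℝ} (ha : 0 < a) (hab : a < b)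
    (h : Ioo a b ⊆ OkT v R) : Cmp v R a b :=
  cmp_left hv hR ha hab fun r hr => cmp_of_Ok hv (ha.trans hr.1) hr.2.le
    fun t ht => h ⟨lt_of_lt_of_le hr.1 ht.1, ht.2⟩

lemma exists_lip (hv : Supers v) (R : ℝ) {t : ℝ} (ht : 0 < t) :
    ∃ M : ℕ, ∀ x y : EuclideanSpace ℝ (Fin n), ‖x‖ ≤ R → ‖y‖ ≤ R →
      |v x t - v y t| ≤ M * ‖x - y‖ := by
  have hd := hv.space t ht
  obtain ⟨C, hC⟩ := (isCompact_closedBall (0 : EuclideanSpace ℝ (Fin n)) R).exists_bound_of_continuousOn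
    (hd.continuous_fderiv (by norm_num)).continuousOn
  obtain ⟨M, hM⟩ := exists_nat_ge C
  refine ⟨M, fun x y hx hy => ?_⟩
  have := (convex_closedBall (0 : EuclideanSpace ℝ (Fin n)) R).norm_image_sub_le_of_norm_fderiv_le
    (f := fun x => v x t) (fun z _ => (hd.differentiable (by norm_num)) z)
    (fun z hz => (hC z hz).trans hM) (x := y) (y := x) (by simpa using hy) (by simpa using hx)
  simpa using this

/-- right lower semicontinuity near a Baire point -/
lemma rl_of_lip (hv : Supers v) (hR : 0 < R) {a b M : ℝ} (ha : 0 < a)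
    (hM : ∀ t ∈ Ioo a b, t ∉ OkT v R → ∀ x y : EuclideanSpace ℝ (Fin n), ‖x‖ ≤ R → ‖y‖ ≤ R →
      |v x t - v y t| ≤ M * ‖x - y‖)
    {r s : ℝ} (hr : a < r) (hs : s < b)
    {ψ : EuclideanSpace ℝ (Fin n) → ℝ → ℝ} (hψ : SubC R r s ψ) :
    ∀ t ∈ Ico r s, ∀ c' ≤ 0, (∀ x, ‖x‖ ≤ R → c' ≤ v x t - ψ x t) → ∀ c < c',
      ∀ᶠ t' in 𝓝[>] t, ∀ x, ‖x‖ ≤ R → c ≤ v x t' - ψ x t' := by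
  intro t ht c' hc' hw c hc
  have htp : 0 < t := ha.trans (lt_of_lt_of_le hr ht.1)
  by_cases htO : t ∈ OkT v R
  · obtain ⟨ε, hε, h⟩ := htO
    filter_upwards [Ioo_mem_nhdsGT (show t < t + ε by linarith), Ioo_mem_nhdsGT ht.2] with t' h1 h2 x hx
    have := h t t' (by linarith) h1.1.le h1.2 htp _
      ((hψ.mono ht.1 h2.2.le).add_const hc') (fun y hy => by have := hw y hy; linarith) x hx
    linarith
  · have hev : ∀ᶠ t' in 𝓝 t, ∀ x ∈ Metric.closedBall (0 : EuclideanSpace ℝ (Fin n)) R,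
        (t' ∉ OkT v R → t' ∈ Ico t s → ‖x‖ ≤ R → c ≤ v x t' - ψ x t') := by
      refine (isCompact_closedBall _ _).eventually_forall_of_forall_eventually ?_
      intro x hx
      have hx' : ‖x‖ ≤ R := by simpa using hx
      set δ := (c' - c) / 4 with hδ
      have hδp : 0 < δ := by rw [hδ]; linarith
      have hMc := hM t ⟨lt_of_lt_of_le hr ht.1, ht.2.trans hs⟩ htO
      have e1 : ∀ᶠ q : ℝ × EuclideanSpace ℝ (Fin n) in 𝓝 (t, x), |v x q.1 - v x t| < δ := by
        have h1 : Tendsto (fun q : ℝ × EuclideanSpace ℝ (Fin n) => v x q.1) (𝓝 (t, x))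
            (𝓝 (v x t)) := (hv.time x t htp).continuousAt.tendsto.comp (continuous_fst.tendsto _)
        exact (Metric.tendsto_nhds.1 h1 δ hδp).mono fun q hq => by rwa [Real.dist_eq] at hq
      have e2 : ∀ᶠ q : ℝ × EuclideanSpace ℝ (Fin n) in 𝓝 (t, x), M * ‖q.2 - x‖ < δ := by
        have h1 : Continuous (fun q : ℝ × EuclideanSpace ℝ (Fin n) => M * ‖q.2 - x‖) := by fun_prop
        have h2 := h1.tendsto (t, x)
        simp only [sub_self, norm_zero, mul_zero] at h2
        exact h2.eventually (gt_mem_nhds hδp)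
      have e3 : ∀ᶠ q : ℝ × EuclideanSpace ℝ (Fin n) in 𝓝 (t, x),
          q.1 ∈ Ico t s → ‖q.2‖ ≤ R → |ψ q.2 q.1 - ψ x t| < δ := by
        have h1 := hψ.cont (x, t) ⟨hx, ht.1, ht.2.le⟩
        have h2 := Metric.tendsto_nhds.1 h1.tendsto δ hδp
        rw [eventually_nhdsWithin_iff] at h2
        have h3 := (continuous_swap.tendsto (t, x)).eventually h2
        filter_upwards [h3] with q hq h4 h5
        have := hq ⟨by simpa using h5, ht.1.trans h4.1, h4.2.le⟩
        rwa [Real.dist_eq] at this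
      filter_upwards [e1, e2, e3] with q h1 h2 h3 hq1 hq2 hq3
      have h4 := hM q.1 ⟨lt_of_lt_of_le hr (ht.1.trans hq2.1), hq2.2.trans hs⟩ hq1 q.2 x hq3 hx'
      have h5 := h3 hq2 hq3
      have h6 := hw x hx'
      rw [abs_lt] at h1 h5
      have h7 := abs_le.1 h4
      have : c = c' - 4 * δ := by rw [hδ]; ring
      linarith [h1.1, h5.2, h7.1]
    obtain ⟨η, hη, hη'⟩ := Metric.eventually_nhds_iff.1 hev
    filter_upwards [Ioo_mem_nhdsGT (show t < t + η by linarith), Ioo_mem_nhdsGT ht.2] with t' h1 h2 x hx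
    by_cases ht' : t' ∈ OkT v R
    · set Z : Set ℝ := (OkT v R)ᶜ ∩ Icc t t' with hZ
      have hZc : IsCompact Z := isCompact_Icc.inter_left OkT_open.isClosed_compl
      have hZn : Z.Nonempty := ⟨t, htO, le_rfl, h1.1.le⟩
      obtain ⟨hr0, hr0'⟩ := hZc.sSup_mem hZn
      set r0 := sSup Z with hr0d
      have hr0lt : r0 < t' := lt_of_le_of_ne hr0'.2 fun h => hr0 (h ▸ ht')
      have hsub : Ioo r0 t' ⊆ OkT v R := by
        intro y hy
        by_contra hyO
        have := le_csSup hZc.bddAbove (show y ∈ Z from ⟨hyO, hr0'.1.trans hy.1.le, hy.2.le⟩)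
        exact absurd hy.1 (not_lt.2 this)
      have hcmp := cmp_of_Ok' hv hR (htp.trans_le hr0'.1) hr0lt hsub
      have := hcmp _ ((hψ.mono (ht.1.trans hr0'.1) h2.2.le).add_const (hc.le.trans hc')) ?_ x hx
      · linarith
      · intro y hy
        have hd : dist r0 t < η := by
          rw [Real.dist_eq, abs_of_nonneg (by linarith [hr0'.1])]; linarith [h1.2]
        have := hη' hd y (by simpa using hy) hr0 ⟨hr0'.1, hr0lt.trans h2.2⟩ hy
        linarith
    · refine hη' ?_ x (by simpa using hx) ht' ⟨h1.1.le, h2.2⟩ hx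
      rw [Real.dist_eq, abs_of_nonneg (by linarith [h1.1])]; linarith [h1.2]

lemma cmp_all (hv : Supers v) (hR : 0 < R) {r s : ℝ} (hr : 0 < r) (hrs : r ≤ s) : Cmp v R r s := by
  by_cases hZ : Ioi 0 ⊆ OkT v R
  · exact cmp_of_Ok hv hr hrs fun t ht => hZ (lt_of_lt_of_le hr ht.1)
  exfalso
  set Z : Set ℝ := Ioi 0 ∩ (OkT v R)ᶜ with hZd
  have hZne : Nonempty Z := by
    rw [not_subset] at hZ
    obtain ⟨t, h1, h2⟩ := hZ
    exact ⟨⟨t, h1, h2⟩⟩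
  have hlc : IsLocallyClosed Z :=
    isOpen_Ioi.isLocallyClosed.inter OkT_open.isClosed_compl.isLocallyClosed
  have := hlc.locallyCompactSpace
  set f : ℕ → Set Z := fun M : ℕ => {t : Z | ∀ x y : EuclideanSpace ℝ (Fin n), ‖x‖ ≤ R → ‖y‖ ≤ R →
      |v x t - v y t| ≤ M * ‖x - y‖} with hf
  have hcl : ∀ M, IsClosed (f M) := by
    intro M
    simp only [hf, setOf_forall]
    refine isClosed_iInter fun x => isClosed_iInter fun y => isClosed_iInter fun hx =>
      isClosed_iInter fun hy => ?_
    have hcx : ∀ x, Continuous (fun t : Z => v x t) := by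
      intro x
      rw [continuous_iff_continuousAt]
      intro t
      exact (hv.time x t t.2.1).continuousAt.comp continuous_subtype_val.continuousAt
    exact isClosed_le ((hcx x).sub (hcx y)).abs continuous_const
  have hun : ⋃ M, f M = univ := by
    rw [eq_univ_iff_forall]
    intro t
    obtain ⟨M, hM⟩ := exists_lip hv R t.2.1
    exact mem_iUnion.2 ⟨M, hM⟩
  obtain ⟨M, hMne⟩ := nonempty_interior_of_iUnion_of_closed hcl hun
  obtain ⟨⟨t, htZ⟩, ht⟩ := hMne
  rw [mem_interior_iff_mem_nhds, Metric.mem_nhds_iff] at ht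
  obtain ⟨ε, hε, hball⟩ := ht
  have ht0 : 0 < t := htZ.1
  set δ := min ε (t / 2) with hδ
  have hδp : 0 < δ := by positivity
  have hδt : δ ≤ t / 2 := min_le_right _ _
  apply htZ.2
  refine ⟨δ, hδp, fun r' s' h1 h2 h3 h4 ψ hψ hinit => ?_⟩
  refine mp_weak hv hR h4 h2 hψ ?_ hinit
  refine rl_of_lip hv hR (a := t - δ) (b := t + δ) (M := M) (by linarith) ?_ h1 h3 hψ
  intro t' ht' htO'
  have : (⟨t', by have := ht'.1; show 0 < t'; linarith, htO'⟩ : Z) ∈ Metric.ball (⟨t, htZ⟩ : Z) ε := by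
    rw [Metric.mem_ball, Subtype.dist_eq, Real.dist_eq, abs_lt]
    have := min_le_left ε (t / 2)
    constructor <;> simp only <;> linarith [ht'.1, ht'.2]
  exact hball this

end comparison2
end

open MeasureTheory Set Filter Topology
open scoped ENNReal NNReal

noncomputable section

/-- extended version of a positive function, zero for nonpositive times -/
def Ve {n : ℕ} (v : EuclideanSpace ℝ (Fin n) → ℝ → ℝ) (t : ℝ) (x : EuclideanSpace ℝ (Fin n)) : ℝ≥0∞ :=
  ENNReal.ofReal ((Ioi (0 : ℝ)).indicator (v x) t)

section LC
variable {n : ℕ} {v : EuclideanSpace ℝ (Fin n) → ℝ → ℝ}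

lemma Ve_eq {t : ℝ} (ht : 0 < t) (x : EuclideanSpace ℝ (Fin n)) :
    Ve v t x = ENNReal.ofReal (v x t) := by
  unfold Ve; rw [indicator_of_mem (show t ∈ Ioi (0 : ℝ) from ht)]

lemma Ve_ne_top (t : ℝ) (x : EuclideanSpace ℝ (Fin n)) : Ve v t x ≠ ⊤ := ENNReal.ofReal_ne_top

lemma meas_aux (hs : ∀ t, 0 < t → Continuous (fun x => v x t))
    (ht : ∀ x, ContinuousOn (v x) (Ioi 0)) :
    Measurable (fun q : EuclideanSpace ℝ (Fin n) × ℝ => Ve v q.2 q.1) := by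
  unfold Ve
  refine Measurable.ennreal_ofReal ?_
  refine measurable_uncurry_of_continuous_of_measurable
    (u := fun x t => (Ioi (0 : ℝ)).indicator (v x) t) ?_ ?_
  · intro t
    by_cases h : 0 < t
    · simp only [indicator_of_mem (show t ∈ Ioi (0 : ℝ) from h)]; exact hs t h
    · simp only [indicator_of_notMem (show t ∉ Ioi (0 : ℝ) from h)]; exact continuous_const
  · intro x
    rw [← piecewise_eq_indicator]
    exact (ht x).measurable_piecewise continuousOn_const measurableSet_Ioi

lemma Supers.contOn (hv : Supers v) (x : EuclideanSpace ℝ (Fin n)) : ContinuousOn (v x) (Ioi 0) :=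
  fun t ht => (hv.time x t ht).continuousAt.continuousWithinAt

lemma Supers.meas (hv : Supers v) :
    Measurable (fun q : EuclideanSpace ℝ (Fin n) × ℝ => Ve v q.2 q.1) :=
  meas_aux (fun t ht => (hv.space t ht).continuous) hv.contOn

lemma Supers.meas_x (hv : Supers v) (t : ℝ) : Measurable (Ve v t) :=
  hv.meas.comp (measurable_id.prodMk measurable_const)

lemma LC_compact (hv : Supers v) {t h : ℝ} (ht : 0 < t) (hh : 0 < h)
    {φ : EuclideanSpace ℝ (Fin n) → ℝ} (hφ : Continuous φ) {ρ C : ℝ} (hρ : 0 < ρ)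
    (hφρ : ∀ z, ρ ≤ ‖z‖ → φ z = 0) (hφ0 : ∀ z, 0 ≤ φ z) (hφC : ∀ z, φ z ≤ C)
    (hφv : ∀ z, φ z ≤ v z t) (x : EuclideanSpace ℝ (Fin n)) : hE φ x h ≤ v x (t + h) := by
  have hcs : HasCompactSupport φ := by
    refine HasCompactSupport.intro (isCompact_closedBall (0 : EuclideanSpace ℝ (Fin n)) ρ) ?_
    intro z hz
    exact hφρ z (by simp at hz; exact hz.le)
  have hC : 0 ≤ C := (hφ0 0).trans (hφC 0)
  refine le_of_forall_pos_le_add fun ε hε => ?_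
  -- choose radius
  obtain ⟨D, hD, hDb⟩ : ∃ D : ℝ, 1 ≤ D ∧ C * h * mtwo n / D ^ 2 ≤ ε := by
    refine ⟨max 1 (C * h * mtwo n / ε), le_max_left _ _, ?_⟩
    have h1 : 1 ≤ max 1 (C * h * mtwo n / ε) := le_max_left _ _
    have h2 := le_max_right 1 (C * h * mtwo n / ε)
    set D := max 1 (C * h * mtwo n / ε)
    rw [div_le_iff₀ (by positivity)]
    rw [div_le_iff₀ hε] at h2
    have h3 : D * ε ≤ D ^ 2 * ε := by gcongr; nlinarith
    linarith
  set R := max (‖x‖ + 1) (ρ + D) with hR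
  have hRx : ‖x‖ ≤ R := by have := le_max_left (‖x‖ + 1) (ρ + D); linarith
  have hRρ : ρ + D ≤ R := le_max_right _ _
  have hRp : 0 < R := by linarith
  have hsub : SubC R t (t + h) (fun y τ => hE φ y (τ - t) + (-ε)) := by
    refine ⟨?_, ?_, ?_⟩
    · exact ((((hE_continuous hφ hcs).comp
        (by fun_prop : Continuous fun q : EuclideanSpace ℝ (Fin n) × ℝ => (q.1, q.2 - t)))).add
          continuous_const).continuousOn
    · intro y hy τ hτ
      have hτ0 : 0 ≤ τ - t := by linarith [hτ.1]
      have : hE φ y (τ - t) ≤ ε := by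
        refine le_trans ?_ hDb
        have e1 : C * h * mtwo n / D ^ 2 = ∫ ζ : EuclideanSpace ℝ (Fin n),
            C * h / D ^ 2 * (‖ζ‖ ^ 2 * hk 1 ζ) := by
          rw [integral_const_mul, mtwo]; ring
        rw [e1]
        unfold hE
        refine integral_mono_of_nonneg (Eventually.of_forall fun ζ =>
          mul_nonneg (hk_pos one_pos ζ).le (hφ0 _)) ((hk_sq_integrable one_pos).const_mul _)
          (Eventually.of_forall fun ζ => ?_)
        simp only
        have hkp := hk_pos one_pos ζ
        by_cases hz : ρ ≤ ‖y + √(τ - t) • ζ‖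
        · rw [hφρ _ hz, mul_zero]; positivity
        · push Not at hz
          have h1 : ‖y‖ ≤ ‖y + √(τ - t) • ζ‖ + ‖√(τ - t) • ζ‖ := by
            have := norm_sub_le (y + √(τ - t) • ζ) (√(τ - t) • ζ)
            simpa using this
          rw [norm_smul, Real.norm_of_nonneg (Real.sqrt_nonneg _)] at h1
          have h2 : D ≤ √(τ - t) * ‖ζ‖ := by linarith
          have h3 : D ^ 2 ≤ h * ‖ζ‖ ^ 2 := by
            calc D ^ 2 ≤ (√(τ - t) * ‖ζ‖) ^ 2 := by gcongr
              _ = (τ - t) * ‖ζ‖ ^ 2 := by rw [mul_pow, Real.sq_sqrt hτ0]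
              _ ≤ h * ‖ζ‖ ^ 2 := by gcongr; linarith [hτ.2]
          have h4 : 1 ≤ h * ‖ζ‖ ^ 2 / D ^ 2 := by rwa [le_div_iff₀ (by positivity), one_mul]
          calc hk 1 ζ * φ (y + √(τ - t) • ζ) ≤ hk 1 ζ * C := by gcongr; exact hφC _
            _ = C * hk 1 ζ * 1 := by ring
            _ ≤ C * hk 1 ζ * (h * ‖ζ‖ ^ 2 / D ^ 2) := by gcongr
            _ = _ := by ring
      linarith
    · intro y hy τ hτ
      obtain ⟨d, c, h1, h2, h3⟩ := hE_deriv hφ hcs y (τ := τ - t) (by linarith [hτ.1])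
      refine ⟨d, c, ?_, fun i => (h2 i).add_const _, h3.le⟩
      have h4 : HasDerivAt (fun τ : ℝ => τ - t) 1 τ := (hasDerivAt_id τ).sub_const t
      exact ((HasDerivAt.comp τ h1 h4).congr_deriv (mul_one _)).add_const _
  have := cmp_all hv hRp ht (by linarith) _ hsub (fun y hy => by
    simp only [sub_self, hE_zero]; linarith [hφv y]) x hRx
  simp only [add_sub_cancel_left] at this
  linarith

lemma ofReal_hE {φ : EuclideanSpace ℝ (Fin n) → ℝ} (hφ : Continuous φ)
    (hcs : HasCompactSupport φ) (hφ0 : ∀ z, 0 ≤ φ z) {h : ℝ} (hh : 0 < h)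
    (x : EuclideanSpace ℝ (Fin n)) :
    ENNReal.ofReal (hE φ x h) = hS h (fun z => ENNReal.ofReal (φ z)) x := by
  rw [hE_eq _ _ hh]
  have hInteg : Integrable (fun z => hk h (x - z) * φ z) :=
    Continuous.integrable_of_hasCompactSupport (by fun_prop) (hcs.mul_left)
  rw [ofReal_integral_eq_lintegral_ofReal hInteg (Eventually.of_forall fun z =>
    mul_nonneg (hk_pos hh _).le (hφ0 z))]
  unfold hS hke
  congr 1; ext z
  rw [ENNReal.ofReal_mul (hk_pos hh _).le]

theorem LC (hv : Supers v) {t h : ℝ} (ht : 0 < t) (hh : 0 < h) (x : EuclideanSpace ℝ (Fin n)) :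
    hS h (Ve v t) x ≤ Ve v (t + h) x := by
  rw [Ve_eq (by positivity)]
  have hvc : Continuous (fun z => v z t) := (hv.space t ht).continuous
  set χ : ℕ → EuclideanSpace ℝ (Fin n) → ℝ := fun m z => max 0 (min 1 ((m : ℝ) + 1 - ‖z‖)) with hχ
  have hχ0 : ∀ m z, 0 ≤ χ m z := fun m z => le_max_left _ _
  have hχ1 : ∀ m z, χ m z ≤ 1 := fun m z => max_le zero_le_one (min_le_left _ _)
  have hχc : ∀ m, Continuous (χ m) := fun m => by simp only [hχ]; fun_prop
  set φ : ℕ → EuclideanSpace ℝ (Fin n) → ℝ := fun m z => v z t * χ m z with hφ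
  have hφc : ∀ m, Continuous (φ m) := fun m => hvc.mul (hχc m)
  have hφ0 : ∀ m z, 0 ≤ φ m z := fun m z => mul_nonneg (hv.pos z t ht).le (hχ0 m z)
  have hφout : ∀ (m : ℕ) z, (m : ℝ) + 1 ≤ ‖z‖ → φ m z = 0 := by
    intro m z hz
    simp only [hφ, hχ]
    rw [max_eq_left ((min_le_right _ _).trans (by linarith)), mul_zero]
  have hφv : ∀ m z, φ m z ≤ v z t := fun m z => by
    have := hv.pos z t ht
    exact mul_le_of_le_one_right this.le (hχ1 m z)
  have hcs : ∀ m, HasCompactSupport (φ m) := fun m => by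
    refine HasCompactSupport.intro
      (isCompact_closedBall (0 : EuclideanSpace ℝ (Fin n)) ((m : ℝ) + 1)) ?_
    intro z hz
    exact hφout m z (by simp at hz; exact hz.le)
  have hm : ∀ m, hS h (fun z => ENNReal.ofReal (φ m z)) x ≤ ENNReal.ofReal (v x (t + h)) := by
    intro m
    rw [← ofReal_hE (hφc m) (hcs m) (hφ0 m) hh]
    obtain ⟨C, hC⟩ := (hφc m).bounded_above_of_compact_support (hcs m)
    exact ENNReal.ofReal_le_ofReal (LC_compact hv ht hh (hφc m) (by positivity) (hφout m) (hφ0 m)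
      (fun z => (le_abs_self _).trans (hC z)) (hφv m) x)
  have hlim : ∀ z, liminf (fun m => hke h (x - z) * ENNReal.ofReal (φ m z)) atTop =
      hke h (x - z) * Ve v t z := by
    intro z
    refine Tendsto.liminf_eq ?_
    refine tendsto_const_nhds.congr' ?_
    obtain ⟨m0, hm0⟩ := exists_nat_ge ‖z‖
    filter_upwards [eventually_ge_atTop m0] with m hm
    have : χ m z = 1 := by
      have : (m0 : ℝ) ≤ m := by exact_mod_cast hm
      simp only [hχ]
      rw [min_eq_left (by linarith), max_eq_right zero_le_one]
    rw [Ve_eq ht]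
    simp only [hφ, this, mul_one]
  calc hS h (Ve v t) x = ∫⁻ z, liminf (fun m => hke h (x - z) * ENNReal.ofReal (φ m z)) atTop := by
        unfold hS; simp_rw [hlim]
    _ ≤ liminf (fun m => ∫⁻ z, hke h (x - z) * ENNReal.ofReal (φ m z)) atTop :=
        lintegral_liminf_le fun m => by
          have := (hφc m).measurable
          fun_prop
    _ ≤ ENNReal.ofReal (v x (t + h)) := by
        refine liminf_le_of_le (by isBoundedDefault) fun b hb => ?_
        obtain ⟨m, hm'⟩ := hb.exists
        exact hm'.trans (hm m)

/-- right lower semicontinuity of supersolutions -/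
lemma Supers.rlsc (hv : Supers v) {t : ℝ} (ht : 0 < t) (x : EuclideanSpace ℝ (Fin n)) {c : ℝ}
    (hc : c < v x t) : ∃ δ > 0, ∀ y r, dist y x < δ → t ≤ r → r < t + δ → c ≤ v y r := by
  rcases lt_or_ge c 0 with h0 | h0
  · exact ⟨1, one_pos, fun y r _ h1 _ => h0.le.trans (hv.pos y r (by linarith)).le⟩
  set c' := (c + v x t) / 2 with hc'
  have h1 : c < c' := by rw [hc']; linarith
  have h2 : c' < v x t := by rw [hc']; linarith
  have hcont := ((hv.space t ht).continuous.continuousAt (x := x)).tendsto.eventually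
    (lt_mem_nhds h2)
  obtain ⟨δ, hδ, hball⟩ := Metric.eventually_nhds_iff.1 hcont
  have hlim : Tendsto (fun τ : ℝ => c' * (1 - mtwo n * τ / (δ / 2) ^ 2)) (𝓝 0) (𝓝 c') := by
    have : Continuous (fun τ : ℝ => c' * (1 - mtwo n * τ / (δ / 2) ^ 2)) := by fun_prop
    simpa using this.tendsto 0
  obtain ⟨η, hη, hη'⟩ := Metric.eventually_nhds_iff.1 (hlim.eventually (lt_mem_nhds h1))
  refine ⟨min (δ / 2) η, by positivity, fun y r hy hr1 hr2 => ?_⟩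
  have hy2 : dist y x < δ / 2 := lt_of_lt_of_le hy (min_le_left _ _)
  rcases hr1.eq_or_lt with rfl | hr1
  · exact (h1.trans (hball (by linarith))).le
  have h3 := hS_lower (n := n) (c := c') (δ := δ / 2) (τ := r - t) (f := Ve v t) (x := y)
    (by linarith) (by positivity) (by linarith) (fun z hz => by
      rw [Ve_eq ht]
      exact ENNReal.ofReal_le_ofReal (hball (by linarith [dist_triangle z y x])).le)
  have h4 := h3.trans (LC hv ht (by linarith) y)
  rw [add_sub_cancel, Ve_eq (by linarith),
    ENNReal.ofReal_le_ofReal_iff (hv.pos _ _ (by linarith)).le] at h4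
  refine le_trans (hη' ?_).le h4
  rw [Real.dist_eq, sub_zero, abs_of_nonneg (by linarith)]
  linarith [min_le_right (δ / 2) η]

end LC
end

open MeasureTheory Set Filter Topology
open scoped ENNReal NNReal

noncomputable section

/-- fourth moment -/
def mfour (n : ℕ) : ℝ := ∫ z : EuclideanSpace ℝ (Fin n), ‖z‖ ^ 4 * hk 1 z

section gen
variable {n : ℕ}

lemma hk_four_integrable :
    Integrable (fun z : EuclideanSpace ℝ (Fin n) => ‖z‖ ^ 4 * hk 1 z) := by
  refine ((hk_sq_integrable (n := n) (t := 2) (by norm_num)).const_mul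
    (8 * 1 * 2 ^ ((n : ℝ) / 2))).mono' (by fun_prop) (Eventually.of_forall fun z => ?_)
  have h0 := (hk_pos one_pos z).le
  rw [Real.norm_of_nonneg (by positivity)]
  have h1 := hk_sq_le one_pos z
  calc ‖z‖ ^ 4 * hk 1 z = ‖z‖ ^ 2 * (‖z‖ ^ 2 * hk 1 z) := by ring
    _ ≤ ‖z‖ ^ 2 * (8 * 1 * 2 ^ ((n : ℝ) / 2) * hk (2 * 1) z) := by gcongr
    _ = _ := by rw [mul_one]; ring_nf

lemma mfour_nonneg : 0 ≤ mfour n :=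
  integral_nonneg fun z => mul_nonneg (by positivity) (hk_pos one_pos z).le

lemma lin_int (L : EuclideanSpace ℝ (Fin n) →L[ℝ] ℝ) :
    Integrable (fun ζ => L ζ * hk 1 ζ) ∧ ∫ ζ, L ζ * hk 1 ζ = 0 := by
  refine ⟨?_, ?_⟩
  · refine ((hk_norm_integrable (n := n) one_pos).const_mul ‖L‖).mono' (by fun_prop)
      (Eventually.of_forall fun z => ?_)
    have h0 := (hk_pos one_pos z).le
    rw [norm_mul, Real.norm_of_nonneg h0, ← mul_assoc]
    gcongr
    exact L.le_opNorm z
  · have h := integral_neg_eq_self (fun ζ => L ζ * hk 1 ζ) volume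
    simp only [map_neg, hk_neg, neg_mul, integral_neg] at h
    linarith

lemma vec_sum (ζ : EuclideanSpace ℝ (Fin n)) :
    ζ = ∑ i, ζ i • EuclideanSpace.single i (1 : ℝ) := by
  have := (EuclideanSpace.basisFun (Fin n) ℝ).sum_repr ζ
  simpa using this.symm

lemma bil_int (B : EuclideanSpace ℝ (Fin n) →L[ℝ] EuclideanSpace ℝ (Fin n) →L[ℝ] ℝ) :
    Integrable (fun ζ => B ζ ζ * hk 1 ζ) ∧
      ∫ ζ, B ζ ζ * hk 1 ζ = 2 * ∑ i, B (EuclideanSpace.single i 1) (EuclideanSpace.single i 1) := by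
  have hij : ∀ i j : Fin n, Integrable
      (fun ζ : EuclideanSpace ℝ (Fin n) => ζ i * ζ j * hk 1 ζ) := by
    intro i j
    refine (hk_sq_integrable (n := n) one_pos).mono' (by fun_prop)
      (Eventually.of_forall fun z => ?_)
    have h0 := (hk_pos one_pos z).le
    rw [norm_mul, norm_mul, Real.norm_of_nonneg h0, sq]
    gcongr
    · exact PiLp.norm_apply_le z i
    · exact PiLp.norm_apply_le z j
  have hB : ∀ ζ : EuclideanSpace ℝ (Fin n), B ζ ζ * hk 1 ζ = ∑ i, ∑ j,
      B (EuclideanSpace.single i 1) (EuclideanSpace.single j 1) * (ζ i * ζ j * hk 1 ζ) := by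
    intro ζ
    have : B ζ ζ = ∑ i, ∑ j, ζ i * (ζ j *
        B (EuclideanSpace.single i 1) (EuclideanSpace.single j 1)) := by
      conv_lhs => rw [vec_sum ζ]
      simp only [map_sum, map_smul, _root_.sum_apply, _root_.smul_apply, smul_eq_mul,
        Finset.mul_sum]
      rw [Finset.sum_comm]
      exact Finset.sum_congr rfl fun i _ => Finset.sum_congr rfl fun j _ => by ring
    rw [this, Finset.sum_mul]
    refine Finset.sum_congr rfl fun i _ => ?_
    rw [Finset.sum_mul]
    exact Finset.sum_congr rfl fun j _ => by ring
  simp_rw [hB]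
  refine ⟨integrable_finsetSum _ fun i _ => integrable_finsetSum _ fun j _ =>
    (hij i j).const_mul _, ?_⟩
  rw [integral_finsetSum _ fun i _ => integrable_finsetSum _ fun j _ => (hij i j).const_mul _]
  rw [Finset.mul_sum]
  refine Finset.sum_congr rfl fun i _ => ?_
  rw [integral_finsetSum _ fun j _ => (hij i j).const_mul _]
  simp_rw [integral_const_mul, hk_moment]
  simp [mul_comm]

lemma poly_int (c α β : ℝ) (L : EuclideanSpace ℝ (Fin n) →L[ℝ] ℝ)
    (B : EuclideanSpace ℝ (Fin n) →L[ℝ] EuclideanSpace ℝ (Fin n) →L[ℝ] ℝ) :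
    Integrable (fun ζ => hk 1 ζ * (c + L ζ + B ζ ζ / 2 + α * ‖ζ‖ ^ 2 + β * ‖ζ‖ ^ 4)) ∧
    ∫ ζ, hk 1 ζ * (c + L ζ + B ζ ζ / 2 + α * ‖ζ‖ ^ 2 + β * ‖ζ‖ ^ 4) =
      c + ∑ i, B (EuclideanSpace.single i 1) (EuclideanSpace.single i 1) + α * mtwo n
        + β * mfour n := by
  have e : ∀ ζ : EuclideanSpace ℝ (Fin n),
      hk 1 ζ * (c + L ζ + B ζ ζ / 2 + α * ‖ζ‖ ^ 2 + β * ‖ζ‖ ^ 4) =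
      c * hk 1 ζ + L ζ * hk 1 ζ + (1 / 2) * (B ζ ζ * hk 1 ζ) + α * (‖ζ‖ ^ 2 * hk 1 ζ)
        + β * (‖ζ‖ ^ 4 * hk 1 ζ) := fun ζ => by ring
  simp_rw [e]
  have i1 := (hk_integrable (n := n) one_pos).const_mul c
  have i2 := (lin_int L).1
  have i3 := (bil_int B).1.const_mul (1 / 2)
  have i4 := (hk_sq_integrable (n := n) one_pos).const_mul α
  have i5 := (hk_four_integrable (n := n)).const_mul β
  refine ⟨(((i1.add i2).add i3).add i4).add i5, ?_⟩
  rw [integral_add (by exact ((i1.add i2).add i3).add i4) i5,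
    integral_add (by exact (i1.add i2).add i3) i4,
    integral_add (by exact i1.add i2) i3, integral_add i1 i2]
  simp_rw [integral_const_mul]
  rw [hk_integral one_pos, (lin_int L).2, (bil_int B).2, ← mtwo, ← mfour]
  ring

lemma taylor2 {f : EuclideanSpace ℝ (Fin n) → ℝ} (hf : ContDiff ℝ 2 f)
    (y : EuclideanSpace ℝ (Fin n)) {ε : ℝ} (hε : 0 < ε) :
    ∃ δ > 0, ∀ w, ‖w‖ < δ →
      |f (y + w) - f y - fderiv ℝ f y w - fderiv ℝ (fderiv ℝ f) y w w / 2| ≤ ε * ‖w‖ ^ 2 := by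
  set B := fderiv ℝ (fderiv ℝ f) y with hB
  have hd1 : ContDiff ℝ 1 (fderiv ℝ f) := hf.fderiv_right (by norm_num)
  have hdd : HasFDerivAt (fderiv ℝ f) B y := (hd1.differentiable (by norm_num) y).hasFDerivAt
  have hsymm : ∀ v w, B v w = B w v := by
    have h := (hf.contDiffAt (x := y)).isSymmSndFDerivAt (by simp)
    exact fun v w => h.eq v w
  have hlo := hdd.isLittleO.bound hε
  rw [Metric.eventually_nhds_iff] at hlo
  obtain ⟨δ, hδ, hlo⟩ := hlo
  refine ⟨δ, hδ, fun w hw => ?_⟩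
  set r : EuclideanSpace ℝ (Fin n) → ℝ := fun w => f (y + w) - f y - fderiv ℝ f y w - B w w / 2
    with hr
  have hder : ∀ z, HasFDerivAt r (fderiv ℝ f (y + z) - fderiv ℝ f y - B z) z := by
    intro z
    have h1 : HasFDerivAt (fun w => f (y + w)) (fderiv ℝ f (y + z)) z := by
      have h := (hf.differentiable (by norm_num) (y + z)).hasFDerivAt
      have h' : HasFDerivAt (fun w => y + w) (ContinuousLinearMap.id ℝ _) z :=
        (hasFDerivAt_id z).const_add y
      exact (HasFDerivAt.comp z h h').congr_fderiv (ContinuousLinearMap.comp_id _)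
    have h2 : HasFDerivAt (fun w => fderiv ℝ f y w) (fderiv ℝ f y) z :=
      (fderiv ℝ f y).hasFDerivAt
    have h3 : HasFDerivAt (fun w => B w w) ((B z).comp (ContinuousLinearMap.id ℝ _) + (B.flip z)) z := by
      have h := (B.hasFDerivAt (x := z)).clm_apply (hasFDerivAt_id z)
      refine h.congr_fderiv ?_
      ext v; simp
    have h4 := ((h1.sub_const (f y)).sub h2).sub (h3.mul_const (1 / 2 : ℝ))
    have h5 : r = fun w => f (y + w) - f y - fderiv ℝ f y w - B w w * (1 / 2) := by
      ext w; simp only [hr]; ring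
    rw [h5]
    refine h4.congr_fderiv ?_
    ext v
    simp only [_root_.sub_apply, _root_.smul_apply, _root_.add_apply,
      ContinuousLinearMap.comp_apply, ContinuousLinearMap.id_apply, smul_eq_mul,
      ContinuousLinearMap.flip_apply]
    rw [hsymm v z]; ring
  have hmv := (convex_closedBall (0 : EuclideanSpace ℝ (Fin n)) ‖w‖).norm_image_sub_le_of_norm_hasFDerivWithin_le
    (f := r) (C := ε * ‖w‖) (fun z _ => (hder z).hasFDerivWithinAt) (fun z hz => by
      have hz' : ‖z‖ ≤ ‖w‖ := by simpa using hz
      have := @hlo (y + z) (by rw [dist_eq_norm, add_sub_cancel_left]; linarith)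
      rw [add_sub_cancel_left] at this
      exact this.trans (by gcongr)) (x := 0) (y := w) (by simp) (by simp)
  have hr0 : r 0 = 0 := by simp [hr]
  rw [hr0, sub_zero, sub_zero, Real.norm_eq_abs] at hmv
  calc |f (y + w) - f y - fderiv ℝ f y w - B w w / 2| = |r w| := rfl
    _ ≤ ε * ‖w‖ * ‖w‖ := hmv
    _ = _ := by ring

lemma laplacian_eq {f : EuclideanSpace ℝ (Fin n) → ℝ} (hf : ContDiff ℝ 2 f)
    (y : EuclideanSpace ℝ (Fin n)) : laplacian f y =
      ∑ i, fderiv ℝ (fderiv ℝ f) y (EuclideanSpace.single i 1) (EuclideanSpace.single i 1) := by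
  unfold laplacian
  refine Finset.sum_congr rfl fun i _ => ?_
  have hd1 : ContDiff ℝ 1 (fderiv ℝ f) := hf.fderiv_right (by norm_num)
  have hdd := (hd1.differentiable (by norm_num) y).hasFDerivAt
  have := hdd.clm_apply (hasFDerivAt_const (EuclideanSpace.single i (1 : ℝ)) y)
  rw [this.fderiv]
  simp

lemma hk_far {δ hs ε : ℝ} (hδ : 0 < δ) (hhs : 0 < hs) (hε : 0 < ε) :
    ∀ᶠ h in 𝓝[>] (0 : ℝ), ∀ w : EuclideanSpace ℝ (Fin n), δ ≤ ‖w‖ →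
      hk h w ≤ ε * h * hk hs w := by
  have h1 : Tendsto (fun h : ℝ => hs ^ ((n : ℝ) / 2) *
      ((h⁻¹) ^ ((n : ℝ) / 2 + 1) * Real.exp (-(δ ^ 2 / 8) * h⁻¹))) (𝓝[>] 0) (𝓝 0) := by
    have := ((tendsto_rpow_mul_exp_neg_mul_atTop_nhds_zero ((n : ℝ) / 2 + 1) (δ ^ 2 / 8)
      (by positivity)).comp tendsto_inv_nhdsGT_zero).const_mul (hs ^ ((n : ℝ) / 2))
    simpa using this
  filter_upwards [h1.eventually (gt_mem_nhds hε),
    Ioo_mem_nhdsGT (show (0 : ℝ) < hs / 2 by positivity)] with h h2 h3 w hw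
  have hp : 0 < h := h3.1
  have hA : (4 * Real.pi * h) ^ (-(n : ℝ) / 2) =
      hs ^ ((n : ℝ) / 2) * h⁻¹ ^ ((n : ℝ) / 2) * (4 * Real.pi * hs) ^ (-(n : ℝ) / 2) := by
    rw [Real.mul_rpow (by positivity) hp.le, Real.mul_rpow (by positivity) hhs.le, neg_div,
      Real.inv_rpow hp.le, Real.rpow_neg hp.le, Real.rpow_neg hhs.le]
    have : hs ^ ((n : ℝ) / 2) ≠ 0 := (Real.rpow_pos_of_pos hhs _).ne'
    field_simp
  have hB : Real.exp (-‖w‖ ^ 2 / (4 * h)) ≤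
      Real.exp (-(δ ^ 2 / 8) * h⁻¹) * Real.exp (-‖w‖ ^ 2 / (4 * hs)) := by
    rw [← Real.exp_add, Real.exp_le_exp]
    have h4 : δ ^ 2 ≤ ‖w‖ ^ 2 := by gcongr
    have h5 : ‖w‖ ^ 2 / (4 * hs) ≤ ‖w‖ ^ 2 / (8 * h) := by
      apply div_le_div_of_nonneg_left (by positivity) (by positivity); linarith [h3.2]
    have h6 : δ ^ 2 / (8 * h) ≤ ‖w‖ ^ 2 / (8 * h) := by gcongr
    have h7 : -‖w‖ ^ 2 / (4 * h) = -(‖w‖ ^ 2 / (8 * h)) - ‖w‖ ^ 2 / (8 * h) := by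
      field_simp; ring
    have h8 : -(δ ^ 2 / 8) * h⁻¹ = -(δ ^ 2 / (8 * h)) := by field_simp
    rw [h7, h8, neg_div]; linarith
  have hC : hs ^ ((n : ℝ) / 2) * h⁻¹ ^ ((n : ℝ) / 2) * Real.exp (-(δ ^ 2 / 8) * h⁻¹) ≤ ε * h := by
    have h9 : hs ^ ((n : ℝ) / 2) * ((h⁻¹) ^ ((n : ℝ) / 2 + 1) * Real.exp (-(δ ^ 2 / 8) * h⁻¹)) * h =
        hs ^ ((n : ℝ) / 2) * h⁻¹ ^ ((n : ℝ) / 2) * Real.exp (-(δ ^ 2 / 8) * h⁻¹) := by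
      rw [Real.rpow_add (by positivity), Real.rpow_one]; field_simp
    rw [← h9]
    gcongr
  unfold hk
  rw [hA]
  have hD : 0 < (4 * Real.pi * hs) ^ (-(n : ℝ) / 2) := by positivity
  calc _ ≤ hs ^ ((n : ℝ) / 2) * h⁻¹ ^ ((n : ℝ) / 2) * (4 * Real.pi * hs) ^ (-(n : ℝ) / 2) *
        (Real.exp (-(δ ^ 2 / 8) * h⁻¹) * Real.exp (-‖w‖ ^ 2 / (4 * hs))) := by gcongr
    _ = (hs ^ ((n : ℝ) / 2) * h⁻¹ ^ ((n : ℝ) / 2) * Real.exp (-(δ ^ 2 / 8) * h⁻¹)) *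
        ((4 * Real.pi * hs) ^ (-(n : ℝ) / 2) * Real.exp (-‖w‖ ^ 2 / (4 * hs))) := by ring
    _ ≤ _ := by gcongr

lemma gen_lower {f : EuclideanSpace ℝ (Fin n) → ℝ} (hf : ContDiff ℝ 2 f) (hf0 : ∀ z, 0 ≤ f z)
    (y : EuclideanSpace ℝ (Fin n)) {ε : ℝ} (hε : 0 < ε) :
    ∀ᶠ h in 𝓝[>] (0 : ℝ), ENNReal.ofReal (f y + h * (laplacian f y - ε)) ≤
      hS h (fun z => ENNReal.ofReal (f z)) y := by
  set L := fderiv ℝ f y with hL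
  set B := fderiv ℝ (fderiv ℝ f) y with hB
  have hm2 := mtwo_nonneg (n := n)
  have hm4 := mfour_nonneg (n := n)
  set ε1 := ε / (2 * (mtwo n + 1)) with hε1
  have hεpos : 0 < ε1 := by positivity
  obtain ⟨δ, hδ, hT⟩ := taylor2 hf y hεpos
  -- constant for the quartic term
  set A := (|f y| + ‖L‖ * δ + ‖B‖ * δ ^ 2) / δ ^ 4 with hA
  have hAp : 0 ≤ A := by positivity
  have hpt : ∀ w, f y + L w + B w w / 2 + (-ε1) * ‖w‖ ^ 2 + (-A) * ‖w‖ ^ 4 ≤ f (y + w) := by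
    intro w
    have h4 : 0 ≤ A * ‖w‖ ^ 4 := by positivity
    have h2 : 0 ≤ ε1 * ‖w‖ ^ 2 := by positivity
    rcases lt_or_ge ‖w‖ δ with hw | hw
    · have := (abs_le.1 (hT w hw)).1
      linarith
    · have h0 := hf0 (y + w)
      have hLw : L w ≤ ‖L‖ * ‖w‖ := (le_abs_self _).trans (L.le_opNorm w)
      have hBw : B w w ≤ ‖B‖ * ‖w‖ * ‖w‖ := (le_abs_self _).trans (B.le_opNorm₂ w w)
      have hwp : 0 < ‖w‖ := by linarith
      have k1 : |f y| ≤ |f y| / δ ^ 4 * ‖w‖ ^ 4 := by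
        rw [div_mul_eq_mul_div, le_div_iff₀ (by positivity)]; gcongr
      have k2 : ‖L‖ * ‖w‖ ≤ ‖L‖ * δ / δ ^ 4 * ‖w‖ ^ 4 := by
        rw [div_mul_eq_mul_div, le_div_iff₀ (by positivity)]
        calc ‖L‖ * ‖w‖ * δ ^ 4 = ‖L‖ * δ * (‖w‖ * δ ^ 3) := by ring
          _ ≤ ‖L‖ * δ * (‖w‖ * ‖w‖ ^ 3) := by gcongr
          _ = _ := by ring
      have k3 : ‖B‖ * ‖w‖ * ‖w‖ ≤ ‖B‖ * δ ^ 2 / δ ^ 4 * ‖w‖ ^ 4 := by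
        rw [div_mul_eq_mul_div, le_div_iff₀ (by positivity)]
        calc ‖B‖ * ‖w‖ * ‖w‖ * δ ^ 4 = ‖B‖ * δ ^ 2 * (‖w‖ ^ 2 * δ ^ 2) := by ring
          _ ≤ ‖B‖ * δ ^ 2 * (‖w‖ ^ 2 * ‖w‖ ^ 2) := by gcongr
          _ = _ := by ring
      have k4 : A * ‖w‖ ^ 4 = |f y| / δ ^ 4 * ‖w‖ ^ 4 + ‖L‖ * δ / δ ^ 4 * ‖w‖ ^ 4 +
          ‖B‖ * δ ^ 2 / δ ^ 4 * ‖w‖ ^ 4 := by rw [hA]; ring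
      have k5 := le_abs_self (f y)
      have k6 : 0 ≤ ‖B‖ * ‖w‖ * ‖w‖ := by positivity
      linarith
  have hsm : ∀ᶠ h in 𝓝[>] (0 : ℝ), h * (A * mfour n) ≤ ε / 2 := by
    have : Tendsto (fun h : ℝ => h * (A * mfour n)) (𝓝 0) (𝓝 0) := by
      have h1 : Continuous (fun h : ℝ => h * (A * mfour n)) := by fun_prop
      simpa using h1.tendsto 0
    exact ((this.eventually (gt_mem_nhds (show (0 : ℝ) < ε / 2 by positivity))).filter_mono
      nhdsWithin_le_nhds).mono fun h hh => hh.le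
  filter_upwards [hsm, self_mem_nhdsWithin] with h hh1 hh
  have hh : 0 < h := hh
  have hsq : √h ^ 2 = h := Real.sq_sqrt hh.le
  obtain ⟨hInteg, hval⟩ := poly_int (n := n) (f y) (-(ε1 * h)) (-(A * h ^ 2)) (√h • L) (h • B)
  have hle : f y + h * (laplacian f y - ε) ≤ f y + ∑ i, (h • B) (EuclideanSpace.single i 1)
      (EuclideanSpace.single i 1) + -(ε1 * h) * mtwo n + -(A * h ^ 2) * mfour n := by
    simp only [_root_.smul_apply, smul_eq_mul]
    rw [← Finset.mul_sum, ← laplacian_eq hf y]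
    have k1 : ε1 * mtwo n ≤ ε / 2 := by
      rw [hε1, div_mul_eq_mul_div, div_le_iff₀ (by positivity)]
      nlinarith
    have k2 : h * (h * (A * mfour n)) ≤ h * (ε / 2) := by gcongr
    have k3 : h * (ε1 * mtwo n) ≤ h * (ε / 2) := by gcongr
    nlinarith
  refine (ENNReal.ofReal_le_ofReal hle).trans ?_
  rw [← hval, hS_scale hh]
  refine (ofReal_integral_le_aux hInteg).trans (lintegral_mono fun ζ => ?_)
  simp only
  unfold hke
  rw [← ENNReal.ofReal_mul (hk_pos one_pos ζ).le]
  refine ENNReal.ofReal_le_ofReal (mul_le_mul_of_nonneg_left ?_ (hk_pos one_pos ζ).le)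
  refine le_trans (le_of_eq ?_) (hpt (√h • ζ))
  simp only [_root_.smul_apply, map_smul, smul_eq_mul, norm_smul, mul_pow,
    Real.norm_of_nonneg (Real.sqrt_nonneg h)]
  have h4 : √h ^ 4 = h ^ 2 := by rw [show (4 : ℕ) = 2 * 2 from rfl, pow_mul, hsq]
  rw [hsq, h4]
  rw [show √h * (√h * (B ζ) ζ) = √h ^ 2 * (B ζ) ζ by ring, hsq]
  ring

lemma gen_upper {f : EuclideanSpace ℝ (Fin n) → ℝ} (hf : ContDiff ℝ 2 f) (hf0 : ∀ z, 0 < f z)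
    (y : EuclideanSpace ℝ (Fin n)) {hs : ℝ} (hhs : 0 < hs)
    (hfin : hS hs (fun z => ENNReal.ofReal (f z)) y ≠ ⊤) {ε : ℝ} (hε : 0 < ε) :
    ∀ᶠ h in 𝓝[>] (0 : ℝ), hS h (fun z => ENNReal.ofReal (f z)) y ≤
      ENNReal.ofReal (f y + h * (laplacian f y + ε)) := by
  set L := fderiv ℝ f y with hL
  set B := fderiv ℝ (fderiv ℝ f) y with hB
  have hm2 := mtwo_nonneg (n := n)
  have hm4 := mfour_nonneg (n := n)
  set ε1 := ε / (3 * (mtwo n + 1)) with hε1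
  have hεpos : 0 < ε1 := by positivity
  obtain ⟨δ, hδ, hT⟩ := taylor2 hf y hεpos
  set A := (|f y| + ‖L‖ * δ + ‖B‖ * δ ^ 2) / δ ^ 4 with hA
  have hAp : 0 ≤ A := by positivity
  have hpt0 : ∀ w, δ ≤ ‖w‖ → 0 ≤ f y + L w + B w w / 2 + ε1 * ‖w‖ ^ 2 + A * ‖w‖ ^ 4 := by
    intro w hw
    have h2 : 0 ≤ ε1 * ‖w‖ ^ 2 := by positivity
    have hLw : -L w ≤ ‖L‖ * ‖w‖ := (neg_le_abs _).trans (L.le_opNorm w)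
    have hBw : -B w w ≤ ‖B‖ * ‖w‖ * ‖w‖ := (neg_le_abs _).trans (B.le_opNorm₂ w w)
    have hwp : 0 < ‖w‖ := by linarith
    have k1 : |f y| ≤ |f y| / δ ^ 4 * ‖w‖ ^ 4 := by
      rw [div_mul_eq_mul_div, le_div_iff₀ (by positivity)]; gcongr
    have k2 : ‖L‖ * ‖w‖ ≤ ‖L‖ * δ / δ ^ 4 * ‖w‖ ^ 4 := by
      rw [div_mul_eq_mul_div, le_div_iff₀ (by positivity)]
      calc ‖L‖ * ‖w‖ * δ ^ 4 = ‖L‖ * δ * (‖w‖ * δ ^ 3) := by ring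
        _ ≤ ‖L‖ * δ * (‖w‖ * ‖w‖ ^ 3) := by gcongr
        _ = _ := by ring
    have k3 : ‖B‖ * ‖w‖ * ‖w‖ ≤ ‖B‖ * δ ^ 2 / δ ^ 4 * ‖w‖ ^ 4 := by
      rw [div_mul_eq_mul_div, le_div_iff₀ (by positivity)]
      calc ‖B‖ * ‖w‖ * ‖w‖ * δ ^ 4 = ‖B‖ * δ ^ 2 * (‖w‖ ^ 2 * δ ^ 2) := by ring
        _ ≤ ‖B‖ * δ ^ 2 * (‖w‖ ^ 2 * ‖w‖ ^ 2) := by gcongr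
        _ = _ := by ring
    have k4 : A * ‖w‖ ^ 4 = |f y| / δ ^ 4 * ‖w‖ ^ 4 + ‖L‖ * δ / δ ^ 4 * ‖w‖ ^ 4 +
        ‖B‖ * δ ^ 2 / δ ^ 4 * ‖w‖ ^ 4 := by rw [hA]; ring
    have k5 := neg_le_abs (f y)
    have k6 : 0 ≤ ‖B‖ * ‖w‖ * ‖w‖ := by positivity
    linarith
  have hpt1 : ∀ w, ‖w‖ < δ → f (y + w) ≤ f y + L w + B w w / 2 + ε1 * ‖w‖ ^ 2 + A * ‖w‖ ^ 4 := by
    intro w hw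
    have h4 : 0 ≤ A * ‖w‖ ^ 4 := by positivity
    have := (abs_le.1 (hT w hw)).2
    linarith
  set D := (hS hs (fun z => ENNReal.ofReal (f z)) y).toReal with hD
  have hDp : 0 ≤ D := ENNReal.toReal_nonneg
  have hsm : ∀ᶠ h in 𝓝[>] (0 : ℝ), h * (A * mfour n) ≤ ε / 3 := by
    have : Tendsto (fun h : ℝ => h * (A * mfour n)) (𝓝 0) (𝓝 0) := by
      have h1 : Continuous (fun h : ℝ => h * (A * mfour n)) := by fun_prop
      simpa using h1.tendsto 0
    exact ((this.eventually (gt_mem_nhds (show (0 : ℝ) < ε / 3 by positivity))).filter_mono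
      nhdsWithin_le_nhds).mono fun h hh => hh.le
  filter_upwards [hsm, self_mem_nhdsWithin,
    hk_far (n := n) hδ hhs (show 0 < ε / (3 * (D + 1)) by positivity)] with h hh1 hh hfar
  have hh : 0 < h := hh
  have hsq : √h ^ 2 = h := Real.sq_sqrt hh.le
  obtain ⟨hInteg, hval⟩ := poly_int (n := n) (f y) (ε1 * h) (A * h ^ 2) (√h • L) (h • B)
  set q : EuclideanSpace ℝ (Fin n) → ℝ := fun w => f y + L w + B w w / 2 + ε1 * ‖w‖ ^ 2 +
    A * ‖w‖ ^ 4 with hq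
  have hqs : ∀ ζ, q (√h • ζ) = f y + (√h • L) ζ + (h • B) ζ ζ / 2 + ε1 * h * ‖ζ‖ ^ 2 +
      A * h ^ 2 * ‖ζ‖ ^ 4 := by
    intro ζ
    simp only [hq, _root_.smul_apply, map_smul, smul_eq_mul, norm_smul, mul_pow,
      Real.norm_of_nonneg (Real.sqrt_nonneg h)]
    have h4 : √h ^ 4 = h ^ 2 := by rw [show (4 : ℕ) = 2 * 2 from rfl, pow_mul, hsq]
    rw [hsq, h4]
    rw [show √h * (√h * (B ζ) ζ) = √h ^ 2 * (B ζ) ζ by ring, hsq]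
    ring
  have hq0 : ∀ w, 0 ≤ q w := by
    intro w
    rcases lt_or_ge ‖w‖ δ with hw | hw
    · exact (hf0 _).le.trans (hpt1 w hw)
    · exact hpt0 w hw
  have hstep : hS h (fun z => ENNReal.ofReal (f z)) y ≤
      hS h (fun z => ENNReal.ofReal (q (z - y))) y +
        ENNReal.ofReal (ε / (3 * (D + 1)) * h) * hS hs (fun z => ENNReal.ofReal (f z)) y := by
    have hfm : Measurable f := hf.continuous.measurable
    have hqm : Measurable q := by
      have : Continuous q := by simp only [hq]; fun_prop
      exact this.measurable
    unfold hS
    rw [← lintegral_const_mul _ (by fun_prop), ← lintegral_add_left (by fun_prop)]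
    refine lintegral_mono fun z => ?_
    simp only
    rcases lt_or_ge ‖z - y‖ δ with hw | hw
    · refine le_add_right (mul_le_mul_right (ENNReal.ofReal_le_ofReal ?_) _)
      have := hpt1 (z - y) hw
      rwa [add_sub_cancel] at this
    · refine le_add_left ?_
      rw [← mul_assoc]
      refine mul_le_mul_left ?_ _
      unfold hke
      rw [← ENNReal.ofReal_mul (by positivity)]
      exact ENNReal.ofReal_le_ofReal (hfar _ (by rwa [norm_sub_rev]))
  refine hstep.trans ?_
  have hq1 : hS h (fun z => ENNReal.ofReal (q (z - y))) y = ENNReal.ofReal (f y +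
      ∑ i, (h • B) (EuclideanSpace.single i 1) (EuclideanSpace.single i 1) + ε1 * h * mtwo n +
      A * h ^ 2 * mfour n) := by
    rw [← hval, hS_scale hh, ofReal_integral_eq_lintegral_ofReal hInteg]
    · refine lintegral_congr fun ζ => ?_
      rw [add_sub_cancel_left, ← hqs, ENNReal.ofReal_mul (hk_pos one_pos ζ).le, hke]
    · refine Eventually.of_forall fun ζ => ?_
      simp only [← hqs]
      exact mul_nonneg (hk_pos one_pos ζ).le (hq0 _)
  have hpolynn : 0 ≤ f y +
      ∑ i, (h • B) (EuclideanSpace.single i 1) (EuclideanSpace.single i 1) + ε1 * h * mtwo n +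
      A * h ^ 2 * mfour n := by
    rw [← hval]
    refine integral_nonneg fun ζ => ?_
    simp only [← hqs]
    exact mul_nonneg (hk_pos one_pos ζ).le (hq0 _)
  rw [hq1, ← ENNReal.ofReal_toReal hfin, ← hD, ← ENNReal.ofReal_mul (by positivity),
    ← ENNReal.ofReal_add hpolynn (by positivity)]
  refine ENNReal.ofReal_le_ofReal ?_
  simp only [_root_.smul_apply, smul_eq_mul]
  rw [← Finset.mul_sum, ← laplacian_eq hf y]
  have k1 : ε1 * mtwo n ≤ ε / 3 := by
    rw [hε1, div_mul_eq_mul_div, div_le_iff₀ (by positivity)]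
    nlinarith
  have k2 : h * (h * (A * mfour n)) ≤ h * (ε / 3) := by gcongr
  have k3 : h * (ε1 * mtwo n) ≤ h * (ε / 3) := by gcongr
  have k4 : ε / (3 * (D + 1)) * D ≤ ε / 3 := by
    rw [div_mul_eq_mul_div, div_le_iff₀ (by positivity)]
    nlinarith
  have k5 : h * (ε / (3 * (D + 1)) * D) ≤ h * (ε / 3) := by gcongr
  nlinarith

end gen
end

open MeasureTheory Set Filter Topology
open scoped ENNReal NNReal

noncomputable section

/-- defect cocycles of the heat semigroup -/
structure Coc {n : ℕ} (N : EuclideanSpace ℝ (Fin n) → ℝ → ℝ → ℝ≥0∞) : Prop where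
  meas : ∀ h, 0 < h → Measurable (fun q : EuclideanSpace ℝ (Fin n) × ℝ => N q.1 q.2 h)
  fin : ∀ x t h, 0 < t → 0 < h → N x t h ≠ ⊤
  coc : ∀ x t h₁ h₂, 0 < t → 0 < h₁ → 0 < h₂ →
    N x t (h₁ + h₂) = N x (t + h₁) h₂ + hS h₂ (fun z => N z t h₁) x

section coc
variable {n : ℕ} {N : EuclideanSpace ℝ (Fin n) → ℝ → ℝ → ℝ≥0∞}

lemma Coc.meas_x (hN : Coc N) (t : ℝ) {h : ℝ} (hh : 0 < h) : Measurable (fun z => N z t h) :=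
  (hN.meas h hh).comp (measurable_id.prodMk measurable_const)

lemma Coc.le (hN : Coc N) {t h₁ h₂ : ℝ} (ht : 0 < t) (h1 : 0 < h₁) (h2 : 0 < h₂)
    (x : EuclideanSpace ℝ (Fin n)) : hS h₂ (fun z => N z t h₁) x ≤ N x t (h₁ + h₂) := by
  rw [hN.coc x t h₁ h₂ ht h1 h2]; exact le_add_self

lemma Coc.b_add (hN : Coc N) {t0 t h T : ℝ} (h0 : 0 < t0) (ht : t0 < t) (hh : 0 < h)
    (hT : t + h < T) (X : EuclideanSpace ℝ (Fin n)) :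
    hS (T - (t + h)) (fun z => N z t0 (t + h - t0)) X =
      hS (T - t - h) (fun z => N z t h) X + hS (T - t) (fun z => N z t0 (t - t0)) X := by
  have e1 : ∀ z, N z t0 (t + h - t0) = N z t h + hS h (fun z => N z t0 (t - t0)) z := by
    intro z
    have := hN.coc z t0 (t - t0) h h0 (by linarith) hh
    rw [show t - t0 + h = t + h - t0 by ring, add_sub_cancel] at this
    exact this
  simp_rw [e1]
  rw [hS_add (hN.meas_x t hh), hS_hS (by linarith) hh (hN.meas_x t0 (by linarith))]
  rw [show T - (t + h) = T - t - h by ring, show T - t - h + h = T - t by ring]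

lemma Coc.b_le (hN : Coc N) {t0 t T : ℝ} (h0 : 0 < t0) (ht : t0 < t)
    (hT : t < T) (X : EuclideanSpace ℝ (Fin n)) :
    hS (T - t) (fun z => N z t0 (t - t0)) X ≤ N X t0 (T - t0) := by
  have := hN.le h0 (show 0 < t - t0 by linarith) (show 0 < T - t by linarith) X
  rwa [show t - t0 + (T - t) = T - t0 by ring] at this

lemma Coc.b_mono (hN : Coc N) {t0 T : ℝ} (h0 : 0 < t0) (X : EuclideanSpace ℝ (Fin n)) :
    MonotoneOn (fun t => hS (T - t) (fun z => N z t0 (t - t0)) X) (Ioo t0 T) := by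
  intro s hs t ht hst
  rcases hst.eq_or_lt with rfl | hst
  · exact le_rfl
  have := hN.b_add (t := s) (h := t - s) (T := T) h0 hs.1 (by linarith) (by linarith [ht.2]) X
  simp only [add_sub_cancel] at this
  simp only
  rw [this]; exact le_add_self

lemma shift_lintegral (g : ℝ → ℝ≥0∞) (a b h : ℝ) :
    ∫⁻ t in Ioc a b, g (t + h) = ∫⁻ t in Ioc (a + h) (b + h), g t := by
  have := (measurePreserving_add_right (volume : Measure ℝ) h).setLIntegral_comp_preimage_emb
    (MeasurableEquiv.addRight h).measurableEmbedding g (Ioc (a + h) (b + h))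
  simpa using this

lemma Coc.main_eq (hN : Coc N) {t0 t1 t2 h T : ℝ} (h0 : 0 < t0) (h01 : t0 ≤ t1)
    (hh : 0 < h) (hT : t2 + h < T) (X : EuclideanSpace ℝ (Fin n)) :
    (∫⁻ t in Ioc t1 t2, hS (T - t - h) (fun z => N z t h) X) +
      ∫⁻ t in Ioc t1 t2, hS (T - t) (fun z => N z t0 (t - t0)) X =
      ∫⁻ t in Ioc (t1 + h) (t2 + h), hS (T - t) (fun z => N z t0 (t - t0)) X := by
  have hm : AEMeasurable (fun t => hS (T - t) (fun z => N z t0 (t - t0)) X)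
      (volume.restrict (Ioc t1 t2)) :=
    aemeasurable_restrict_of_monotoneOn measurableSet_Ioc
      ((hN.b_mono h0 X).mono fun t ht => ⟨lt_of_le_of_lt h01 ht.1, by linarith [ht.2]⟩)
  rw [← lintegral_add_right' _ hm, ← shift_lintegral]
  refine setLIntegral_congr_fun measurableSet_Ioc fun t ht => ?_
  exact (hN.b_add h0 (lt_of_le_of_lt h01 ht.1) hh (by linarith [ht.2]) X).symm

lemma Coc.F1 (hN : Coc N) {t1 t2 h T : ℝ} (h0 : 0 < t1)
    (h12 : t1 ≤ t2) (hh : 0 < h) (hT : t2 + h < T) (X : EuclideanSpace ℝ (Fin n)) :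
    ∫⁻ t in Ioc t1 t2, hS (T - t - h) (fun z => N z t h) X ≤
      ENNReal.ofReal h * N X t1 (T - t1) := by
  set g := fun t => hS (T - t) (fun z => N z t1 (t - t1)) X with hg
  have hgB : ∀ t ∈ Ioo t1 T, g t ≤ N X t1 (T - t1) := fun t ht => hN.b_le h0 ht.1 ht.2 X
  have e := hN.main_eq (t1 := t1) (t2 := t2) h0 le_rfl hh hT X
  have hB := hN.fin X t1 (T - t1) h0 (by linarith)
  have hInteg : ∀ a b, t1 ≤ a → b < T → ∫⁻ t in Ioc a b, g t ≤ N X t1 (T - t1) * ENNReal.ofReal (b - a) := by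
    intro a b ha hb
    calc ∫⁻ t in Ioc a b, g t ≤ ∫⁻ t in Ioc a b, N X t1 (T - t1) :=
          setLIntegral_mono' measurableSet_Ioc fun t ht =>
            hgB t ⟨lt_of_le_of_lt ha ht.1, lt_of_le_of_lt ht.2 hb⟩
      _ = _ := by rw [setLIntegral_const, Real.volume_Ioc]
  have hfin : ∫⁻ t in Ioc t1 t2, g t ≠ ⊤ :=
    ((hInteg t1 t2 le_rfl (by linarith)).trans_lt (ENNReal.mul_lt_top hB.lt_top
      ENNReal.ofReal_lt_top)).ne
  have hle : ∫⁻ t in Ioc (t1 + h) (t2 + h), g t ≤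
      ENNReal.ofReal h * N X t1 (T - t1) + ∫⁻ t in Ioc t1 t2, g t := by
    calc ∫⁻ t in Ioc (t1 + h) (t2 + h), g t ≤ ∫⁻ t in Ioc t1 t2 ∪ Ioc t2 (t2 + h), g t := by
          apply lintegral_mono_set
          rw [Ioc_union_Ioc_eq_Ioc h12 (by linarith)]
          exact Ioc_subset_Ioc_left (by linarith)
      _ ≤ (∫⁻ t in Ioc t1 t2, g t) + ∫⁻ t in Ioc t2 (t2 + h), g t := lintegral_union_le _ _ _
      _ ≤ _ := by
          rw [add_comm]
          gcongr
          refine (hInteg t2 (t2 + h) h12 hT).trans (le_of_eq ?_)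
          rw [add_sub_cancel_left, mul_comm]
  rw [← e] at hle
  exact (ENNReal.add_le_add_iff_right hfin).1 hle

lemma Coc.F2 (hN : Coc N) {t1 t1' t2 h T : ℝ} (h0 : 0 < t1) (hh : 0 < h) (h1 : t1 + h < t1')
    (h12 : t1' < t2) (hT : t2 + h < T) (X : EuclideanSpace ℝ (Fin n)) :
    ENNReal.ofReal h * hS (T - t2) (fun z => N z t1' (t2 - t1')) X ≤
    ∫⁻ t in Ioc t1 t2, hS (T - t - h) (fun z => N z t h) X := by
  have h00 : 0 < t1 / 2 := by positivity
  set t0 := t1 / 2 with ht0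
  have h01 : t0 < t1 := by rw [ht0]; linarith
  set g := fun t => hS (T - t) (fun z => N z t0 (t - t0)) X with hg
  have hmono := hN.b_mono (T := T) h00 X
  have e := hN.main_eq (t1 := t1) (t2 := t2) h00 h01.le hh hT X
  have hB := hN.fin X t0 (T - t0) h00 (by linarith)
  have hgB : ∀ t ∈ Ioo t0 T, g t ≤ N X t0 (T - t0) := fun t ht => hN.b_le h00 ht.1 ht.2 X
  have hg2 : g t2 = hS (T - t2) (fun z => N z t1' (t2 - t1')) X + g t1' := by
    have := hN.b_add (t := t1') (h := t2 - t1') (T := T) h00 (by linarith) (by linarith)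
      (by linarith) X
    simp only [add_sub_cancel] at this
    rw [show T - t1' - (t2 - t1') = T - t2 by ring] at this
    exact this
  have k1 : ENNReal.ofReal h * g t2 ≤ ∫⁻ t in Ioc t2 (t2 + h), g t := by
    calc ENNReal.ofReal h * g t2 = ∫⁻ t in Ioc t2 (t2 + h), g t2 := by
          rw [setLIntegral_const, Real.volume_Ioc, add_sub_cancel_left, mul_comm]
      _ ≤ _ := setLIntegral_mono' measurableSet_Ioc fun t ht =>
          hmono ⟨by linarith, by linarith⟩ ⟨by linarith [ht.1], by linarith [ht.2]⟩ ht.1.le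
  have k2 : ∫⁻ t in Ioc t1 (t1 + h), g t ≤ ENNReal.ofReal h * g t1' := by
    calc ∫⁻ t in Ioc t1 (t1 + h), g t ≤ ∫⁻ t in Ioc t1 (t1 + h), g t1' :=
          setLIntegral_mono' measurableSet_Ioc fun t ht =>
            hmono ⟨by linarith [ht.1], by linarith [ht.2]⟩ ⟨by linarith, by linarith⟩
              (by linarith [ht.2])
      _ = _ := by rw [setLIntegral_const, Real.volume_Ioc, add_sub_cancel_left, mul_comm]
  have s1 : ∫⁻ t in Ioc t1 t2, g t = (∫⁻ t in Ioc t1 (t1 + h), g t) + ∫⁻ t in Ioc (t1 + h) t2, g t := by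
    rw [← Ioc_union_Ioc_eq_Ioc (show t1 ≤ t1 + h by linarith) (show t1 + h ≤ t2 by linarith)]
    exact lintegral_union measurableSet_Ioc (Ioc_disjoint_Ioc_of_le le_rfl)
  have s2 : ∫⁻ t in Ioc (t1 + h) (t2 + h), g t =
      (∫⁻ t in Ioc (t1 + h) t2, g t) + ∫⁻ t in Ioc t2 (t2 + h), g t := by
    rw [← Ioc_union_Ioc_eq_Ioc (show t1 + h ≤ t2 by linarith) (show t2 ≤ t2 + h by linarith)]
    exact lintegral_union measurableSet_Ioc (Ioc_disjoint_Ioc_of_le le_rfl)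
  have hfin : ∫⁻ t in Ioc (t1 + h) t2, g t ≠ ⊤ := by
    refine (lt_of_le_of_lt (setLIntegral_mono' (g := fun _ => N X t0 (T - t0))
      measurableSet_Ioc fun t ht => hgB t ⟨by linarith [ht.1], by linarith [ht.2]⟩) ?_).ne
    rw [setLIntegral_const, Real.volume_Ioc]
    exact ENNReal.mul_lt_top hB.lt_top ENNReal.ofReal_lt_top
  set I := ∫⁻ t in Ioc t1 t2, hS (T - t - h) (fun z => N z t h) X
  have e' : I + ((∫⁻ t in Ioc t1 (t1 + h), g t) + ∫⁻ t in Ioc (t1 + h) t2, g t) =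
      (∫⁻ t in Ioc (t1 + h) t2, g t) + ∫⁻ t in Ioc t2 (t2 + h), g t := by
    rw [← s1, ← s2]; exact e
  have hc : I + ∫⁻ t in Ioc t1 (t1 + h), g t = ∫⁻ t in Ioc t2 (t2 + h), g t := by
    rw [← add_assoc, add_comm (∫⁻ t in Ioc (t1 + h) t2, g t)] at e'
    exact (ENNReal.add_left_inj hfin).1 e'
  have hf1 : ENNReal.ofReal h * g t1' ≠ ⊤ :=
    ENNReal.mul_ne_top ENNReal.ofReal_ne_top
      ((hgB t1' ⟨by linarith, by linarith⟩).trans_lt hB.lt_top).ne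
  refine (ENNReal.add_le_add_iff_right hf1).1 ?_
  calc _ = ENNReal.ofReal h * g t2 := by rw [hg2, mul_add]
    _ ≤ _ := k1
    _ = I + ∫⁻ t in Ioc t1 (t1 + h), g t := hc.symm
    _ ≤ _ := by gcongr

end coc
end

open MeasureTheory Set Filter Topology
open scoped ENNReal NNReal

noncomputable section

lemma ultra_lim {ι : Type*} (U : Ultrafilter ι) (f : ι → ℝ≥0∞) :
    Tendsto f U (𝓝 ((U.map f).lim)) := by
  have := (U.map f).le_nhds_lim
  exact this

lemma exists_weak_limit {G : Type*} [TopologicalSpace G] [T2Space G] [MeasurableSpace G]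
    [BorelSpace G] (l : Filter ℝ) [l.NeBot] (ν : ℝ → Measure G)
    (hb : ∀ K : Set G, IsCompact K → ∃ C : ℝ≥0∞, C ≠ ⊤ ∧ ∀ᶠ h in l, ν h K ≤ C) :
    ∃ (U : Ultrafilter ℝ) (μ : Measure G), (U : Filter ℝ) ≤ l ∧
      (∀ (O K : Set G) (c : ℝ≥0∞), IsOpen O → IsCompact K → O ⊆ K →
        (∀ᶠ h in (U : Filter ℝ), ν h K ≤ c) → μ O ≤ c) ∧
      (∀ K : Set G, IsCompact K → μ K = 0 → Tendsto (fun h => ν h K) U (𝓝 0)) := by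
  classical
  set U := Ultrafilter.of l with hU
  have hUl : (U : Filter ℝ) ≤ l := Ultrafilter.of_le l
  set m : Set G → ℝ≥0∞ := fun A => (U.map (fun h => ν h A)).lim with hm
  have hmt : ∀ A, Tendsto (fun h => ν h A) U (𝓝 (m A)) := fun A => ultra_lim U _
  have hfin : ∀ K : TopologicalSpace.Compacts G, m K ≠ ⊤ := by
    intro K
    obtain ⟨C, hC, h⟩ := hb K K.isCompact
    exact ((le_of_tendsto (hmt K) (hUl h)).trans_lt hC.lt_top).ne
  have hmono : ∀ A B : Set G, A ⊆ B → m A ≤ m B := fun A B h =>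
    le_of_tendsto_of_tendsto' (hmt A) (hmt B) fun x => measure_mono h
  have hsub : ∀ A B : Set G, m (A ∪ B) ≤ m A + m B := fun A B =>
    le_of_tendsto_of_tendsto' (hmt _) ((hmt A).add (hmt B)) fun x => measure_union_le _ _
  have hadd : ∀ A B : Set G, Disjoint A B → MeasurableSet B → m (A ∪ B) = m A + m B := by
    intro A B h hB
    refine tendsto_nhds_unique (hmt _) ?_
    simp_rw [measure_union h hB]
    exact (hmt A).add (hmt B)
  let c : Content G :=
    { toFun := fun K => (m K).toNNReal
      mono' := fun K L h => by
        apply ENNReal.toNNReal_mono (hfin L) (hmono _ _ h)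
      sup_disjoint' := fun K L h _ hL => by
        rw [TopologicalSpace.Compacts.coe_sup, hadd _ _ h hL.measurableSet,
          ENNReal.toNNReal_add (hfin K) (hfin L)]
      sup_le' := fun K L => by
        rw [TopologicalSpace.Compacts.coe_sup, ← ENNReal.toNNReal_add (hfin K) (hfin L)]
        exact ENNReal.toNNReal_mono (ENNReal.add_ne_top.2 ⟨hfin K, hfin L⟩) (hsub _ _) }
  have hc : ∀ K : TopologicalSpace.Compacts G, c K = m K := fun K =>
    ENNReal.coe_toNNReal (hfin K)
  refine ⟨U, c.measure, hUl, ?_, ?_⟩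
  · intro O K d hO hK hOK h
    rw [c.measure_apply hO.measurableSet]
    refine (c.outerMeasure_le ⟨O, hO⟩ ⟨K, hK⟩ hOK).trans ?_
    rw [hc]
    exact le_of_tendsto (hmt K) h
  · intro K hK h0
    rw [c.measure_apply hK.measurableSet] at h0
    have := c.le_outerMeasure_compacts ⟨K, hK⟩
    rw [hc] at this
    have h1 : m K = 0 := le_antisymm (this.trans h0.le) bot_le
    rw [← h1]
    exact hmt K

section cocmeas
variable {n : ℕ} {N : EuclideanSpace ℝ (Fin n) → ℝ → ℝ → ℝ≥0∞}

/-- the normalised defect density as a measure -/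
def nu (N : EuclideanSpace ℝ (Fin n) → ℝ → ℝ → ℝ≥0∞) (t1 h : ℝ) :
    Measure (EuclideanSpace ℝ (Fin n) × ℝ) :=
  ((volume.prod volume).restrict (univ ×ˢ Ioi t1)).withDensity
    (fun q => N q.1 q.2 h / ENNReal.ofReal h)

lemma nu_prod (hN : Coc N) {t1 h : ℝ} (hh : 0 < h) {A : Set (EuclideanSpace ℝ (Fin n))}
    (hA : MeasurableSet A) {B : Set ℝ} (hB : MeasurableSet B) (hBt : B ⊆ Ioi t1) :
    ENNReal.ofReal h * nu N t1 h (A ×ˢ B) = ∫⁻ t in B, ∫⁻ z in A, N z t h := by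
  have h0 : ENNReal.ofReal h ≠ 0 := by simpa using hh
  have hd : Measurable (fun q : EuclideanSpace ℝ (Fin n) × ℝ => N q.1 q.2 h / ENNReal.ofReal h) :=
    (hN.meas h hh).div_const _
  unfold nu
  rw [withDensity_apply _ (hA.prod hB), Measure.restrict_restrict (hA.prod hB),
    inter_eq_left.2 (prod_mono (subset_univ _) hBt), ← lintegral_const_mul _ hd]
  simp_rw [ENNReal.mul_div_cancel h0 ENNReal.ofReal_ne_top]
  rw [← Measure.prod_restrict, lintegral_prod_symm' _ (hN.meas h hh)]

/-- local mass bound -/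
lemma Coc.KL (hN : Coc N) {a b h T σ S R : ℝ} (ha : 0 < a) (hab : a ≤ b) (hh : 0 < h)
    (hσ : 0 < σ) (hσ' : σ ≤ T - b - h) (hS' : T - a ≤ S) (hR : 0 ≤ R)
    (X : EuclideanSpace ℝ (Fin n)) :
    ENNReal.ofReal ((4 * Real.pi * S) ^ (-(n : ℝ) / 2) * Real.exp (-R ^ 2 / (4 * σ))) *
      ∫⁻ t in Ioc a b, ∫⁻ z in Metric.closedBall X R, N z t h ≤
      ENNReal.ofReal h * N X a (T - a) := by
  refine le_trans ?_ (hN.F1 ha hab hh (by linarith) X)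
  rw [← lintegral_const_mul']
  swap
  · exact ENNReal.ofReal_ne_top
  refine setLIntegral_mono' measurableSet_Ioc fun t ht => ?_
  rw [← lintegral_const_mul' _ _ ENNReal.ofReal_ne_top]
  unfold hS
  refine le_trans ?_ (setLIntegral_le_lintegral (Metric.closedBall X R) _)
  refine setLIntegral_mono' measurableSet_closedBall fun z hz => ?_
  refine mul_le_mul_left (ENNReal.ofReal_le_ofReal ?_) _
  have hτ : σ ≤ T - t - h := by linarith [ht.2]
  have hτ0 : 0 < T - t - h := by linarith
  unfold hk
  have hz' : ‖X - z‖ ≤ R := by rw [← dist_eq_norm, dist_comm]; exact hz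
  gcongr ?_ * ?_
  · exact Real.rpow_le_rpow_of_nonpos (by positivity)
      (by gcongr; linarith [ht.1]) (by have : (0:ℝ) ≤ n := by positivity
                                       linarith)
  · apply Real.exp_le_exp.2
    rw [neg_div, neg_div, neg_le_neg_iff]
    gcongr

end cocmeas
end

open MeasureTheory Set Filter Topology
open scoped ENNReal NNReal

noncomputable section

section cocmeas2
variable {n : ℕ} {N : EuclideanSpace ℝ (Fin n) → ℝ → ℝ → ℝ≥0∞}

lemma Coc.nuKL (hN : Coc N) {t1 a b h T σ S R : ℝ} (ha : 0 < a) (h1 : t1 ≤ a) (hab : a ≤ b)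
    (hh : 0 < h) (hσ : 0 < σ) (hσ' : σ ≤ T - b - h) (hS' : T - a ≤ S) (hR : 0 ≤ R)
    (X : EuclideanSpace ℝ (Fin n)) :
    nu N t1 h (Metric.closedBall X R ×ˢ Ioc a b) ≤ N X a (T - a) /
      ENNReal.ofReal ((4 * Real.pi * S) ^ (-(n : ℝ) / 2) * Real.exp (-R ^ 2 / (4 * σ))) := by
  have h0 : ENNReal.ofReal h ≠ 0 := by simpa using hh
  have hS0 : 0 < S := by linarith
  have hc : 0 < (4 * Real.pi * S) ^ (-(n : ℝ) / 2) * Real.exp (-R ^ 2 / (4 * σ)) := by positivity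
  have h2 := hN.KL ha hab hh hσ hσ' hS' hR X
  rw [← nu_prod hN hh measurableSet_closedBall measurableSet_Ioc
    (fun t ht => lt_of_le_of_lt h1 ht.1)] at h2
  rw [mul_left_comm] at h2
  have h3 := (ENNReal.mul_le_mul_iff_right h0 ENNReal.ofReal_ne_top).1 h2
  rw [ENNReal.le_div_iff_mul_le (Or.inl (by simpa using hc)) (Or.inl ENNReal.ofReal_ne_top),
    mul_comm]
  exact h3

lemma Coc.nu_bdd (hN : Coc N) {t1 : ℝ} (h1 : 0 < t1)
    (K : Set (EuclideanSpace ℝ (Fin n) × ℝ)) (hK : IsCompact K) :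
    ∃ C : ℝ≥0∞, C ≠ ⊤ ∧ ∀ᶠ h in 𝓝[>] (0:ℝ), nu N t1 h K ≤ C := by
  obtain ⟨R, hR⟩ := (hK.isBounded).subset_closedBall 0
  set b := max R t1 + 1 with hb
  set R' := max R 0
  have hR0 : 0 ≤ R' := le_max_right _ _
  have hb1 : t1 ≤ b := by rw [hb]; linarith [le_max_right R t1]
  refine ⟨N 0 t1 (b + 2 - t1) / ENNReal.ofReal ((4 * Real.pi * (b + 2)) ^ (-(n : ℝ) / 2) *
    Real.exp (-R' ^ 2 / (4 * 1))), ?_, ?_⟩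
  · refine (ENNReal.div_lt_top (hN.fin _ _ _ h1 (by linarith)) ?_).ne
    have : 0 < b + 2 := by linarith
    have : 0 < (4 * Real.pi * (b + 2)) ^ (-(n : ℝ) / 2) * Real.exp (-R' ^ 2 / (4 * 1)) := by
      positivity
    simpa using this
  · filter_upwards [self_mem_nhdsWithin, mem_nhdsWithin_of_mem_nhds (Iio_mem_nhds one_pos)]
      with h hh hh1
    have hh : 0 < h := hh
    have hh1 : h < 1 := hh1
    have hsub : K ⊆ (Metric.closedBall 0 R' ×ˢ Ioc t1 b) ∪ (univ ×ˢ Ioi t1)ᶜ := by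
      intro q hq
      by_cases hq1 : t1 < q.2
      · left
        have := hR hq
        rw [mem_closedBall_zero_iff, Prod.norm_def] at this
        have h1 := (le_max_left ‖q.1‖ ‖q.2‖).trans this
        have h2 := (le_max_right ‖q.1‖ ‖q.2‖).trans this
        refine ⟨by rw [mem_closedBall_zero_iff]; exact h1.trans (le_max_left _ _), hq1, ?_⟩
        have := (le_abs_self q.2).trans h2
        rw [hb]; linarith [le_max_left R t1]
      · right; simpa using hq1
    have hz : nu N t1 h ((univ ×ˢ Ioi t1)ᶜ) = 0 := by
      unfold nu
      refine withDensity_absolutelyContinuous _ _ ?_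
      rw [Measure.restrict_apply (MeasurableSet.univ.prod measurableSet_Ioi).compl]
      simp
    calc nu N t1 h K ≤ _ := measure_mono hsub
      _ ≤ _ := measure_union_le _ _
      _ = nu N t1 h (Metric.closedBall 0 R' ×ˢ Ioc t1 b) := by rw [hz, add_zero]
      _ ≤ _ := hN.nuKL h1 le_rfl hb1 hh one_pos (T := b + 2) (by linarith) (by linarith) hR0 0

lemma Coc.cyl (hN : Coc N)
    (back : ∀ x t h, 0 < t → 0 < h → ∀ c, N x t h < c →
      ∀ᶠ δ in 𝓝[>] (0:ℝ), N x (t - δ) (h + δ) < c) {t1 : ℝ} (h1 : 0 < t1)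
    {U : Ultrafilter ℝ} (hU : (U : Filter ℝ) ≤ 𝓝[>] 0)
    {μ : Measure (EuclideanSpace ℝ (Fin n) × ℝ)}
    (hμ : ∀ (O K : Set (EuclideanSpace ℝ (Fin n) × ℝ)) (c : ℝ≥0∞), IsOpen O → IsCompact K →
      O ⊆ K → (∀ᶠ h in (U : Filter ℝ), nu N t1 h K ≤ c) → μ O ≤ c)
    {x : EuclideanSpace ℝ (Fin n)} {t ρ : ℝ} {c : ℝ≥0∞} (ht : t1 < t) (hρ : 0 < ρ)
    (hc : N x t (3 * ρ ^ 2) < c) :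
    μ (Metric.ball x ρ ×ˢ Ico t (t + ρ ^ 2)) ≤
      c / ENNReal.ofReal ((4 * Real.pi * (4 * ρ ^ 2)) ^ (-(n : ℝ) / 2) * Real.exp (-1 / 4)) := by
  have hρ2 : 0 < ρ ^ 2 := by positivity
  have e1 : ∀ᶠ δ in 𝓝[>] (0:ℝ), δ < ρ ^ 2 := mem_nhdsWithin_of_mem_nhds (Iio_mem_nhds hρ2)
  have e2 : ∀ᶠ δ in 𝓝[>] (0:ℝ), δ < t - t1 :=
    mem_nhdsWithin_of_mem_nhds (Iio_mem_nhds (sub_pos.2 ht))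
  have e3 : ∀ᶠ δ in 𝓝[>] (0:ℝ), 0 < δ := eventually_mem_nhdsWithin
  obtain ⟨δ, hδ, hδ0, hδ1, hδ2⟩ := ((back x t (3 * ρ ^ 2) (by linarith) (by positivity) c hc).and
    (e3.and (e1.and e2))).exists
  have hδ0 : 0 < δ := hδ0
  have hδ1 : δ < ρ ^ 2 := hδ1
  have hδ2 : δ < t - t1 := hδ2
  refine (measure_mono ?_).trans (hμ (Metric.ball x ρ ×ˢ Ioo (t - δ / 2) (t + ρ ^ 2))
    (Metric.closedBall x ρ ×ˢ Icc (t - δ / 2) (t + ρ ^ 2)) _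
    (Metric.isOpen_ball.prod isOpen_Ioo) ((isCompact_closedBall x ρ).prod isCompact_Icc)
    (prod_mono Metric.ball_subset_closedBall Ioo_subset_Icc_self) ?_)
  · exact prod_mono le_rfl fun s hs => ⟨by linarith [hs.1], hs.2⟩
  · filter_upwards [hU self_mem_nhdsWithin,
      hU (mem_nhdsWithin_of_mem_nhds (Iio_mem_nhds hρ2))] with h hh hh1
    have hh : 0 < h := hh
    have hh1 : h < ρ ^ 2 := hh1
    refine (measure_mono (prod_mono le_rfl (t₂ := Ioc (t - δ) (t + ρ ^ 2)) fun s hs =>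
      ⟨by linarith [hs.1], hs.2⟩)).trans ?_
    refine (hN.nuKL (T := t + 3 * ρ ^ 2) (σ := ρ ^ 2) (S := 4 * ρ ^ 2) (by linarith) (by linarith)
      (by linarith) hh hρ2 (by linarith) (by linarith) hρ.le x).trans ?_
    rw [show t + 3 * ρ ^ 2 - (t - δ) = 3 * ρ ^ 2 + δ by ring,
      show -ρ ^ 2 / (4 * ρ ^ 2) = -1 / 4 by field_simp]
    gcongr

lemma measure_cell {μ : Measure (EuclideanSpace ℝ (Fin n) × ℝ)} {ρ : ℝ} {B : ℝ≥0∞}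
    (A : Set (EuclideanSpace ℝ (Fin n) × ℝ))
    (hA : ∀ p ∈ A, μ (Metric.ball p.1 ρ ×ˢ Ico p.2 (p.2 + ρ ^ 2)) ≤ B)
    (hd : ∀ p ∈ A, ∀ q ∈ A, dist p.1 q.1 < ρ ∧ p.2 < q.2 + ρ ^ 2) (hb : BddBelow (Prod.snd '' A)) :
    μ A ≤ B := by
  rcases A.eq_empty_or_nonempty with rfl | hne
  · simp
  have hsub : ∀ q ∈ A, μ (A ∩ {p | q.2 ≤ p.2}) ≤ B := fun q hq =>
    (measure_mono (show A ∩ {p | q.2 ≤ p.2} ⊆ Metric.ball q.1 ρ ×ˢ Ico q.2 (q.2 + ρ ^ 2) from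
      fun p hp => ⟨(hd p hp.1 q hq).1, hp.2, (hd p hp.1 q hq).2⟩)).trans (hA q hq)
  obtain ⟨u, hu, hlim, hmem⟩ := exists_seq_tendsto_sInf (hne.image Prod.snd) hb
  by_cases hmin : sInf (Prod.snd '' A) ∈ Prod.snd '' A
  · obtain ⟨q, hq, hqe⟩ := hmin
    have : A ⊆ A ∩ {p | q.2 ≤ p.2} := fun p hp =>
      ⟨hp, by rw [mem_ofPred_eq, hqe]; exact csInf_le hb ⟨p, hp, rfl⟩⟩
    exact (measure_mono this).trans (hsub q hq)
  · have hcov : A ⊆ ⋃ i, A ∩ {p | u i ≤ p.2} := by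
      intro p hp
      have hlt : sInf (Prod.snd '' A) < p.2 := lt_of_le_of_ne (csInf_le hb ⟨p, hp, rfl⟩)
        fun h => hmin (h ▸ ⟨p, hp, rfl⟩)
      obtain ⟨i, hi⟩ := (hlim.eventually (Iio_mem_nhds hlt)).exists
      exact mem_iUnion.2 ⟨i, hp, (show u i < p.2 from hi).le⟩
    refine (measure_mono hcov).trans ?_
    rw [Monotone.measure_iUnion]
    · refine iSup_le fun i => ?_
      obtain ⟨q, hq, hqe⟩ := hmem i
      rw [← hqe]; exact hsub q hq
    · intro i j hij p hp
      exact ⟨hp.1, (hu hij).trans hp.2⟩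

/-- cells -/
def cellMap (n m : ℕ) (p : EuclideanSpace ℝ (Fin n) × ℝ) : (Fin n → ℤ) × ℤ :=
  (fun i => ⌊(m : ℝ) * p.1 i⌋, ⌊(m : ℝ) ^ 2 * p.2⌋)

lemma cell_close {m : ℕ} (hm : 0 < m) {p q : EuclideanSpace ℝ (Fin n) × ℝ}
    (h : cellMap n m p = cellMap n m q) :
    dist p.1 q.1 < (n + 1) / m ∧ p.2 < q.2 + ((n + 1) / m : ℝ) ^ 2 := by
  have hm' : (0:ℝ) < m := by exact_mod_cast hm
  have h1 := congrArg Prod.fst h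
  have h2 := congrArg Prod.snd h
  simp only [cellMap] at h1 h2
  constructor
  · have hc : ∀ i, |p.1 i - q.1 i| ≤ 1 / m := by
      intro i
      have := Int.abs_sub_lt_one_of_floor_eq_floor (congrFun h1 i)
      rw [← mul_sub, abs_mul, abs_of_pos hm'] at this
      rw [le_div_iff₀ hm']; linarith
    rw [EuclideanSpace.dist_eq]
    have : √(∑ i, dist (p.1 i) (q.1 i) ^ 2) ≤ ∑ i, dist (p.1 i) (q.1 i) := by
      rw [Real.sqrt_le_left (Finset.sum_nonneg fun i _ => dist_nonneg)]
      exact Finset.sum_sq_le_sq_sum_of_nonneg fun i _ => dist_nonneg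
    refine this.trans_lt ?_
    calc ∑ i, dist (p.1 i) (q.1 i) ≤ ∑ i : Fin n, 1 / (m:ℝ) :=
          Finset.sum_le_sum fun i _ => by rw [Real.dist_eq]; exact hc i
      _ = n / m := by simp [div_eq_mul_inv]
      _ < _ := by gcongr; linarith
  · have := Int.abs_sub_lt_one_of_floor_eq_floor h2
    rw [← mul_sub, abs_mul, abs_of_pos (by positivity)] at this
    have h3 : p.2 - q.2 < 1 / (m:ℝ) ^ 2 := by
      rw [lt_div_iff₀ (by positivity)]
      have := mul_le_mul_of_nonneg_left (le_abs_self (p.2 - q.2)) (show 0 ≤ (m:ℝ)^2 by positivity)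
      linarith
    have h4 : 1 / (m:ℝ) ^ 2 ≤ ((n + 1) / m : ℝ) ^ 2 := by
      rw [div_pow]; gcongr
      have : (0:ℝ) ≤ n := by positivity
      nlinarith
    linarith

lemma measure_cells {μ : Measure (EuclideanSpace ℝ (Fin n) × ℝ)} {m R : ℕ} {B : ℝ≥0∞}
    (hm : 0 < m) (hR : 0 < R)
    (A : Set (EuclideanSpace ℝ (Fin n) × ℝ))
    (hA : ∀ p ∈ A, μ (Metric.ball p.1 ((n + 1) / m) ×ˢ Ico p.2 (p.2 + ((n + 1) / m) ^ 2)) ≤ B)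
    (hR' : ∀ p ∈ A, ‖p.1‖ ≤ R ∧ 0 ≤ p.2 ∧ p.2 ≤ R) :
    μ A ≤ (((3 * m * R) ^ n * (2 * m ^ 2 * R) : ℕ) : ℝ≥0∞) * B := by
  classical
  set S : Finset ((Fin n → ℤ) × ℤ) :=
    (Fintype.piFinset fun _ => Finset.Icc (-(m * R : ℤ)) (m * R)) ×ˢ Finset.Icc 0 (m ^ 2 * R : ℤ)
    with hS
  have hm' : (0:ℝ) < m := by exact_mod_cast hm
  have hcov : A ⊆ ⋃ κ ∈ S, A ∩ {p | cellMap n m p = κ} := by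
    intro p hp
    refine mem_iUnion₂.2 ⟨cellMap n m p, ?_, hp, rfl⟩
    obtain ⟨h1, h2, h3⟩ := hR' p hp
    simp only [hS, Finset.mem_product, Fintype.mem_piFinset, Finset.mem_Icc, cellMap]
    refine ⟨fun i => ?_, ?_, ?_⟩
    · have := abs_le.1 ((PiLp.norm_apply_le p.1 i).trans h1)
      constructor
      · rw [Int.le_floor]; push_cast; nlinarith
      · have : ((⌊(m:ℝ) * p.1 i⌋ : ℤ) : ℝ) ≤ m * R := (Int.floor_le _).trans (by gcongr; exact this.2)
        exact_mod_cast this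
    · exact Int.floor_nonneg.2 (by positivity)
    · have : ((⌊(m:ℝ) ^ 2 * p.2⌋ : ℤ) : ℝ) ≤ m ^ 2 * R := (Int.floor_le _).trans (by gcongr)
      exact_mod_cast this
  calc μ A ≤ μ (⋃ κ ∈ S, A ∩ {p | cellMap n m p = κ}) := measure_mono hcov
    _ ≤ ∑ κ ∈ S, μ (A ∩ {p | cellMap n m p = κ}) := measure_biUnion_finset_le _ _
    _ ≤ ∑ κ ∈ S, B := by
        refine Finset.sum_le_sum fun κ _ => measure_cell (ρ := (n + 1) / m) _ (fun p hp => hA p hp.1)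
          (fun p hp q hq => cell_close hm (hp.2.trans hq.2.symm)) ?_
        refine ⟨0, ?_⟩
        rintro _ ⟨p, hp, rfl⟩
        exact (hR' p hp.1).2.1
    _ = (S.card : ℝ≥0∞) * B := by rw [Finset.sum_const, nsmul_eq_mul]
    _ ≤ _ := by
        gcongr
        have hc : S.card = (2 * (m * R) + 1) ^ n * (m ^ 2 * R + 1) := by
          rw [hS, Finset.card_product, Fintype.card_piFinset]
          simp only [Int.card_Icc, Finset.prod_const, Finset.card_univ, Fintype.card_fin]
          congr 1
          · congr 1; omega
        rw [hc]
        have h1 : 1 ≤ m * R := Nat.mul_pos hm hR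
        have h2 : 1 ≤ m ^ 2 * R := Nat.mul_pos (by positivity) hR
        refine Nat.mul_le_mul (Nat.pow_le_pow_left (by nlinarith) _) (by nlinarith)

end cocmeas2
end

open MeasureTheory Set Filter Topology
open scoped ENNReal NNReal

noncomputable section

section coczero
variable {n : ℕ} {N : EuclideanSpace ℝ (Fin n) → ℝ → ℝ → ℝ≥0∞}

lemma hk_ratio {τ0 τ1 ε : ℝ} (h0 : 0 < τ0) (hε : 0 < ε) :
    ∃ R0 : ℝ, 0 < R0 ∧ ∀ τ, τ0 ≤ τ → τ ≤ τ1 → ∀ w : EuclideanSpace ℝ (Fin n), R0 ≤ ‖w‖ →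
      hk τ w ≤ ε * hk (τ + 1) w := by
  by_cases h01 : τ0 ≤ τ1
  swap
  · exact ⟨1, one_pos, fun τ h1 h2 => absurd (h1.trans h2) h01⟩
  have hτ1 : 0 < τ1 := by linarith
  have hτ11 : 0 < τ1 + 1 := by linarith
  set C := (4 * Real.pi * τ0) ^ (-(n : ℝ) / 2)
  set c := (4 * Real.pi * (τ1 + 1)) ^ (-(n : ℝ) / 2)
  have hC : 0 < C := by positivity
  have hc : 0 < c := by positivity
  have hlim : Tendsto (fun R : ℝ => C * Real.exp (-(R ^ 2 * (1 / (4 * τ1 * (τ1 + 1)))))) atTop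
      (𝓝 (C * 0)) := by
    refine Tendsto.const_mul _ (Real.tendsto_exp_neg_atTop_nhds_zero.comp ?_)
    exact (tendsto_pow_atTop (by norm_num)).atTop_mul_const (by positivity)
  rw [mul_zero] at hlim
  obtain ⟨R0, hR, hR0⟩ := ((hlim.eventually (Iio_mem_nhds (show 0 < ε * c by positivity))).and
    (eventually_gt_atTop 0)).exists
  have hR : C * Real.exp (-(R0 ^ 2 * (1 / (4 * τ1 * (τ1 + 1))))) < ε * c := hR
  refine ⟨R0, hR0, fun τ h1 h2 w hw => ?_⟩
  have hτ : 0 < τ := by linarith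
  have hτ' : 0 < τ + 1 := by linarith
  have hn0 : -(n : ℝ) / 2 ≤ 0 := by
    have : (0:ℝ) ≤ n := by positivity
    linarith
  unfold hk
  have hC1 : (4 * Real.pi * τ) ^ (-(n : ℝ) / 2) ≤ C :=
    Real.rpow_le_rpow_of_nonpos (by positivity) (by gcongr) hn0
  have hc1 : c ≤ (4 * Real.pi * (τ + 1)) ^ (-(n : ℝ) / 2) :=
    Real.rpow_le_rpow_of_nonpos (by positivity) (by gcongr) hn0
  have hexp : Real.exp (-‖w‖ ^ 2 / (4 * τ)) ≤
      Real.exp (-(R0 ^ 2 * (1 / (4 * τ1 * (τ1 + 1))))) * Real.exp (-‖w‖ ^ 2 / (4 * (τ + 1))) := by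
    rw [← Real.exp_add]
    apply Real.exp_le_exp.2
    have e : -‖w‖ ^ 2 / (4 * τ) = -(‖w‖ ^ 2 * (1 / (4 * τ * (τ + 1)))) + -‖w‖ ^ 2 / (4 * (τ + 1)) := by
      field_simp; ring
    rw [e]
    have : R0 ^ 2 * (1 / (4 * τ1 * (τ1 + 1))) ≤ ‖w‖ ^ 2 * (1 / (4 * τ * (τ + 1))) := by gcongr
    linarith
  calc _ ≤ C * (Real.exp (-(R0 ^ 2 * (1 / (4 * τ1 * (τ1 + 1))))) *
        Real.exp (-‖w‖ ^ 2 / (4 * (τ + 1)))) := by gcongr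
    _ = C * Real.exp (-(R0 ^ 2 * (1 / (4 * τ1 * (τ1 + 1))))) *
        Real.exp (-‖w‖ ^ 2 / (4 * (τ + 1))) := by ring
    _ ≤ ε * c * Real.exp (-‖w‖ ^ 2 / (4 * (τ + 1))) := by gcongr
    _ ≤ ε * (4 * Real.pi * (τ + 1)) ^ (-(n : ℝ) / 2) * Real.exp (-‖w‖ ^ 2 / (4 * (τ + 1))) := by
        gcongr
    _ = _ := by ring

lemma Coc.mu_zero (hN : Coc N)
    (small : ∀ x t, 0 < t → ∀ ε, 0 < ε → ∀ᶠ h in 𝓝[>] (0:ℝ), N x t h ≤ ENNReal.ofReal (ε * h))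
    (back : ∀ x t h, 0 < t → 0 < h → ∀ c, N x t h < c →
      ∀ᶠ δ in 𝓝[>] (0:ℝ), N x (t - δ) (h + δ) < c) {t1 : ℝ} (h1 : 0 < t1)
    {U : Ultrafilter ℝ} (hU : (U : Filter ℝ) ≤ 𝓝[>] 0)
    {μ : Measure (EuclideanSpace ℝ (Fin n) × ℝ)}
    (hμ : ∀ (O K : Set (EuclideanSpace ℝ (Fin n) × ℝ)) (c : ℝ≥0∞), IsOpen O → IsCompact K →
      O ⊆ K → (∀ᶠ h in (U : Filter ℝ), nu N t1 h K ≤ c) → μ O ≤ c)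
    {R : ℕ} (hR : 0 < R) {t1' : ℝ} (h1' : t1 < t1') :
    μ (Metric.closedBall 0 R ×ˢ Icc t1' R) = 0 := by
  -- the covering constant
  set D : ℝ := (4 * Real.pi * 4) ^ (-(n : ℝ) / 2) * Real.exp (-1 / 4) with hD
  have hD0 : 0 < D := by positivity
  set C : ℝ := 4 * (3 * R) ^ n * (2 * R) * (n + 1) ^ (n + 2) / D with hC
  have hC0 : 0 ≤ C := by positivity
  set K : Set (EuclideanSpace ℝ (Fin n) × ℝ) := Metric.closedBall 0 R ×ˢ Icc t1' R with hK
  suffices h : ∀ ε : ℝ, 0 < ε → μ K ≤ ENNReal.ofReal (C * ε) by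
    have hl : Tendsto (fun ε : ℝ => ENNReal.ofReal (C * ε)) (𝓝[>] 0) (𝓝 (ENNReal.ofReal (C * 0))) := by
      refine (ENNReal.continuous_ofReal.tendsto _).comp ?_
      exact (Continuous.tendsto (by fun_prop) 0).mono_left nhdsWithin_le_nhds
    rw [mul_zero, ENNReal.ofReal_zero] at hl
    exact le_antisymm (ge_of_tendsto hl (eventually_mem_nhdsWithin.mono fun ε hε => h ε hε)) bot_le
  intro ε hε
  set G : ℕ → Set (EuclideanSpace ℝ (Fin n) × ℝ) := fun k =>
    {p | p ∈ K ∧ ∀ ρ : ℝ, 0 < ρ → ρ * (k + 1) < 1 →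
      N p.1 p.2 (3 * ρ ^ 2) < ENNReal.ofReal (4 * ε * ρ ^ 2)} with hG
  have hGK : K ⊆ ⋃ k, G k := by
    intro p hp
    have hp2 : 0 < p.2 := by have := hp.2.1; linarith
    have := small p.1 p.2 hp2 ε hε
    obtain ⟨r, hr, hr'⟩ := (mem_nhdsGT_iff_exists_Ioo_subset).1 this
    have hr : 0 < r := hr
    obtain ⟨k, hkk⟩ := exists_nat_gt (max 1 (3 / r))
    have hk1 : 1 < (k:ℝ) := (le_max_left _ _).trans_lt hkk
    have hk2 : 3 / r < k := (le_max_right _ _).trans_lt hkk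
    refine mem_iUnion.2 ⟨k, hp, fun ρ hρ hρk => ?_⟩
    have hρ1 : ρ < 1 := by nlinarith
    have hmem : 3 * ρ ^ 2 ∈ Ioo 0 r := by
      refine ⟨by positivity, ?_⟩
      rw [div_lt_iff₀ hr] at hk2
      have h3 : 3 * ρ * (k+1) < k * r := by nlinarith
      have h4 : 3 * ρ < r := by
        by_contra hcon
        push Not at hcon
        nlinarith
      nlinarith
    refine lt_of_le_of_lt (hr' hmem) ?_
    rw [ENNReal.ofReal_lt_ofReal_iff (by positivity)]
    nlinarith [show 0 < ε * ρ ^ 2 by positivity]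
  refine (measure_mono hGK).trans ?_
  have hmono : Monotone G := by
    intro i j hij p hp
    refine ⟨hp.1, fun ρ hρ h => hp.2 ρ hρ (lt_of_le_of_lt ?_ h)⟩
    gcongr
  rw [hmono.measure_iUnion]
  refine iSup_le fun k => ?_
  obtain ⟨m, hm⟩ := exists_nat_gt (((n:ℝ) + 1) * (k + 1))
  have hm0 : (0:ℝ) < m := lt_trans (by positivity) hm
  have hm0' : 0 < m := by exact_mod_cast hm0
  set ρ : ℝ := (n + 1) / m with hρ
  have hρ0 : 0 < ρ := by positivity
  have hρk : ρ * (k + 1) < 1 := by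
    rw [hρ, div_mul_eq_mul_div, div_lt_one hm0]; exact hm
  refine (measure_cells hm0' hR (B := ENNReal.ofReal (4 * ε * ρ ^ 2) / ENNReal.ofReal
    ((4 * Real.pi * (4 * ρ ^ 2)) ^ (-(n : ℝ) / 2) * Real.exp (-1 / 4))) (G k) ?_ ?_).trans ?_
  · intro p hp
    exact hN.cyl back h1 hU hμ (lt_of_lt_of_le h1' hp.1.2.1) hρ0 (hp.2 ρ hρ0 hρk)
  · intro p hp
    obtain ⟨⟨ha, hb⟩, -⟩ := hp
    exact ⟨by simpa using ha, by linarith [hb.1], hb.2⟩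
  · have e1 : (4 * Real.pi * (4 * ρ ^ 2)) ^ (-(n : ℝ) / 2) * Real.exp (-1 / 4) = D / ρ ^ n := by
      rw [hD, show 4 * Real.pi * (4 * ρ ^ 2) = 4 * Real.pi * 4 * ρ ^ 2 by ring,
        Real.mul_rpow (by positivity) (by positivity), ← Real.rpow_natCast ρ 2, ← Real.rpow_mul hρ0.le,
        show ((2:ℕ):ℝ) * (-(n:ℝ) / 2) = -n by push_cast; ring, Real.rpow_neg hρ0.le,
        Real.rpow_natCast]
      field_simp
    rw [e1, ← ENNReal.ofReal_div_of_pos (by positivity), ← ENNReal.ofReal_natCast,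
      ← ENNReal.ofReal_mul (by positivity)]
    refine ENNReal.ofReal_le_ofReal (le_of_eq ?_)
    rw [hC, hρ]
    push_cast
    rw [show (3:ℝ) * m * R = 3 * R * m by ring, mul_pow (3 * (R:ℝ)) (m:ℝ), div_pow ((n:ℝ) + 1) _ n, pow_add]
    field_simp

theorem Coc.zero (hN : Coc N)
    (small : ∀ x t, 0 < t → ∀ ε, 0 < ε → ∀ᶠ h in 𝓝[>] (0:ℝ), N x t h ≤ ENNReal.ofReal (ε * h))
    (back : ∀ x t h, 0 < t → 0 < h → ∀ c, N x t h < c →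
      ∀ᶠ δ in 𝓝[>] (0:ℝ), N x (t - δ) (h + δ) < c)
    {t h τ : ℝ} (ht : 0 < t) (hh : 0 < h) (hτ : 0 < τ) (X : EuclideanSpace ℝ (Fin n)) :
    hS τ (fun z => N z t h) X = 0 := by
  set t1 := t / 3 with ht1
  set s1 := 2 * t / 3 with hs1
  have h1 : 0 < t1 := by rw [ht1]; positivity
  have h1s : t1 < s1 := by rw [ht1, hs1]; linarith
  have hst : s1 < t := by rw [hs1]; linarith
  set t2 := t + h with ht2
  set T := t2 + τ with hT
  obtain ⟨U, μ, hU, hμ, hK⟩ := exists_weak_limit (𝓝[>] (0:ℝ)) (nu N t1) (hN.nu_bdd h1)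
  set Q := hS τ (fun z => N z t h) X with hQ
  suffices hε : ∀ ε : ℝ, 0 < ε → Q ≤ ENNReal.ofReal ε * N X s1 (T + 1 - s1) by
    have hfin := hN.fin X s1 (T + 1 - s1) (by linarith) (by linarith)
    have hl : Tendsto (fun ε : ℝ => ENNReal.ofReal ε * N X s1 (T + 1 - s1)) (𝓝[>] 0)
        (𝓝 (ENNReal.ofReal 0 * N X s1 (T + 1 - s1))) := by
      refine ENNReal.Tendsto.mul_const ?_ (Or.inr hfin)
      exact (ENNReal.continuous_ofReal.tendsto 0).mono_left nhdsWithin_le_nhds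
    rw [ENNReal.ofReal_zero, zero_mul] at hl
    exact le_antisymm (ge_of_tendsto hl (eventually_mem_nhdsWithin.mono fun ε h => hε ε h)) bot_le
  intro ε hε
  obtain ⟨R0, hR0, hratio⟩ := hk_ratio (n := n) (τ0 := τ / 2) (τ1 := T) (ε := ε) (by positivity) hε
  obtain ⟨R, hR⟩ := exists_nat_gt (max (R0 + ‖X‖) t2)
  have hRa : R0 + ‖X‖ < R := (le_max_left _ _).trans_lt hR
  have hRb : t2 < R := (le_max_right _ _).trans_lt hR
  have hRpos : 0 < R := by
    have : (0:ℝ) < R := by linarith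
    exact_mod_cast this
  set Kc : Set (EuclideanSpace ℝ (Fin n) × ℝ) := Metric.closedBall 0 R ×ˢ Icc s1 R with hKc
  have hKcc : IsCompact Kc := (isCompact_closedBall _ _).prod isCompact_Icc
  have hlim := hK Kc hKcc (hN.mu_zero small back h1 hU hμ hRpos h1s)
  set c0 := (4 * Real.pi * (τ / 2)) ^ (-(n : ℝ) / 2) with hc0
  have hlim2 : Tendsto (fun h' => ENNReal.ofReal c0 * nu N t1 h' Kc +
      ENNReal.ofReal ε * N X s1 (T + 1 - s1)) U
      (𝓝 (ENNReal.ofReal c0 * 0 + ENNReal.ofReal ε * N X s1 (T + 1 - s1))) :=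
    (ENNReal.Tendsto.const_mul hlim (Or.inr ENNReal.ofReal_ne_top)).add tendsto_const_nhds
  rw [mul_zero, zero_add] at hlim2
  refine ge_of_tendsto hlim2 ?_
  filter_upwards [hU self_mem_nhdsWithin,
    hU (mem_nhdsWithin_of_mem_nhds (Iio_mem_nhds (show 0 < τ / 2 by positivity))),
    hU (mem_nhdsWithin_of_mem_nhds (Iio_mem_nhds (show 0 < t - s1 by linarith)))] with k k0 k1 k2
  have k0 : 0 < k := k0
  have k1 : k < τ / 2 := k1
  have k2 : k < t - s1 := k2
  have hk0 : ENNReal.ofReal k ≠ 0 := by simpa using k0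
  have hF2 := hN.F2 (t1 := s1) (t1' := t) (t2 := t2) (h := k) (T := T) (by linarith) k0
    (by linarith) (by linarith) (by linarith) X
  rw [show T - t2 = τ by rw [hT]; ring, show t2 - t = h by rw [ht2]; ring] at hF2
  have hF1 := hN.F1 (t1 := s1) (t2 := t2) (h := k) (T := T + 1) (by linarith) (by linarith) k0
    (by linarith) X
  have hpt : ∀ s ∈ Ioc s1 t2, hS (T - s - k) (fun z => N z s k) X ≤
      ENNReal.ofReal c0 * (∫⁻ z in Metric.closedBall 0 R, N z s k) +
        ENNReal.ofReal ε * hS (T + 1 - s - k) (fun z => N z s k) X := by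
    intro s hs
    have hτs : τ / 2 ≤ T - s - k := by linarith [hs.2]
    have hτs' : T - s - k ≤ T := by linarith [hs.1]
    unfold hS
    rw [← lintegral_const_mul' _ _ ENNReal.ofReal_ne_top,
      ← lintegral_const_mul' _ _ ENNReal.ofReal_ne_top, ← lintegral_indicator measurableSet_closedBall,
      ← lintegral_add_left]
    swap
    · exact ((hN.meas_x s k0).const_mul _).indicator measurableSet_closedBall
    refine lintegral_mono fun z => ?_
    by_cases hz : z ∈ Metric.closedBall (0 : EuclideanSpace ℝ (Fin n)) R
    · simp only [indicator_of_mem hz]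
      refine le_trans ?_ le_self_add
      refine mul_le_mul_left (ENNReal.ofReal_le_ofReal ?_) _
      exact hk_le (by positivity) hτs _
    · refine le_trans ?_ le_add_self
      rw [← mul_assoc]
      refine mul_le_mul_left ?_ _
      unfold hke
      rw [← ENNReal.ofReal_mul hε.le]
      refine ENNReal.ofReal_le_ofReal ?_
      rw [show T + 1 - s - k = T - s - k + 1 by ring]
      refine hratio _ hτs hτs' _ ?_
      have hz' : (R:ℝ) < ‖z‖ := by simpa using hz
      have := norm_sub_norm_le z X
      rw [norm_sub_rev] at this
      linarith
  have hI : ∫⁻ s in Ioc s1 t2, hS (T - s - k) (fun z => N z s k) X ≤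
      ENNReal.ofReal c0 * (ENNReal.ofReal k * nu N t1 k Kc) +
        ENNReal.ofReal ε * (ENNReal.ofReal k * N X s1 (T + 1 - s1)) := by
    refine (setLIntegral_mono' measurableSet_Ioc hpt).trans ?_
    rw [lintegral_add_left, lintegral_const_mul' _ _ ENNReal.ofReal_ne_top,
      lintegral_const_mul' _ _ ENNReal.ofReal_ne_top,
      ← nu_prod hN k0 measurableSet_closedBall measurableSet_Ioc (fun s hs => h1s.trans hs.1)]
    · gcongr
      exact prod_mono le_rfl fun s hs => ⟨hs.1.le, hs.2.trans hRb.le⟩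
    · refine Measurable.const_mul ?_ _
      exact Measurable.lintegral_prod_left' (hN.meas k k0)
  have := hF2.trans hI
  rw [mul_left_comm, mul_left_comm (ENNReal.ofReal ε), ← mul_add] at this
  exact (ENNReal.mul_le_mul_iff_right hk0 ENNReal.ofReal_ne_top).1 this

end coczero
end

open MeasureTheory Set Filter Topology
open scoped ENNReal NNReal

noncomputable section

/-- Duhamel term -/
def Dh {n : ℕ} (H : ℝ → EuclideanSpace ℝ (Fin n) → ℝ≥0∞) (x : EuclideanSpace ℝ (Fin n)) (t h : ℝ) :
    ℝ≥0∞ := ∫⁻ r in Ioc t (t + h), hS (t + h - r) (H r) x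

section duh
variable {n : ℕ} {v : EuclideanSpace ℝ (Fin n) → ℝ → ℝ} {H : ℝ → EuclideanSpace ℝ (Fin n) → ℝ≥0∞}

lemma meas_slice (hH : Measurable (fun q : EuclideanSpace ℝ (Fin n) × ℝ => H q.2 q.1)) (t : ℝ) :
    Measurable (H t) := hH.comp (measurable_id.prodMk measurable_const)

@[fun_prop]
lemma hS_meas {α : Type*} [MeasurableSpace α] {f : α → ℝ} {g : α → EuclideanSpace ℝ (Fin n)}
    {k : α → EuclideanSpace ℝ (Fin n) → ℝ≥0∞} (hf : Measurable f) (hg : Measurable g)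
    (hk' : Measurable (Function.uncurry k)) : Measurable (fun a => hS (f a) (k a) (g a)) := by
  unfold hS
  refine Measurable.lintegral_prod_right' (f := fun p : α × EuclideanSpace ℝ (Fin n) =>
    hke (f p.1) (g p.1 - p.2) * k p.1 p.2) ?_
  exact (hke_measurable_comp (by fun_prop) (by fun_prop)).mul hk'

lemma Dh_eq (x : EuclideanSpace ℝ (Fin n)) (t h : ℝ) :
    Dh H x t h = ∫⁻ ρ in Ioc 0 h, hS (h - ρ) (H (ρ + t)) x := by
  have := shift_lintegral (fun r => hS (t + h - r) (H r) x) 0 h t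
  rw [zero_add, add_comm h t] at this
  unfold Dh
  rw [← this]
  refine lintegral_congr fun ρ => ?_
  rw [show t + h - (ρ + t) = h - ρ by ring]

lemma Dh_meas (hH : Measurable (fun q : EuclideanSpace ℝ (Fin n) × ℝ => H q.2 q.1)) (h : ℝ) :
    Measurable (fun q : EuclideanSpace ℝ (Fin n) × ℝ => Dh H q.1 q.2 h) := by
  simp_rw [Dh_eq]
  refine Measurable.lintegral_prod_right' (f := fun p : (EuclideanSpace ℝ (Fin n) × ℝ) × ℝ =>
    hS (h - p.2) (H (p.2 + p.1.2)) p.1.1) ?_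
  refine hS_meas (by fun_prop) (by fun_prop) ?_
  exact hH.comp (f := fun w : ((EuclideanSpace ℝ (Fin n) × ℝ) × ℝ) × EuclideanSpace ℝ (Fin n) =>
    (w.2, w.1.2 + w.1.1.2)) (by fun_prop)

lemma hS_lint {α : Type*} [MeasurableSpace α] {ν : Measure α} [SFinite ν]
    {f : α → EuclideanSpace ℝ (Fin n) → ℝ≥0∞} (hf : Measurable (Function.uncurry f)) (τ : ℝ)
    (x : EuclideanSpace ℝ (Fin n)) :
    hS τ (fun z => ∫⁻ r, f r z ∂ν) x = ∫⁻ r, hS τ (f r) x ∂ν := by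
  unfold hS
  rw [lintegral_lintegral_swap]
  · refine lintegral_congr fun z => ?_
    rw [lintegral_const_mul']
    exact ENNReal.ofReal_ne_top
  · exact ((hke_measurable_comp (by fun_prop) (by fun_prop)).mul hf).aemeasurable

lemma Dh_coc (hH : Measurable (fun q : EuclideanSpace ℝ (Fin n) × ℝ => H q.2 q.1))
    (x : EuclideanSpace ℝ (Fin n)) (t : ℝ) {h₁ h₂ : ℝ} (h1 : 0 < h₁) (h2 : 0 < h₂) :
    Dh H x t (h₁ + h₂) = Dh H x (t + h₁) h₂ + hS h₂ (fun z => Dh H z t h₁) x := by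
  unfold Dh
  rw [hS_lint]
  swap
  · refine hS_meas (by fun_prop) (by fun_prop) ?_
    exact hH.comp (f := fun w : (ℝ × EuclideanSpace ℝ (Fin n)) × EuclideanSpace ℝ (Fin n) =>
      (w.2, w.1.1)) (by fun_prop)
  rw [add_comm (lintegral _ _), ← add_assoc t, ← Ioc_union_Ioc_eq_Ioc (show t ≤ t + h₁ by linarith)
    (show t + h₁ ≤ t + h₁ + h₂ by linarith),
    lintegral_union measurableSet_Ioc (Ioc_disjoint_Ioc_of_le le_rfl)]
  congr 1
  rw [setLIntegral_congr Ioo_ae_eq_Ioc.symm, setLIntegral_congr Ioo_ae_eq_Ioc.symm]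
  refine setLIntegral_congr_fun measurableSet_Ioo fun r hr => ?_
  rw [hS_hS h2 (by linarith [hr.2]) (meas_slice hH r), show h₂ + (t + h₁ - r) = t + h₁ + h₂ - r by ring]

/-- the defect of the Duhamel inequality is a cocycle -/
lemma coc_defect (hv : Supers v) {D : EuclideanSpace ℝ (Fin n) → ℝ → ℝ → ℝ≥0∞}
    (hDm : ∀ h, 0 < h → Measurable (fun q : EuclideanSpace ℝ (Fin n) × ℝ => D q.1 q.2 h))
    (hDc : ∀ x t h₁ h₂, 0 < t → 0 < h₁ → 0 < h₂ →
      D x t (h₁ + h₂) = D x (t + h₁) h₂ + hS h₂ (fun z => D z t h₁) x)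
    (hle : ∀ x t h, 0 < t → 0 < h → hS h (Ve v t) x + D x t h ≤ Ve v (t + h) x) :
    Coc (fun x t h => Ve v (t + h) x - (hS h (Ve v t) x + D x t h)) where
  meas := by
    intro h hh
    have h1 : Measurable (fun q : EuclideanSpace ℝ (Fin n) × ℝ => Ve v (q.2 + h) q.1) :=
      hv.meas.comp (f := fun q : EuclideanSpace ℝ (Fin n) × ℝ => (q.1, q.2 + h)) (by fun_prop)
    have h2 : Measurable (fun q : EuclideanSpace ℝ (Fin n) × ℝ => hS h (Ve v q.2) q.1) := by
      refine hS_meas (by fun_prop) (by fun_prop) ?_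
      exact hv.meas.comp (f := fun w : (EuclideanSpace ℝ (Fin n) × ℝ) × EuclideanSpace ℝ (Fin n) =>
        (w.2, w.1.2)) (by fun_prop)
    exact h1.sub (h2.add (hDm h hh))
  fin := fun x t h ht hh => (tsub_le_self.trans_lt (Ve_ne_top _ _).lt_top).ne
  coc := by
    intro x t h₁ h₂ ht h1 h2
    have hmx : ∀ t h, 0 < h → Measurable (fun z => D z t h) := fun t h hh =>
      (hDm h hh).comp (measurable_id.prodMk measurable_const)
    have key : ∀ x t h, 0 < t → 0 < h → (Ve v (t + h) x - (hS h (Ve v t) x + D x t h)) +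
        (hS h (Ve v t) x + D x t h) = Ve v (t + h) x := fun x t h ht hh =>
      tsub_add_cancel_of_le (hle x t h ht hh)
    have e1 := key x t (h₁ + h₂) ht (by positivity)
    have e2 := key x (t + h₁) h₂ (by positivity) h2
    have hm1 : Measurable (fun z => hS h₁ (Ve v t) z) :=
      hS_meas (by fun_prop) (by fun_prop) ((hv.meas_x t).comp measurable_snd)
    have hm2 : Measurable (fun z => hS h₁ (Ve v t) z + D z t h₁) := hm1.add (hmx t h₁ h1)
    have e3 : hS h₂ (Ve v (t + h₁)) x =
        hS h₂ (fun z => Ve v (t + h₁) z - (hS h₁ (Ve v t) z + D z t h₁)) x +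
        (hS (h₁ + h₂) (Ve v t) x + hS h₂ (fun z => D z t h₁) x) := by
      have : Ve v (t + h₁) = fun z => (hS h₁ (Ve v t) z + D z t h₁) +
          (Ve v (t + h₁) z - (hS h₁ (Ve v t) z + D z t h₁)) := by
        funext z; exact (add_tsub_cancel_of_le (hle z t h₁ ht h1)).symm
      conv_lhs => rw [this]
      rw [hS_add hm2, hS_add hm1, hS_hS h2 h1 (hv.meas_x t), add_comm h₂ h₁, add_comm]
    have hfin : hS (h₁ + h₂) (Ve v t) x + D x t (h₁ + h₂) ≠ ⊤ :=
      ((hle x t (h₁ + h₂) ht (by positivity)).trans_lt (Ve_ne_top _ _).lt_top).ne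
    refine (ENNReal.add_left_inj hfin).1 ?_
    generalize Ve v (t + h₁ + h₂) x - (hS h₂ (Ve v (t + h₁)) x + D x (t + h₁) h₂) = A at e2 ⊢
    rw [e1, ← add_assoc t, ← e2, e3, hDc x t h₁ h₂ ht h1 h2]
    ring

lemma coc_M (hv : Supers v) : Coc (fun x t h => Ve v (t + h) x - hS h (Ve v t) x) := by
  have := coc_defect hv (D := fun _ _ _ => 0) (fun _ _ => measurable_const)
    (fun x t h₁ h₂ ht h1 h2 => by simp [hS]) (fun x t h ht hh => by simpa using LC hv ht hh x)
  simpa using this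

lemma hS_Ve {t : ℝ} (ht : 0 < t) (h : ℝ) (x : EuclideanSpace ℝ (Fin n)) :
    hS h (Ve v t) x = hS h (fun z => ENNReal.ofReal (v z t)) x := by
  congr 1; funext z; exact Ve_eq ht z

lemma M_lower (hv : Supers v) {t : ℝ} (ht : 0 < t) (x : EuclideanSpace ℝ (Fin n)) {ε : ℝ} (hε : 0 < ε) :
    ∀ᶠ h in 𝓝[>] (0 : ℝ), ENNReal.ofReal
      (deriv (v x) t - laplacian (fun y => v y t) x - ε) ≤
        (Ve v (t + h) x - hS h (Ve v t) x) / ENNReal.ofReal h := by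
  set d := deriv (v x) t
  set L := laplacian (fun y => v y t) x
  have hfin : hS 1 (fun z => ENNReal.ofReal (v z t)) x ≠ ⊤ := by
    rw [← hS_Ve ht]
    exact ((LC hv ht one_pos x).trans_lt (Ve_ne_top _ _).lt_top).ne
  have g := gen_upper (hv.space t ht) (fun z => hv.pos z t ht) x one_pos hfin (half_pos hε)
  have hd : HasDerivAt (v x) d t := (hv.time x t ht).hasDerivAt
  have hd' : ∀ᶠ h in 𝓝[>] (0 : ℝ), v x t + h * (d - ε / 2) ≤ v x (t + h) := by
    rw [hasDerivAt_iff_isLittleO_nhds_zero] at hd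
    have := (hd.def (half_pos hε)).filter_mono (nhdsWithin_le_nhds (s := Ioi 0))
    filter_upwards [this, self_mem_nhdsWithin] with h h1 h2
    have h2 : 0 < h := h2
    rw [Real.norm_eq_abs, Real.norm_eq_abs, abs_of_pos h2, smul_eq_mul] at h1
    have := (abs_le.1 h1).1
    nlinarith
  have hp : ∀ᶠ h in 𝓝[>] (0 : ℝ), 0 < v x t + h * (L + ε / 2) := by
    have : Tendsto (fun h : ℝ => v x t + h * (L + ε / 2)) (𝓝[>] 0)
        (𝓝 (v x t + 0 * (L + ε / 2))) :=
      (Continuous.tendsto (by fun_prop) 0).mono_left nhdsWithin_le_nhds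
    refine this.eventually (Ioi_mem_nhds ?_)
    rw [zero_mul, add_zero]; exact hv.pos x t ht
  filter_upwards [g, hd', hp, self_mem_nhdsWithin] with h h1 h2 h3 h4
  have h4 : 0 < h := h4
  rw [ENNReal.le_div_iff_mul_le (Or.inl (by simpa using h4)) (Or.inl ENNReal.ofReal_ne_top),
    ← ENNReal.ofReal_mul' h4.le, Ve_eq (by positivity), hS_Ve ht]
  calc ENNReal.ofReal ((d - L - ε) * h) =
        ENNReal.ofReal ((v x t + h * (d - ε / 2)) - (v x t + h * (L + ε / 2))) := by ring_nf
    _ = ENNReal.ofReal (v x t + h * (d - ε / 2)) - ENNReal.ofReal (v x t + h * (L + ε / 2)) :=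
        ENNReal.ofReal_sub _ h3.le
    _ ≤ _ := tsub_le_tsub (ENNReal.ofReal_le_ofReal h2) h1

/-- Duhamel inequality -/
theorem LCS (hv : Supers v) (hH : Measurable (fun q : EuclideanSpace ℝ (Fin n) × ℝ => H q.2 q.1))
    (hHv : ∀ x t, 0 < t → H t x ≤ ENNReal.ofReal (deriv (v x) t - laplacian (fun y => v y t) x))
    (X : EuclideanSpace ℝ (Fin n)) {t h : ℝ} (ht : 0 < t) (hh : 0 < h) :
    hS h (Ve v t) X + Dh H X t h ≤ Ve v (t + h) X := by
  set M := fun (x : EuclideanSpace ℝ (Fin n)) (t h : ℝ) => Ve v (t + h) x - hS h (Ve v t) x with hM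
  have hMc : Coc M := coc_M hv
  suffices hs : Dh H X t h ≤ M X t h by
    calc _ ≤ hS h (Ve v t) X + M X t h := by gcongr
      _ = _ := add_tsub_cancel_of_le (LC hv ht hh X)
  set T := t + h with hT
  set k : ℕ → ℝ := fun j => 1 / ((j:ℝ) + 1) with hkk
  have k0 : ∀ j, 0 < k j := fun j => by simp only [hkk]; positivity
  have klim : Tendsto k atTop (𝓝 0) := tendsto_one_div_add_atTop_nhds_zero_nat
  have klim' : Tendsto k atTop (𝓝[>] 0) :=
    tendsto_nhdsWithin_iff.2 ⟨klim, Eventually.of_forall k0⟩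
  set f : ℕ → ℝ → EuclideanSpace ℝ (Fin n) → ℝ≥0∞ := fun j r z =>
    (Ioc t (T - 2 * k j)).indicator (fun _ => hke (T - r - k j) (X - z) *
      (M z r (k j) / ENNReal.ofReal (k j))) r with hf
  have hfm : ∀ j, Measurable (Function.uncurry (f j)) := by
    intro j
    have : Function.uncurry (f j) = indicator (Ioc t (T - 2 * k j) ×ˢ univ)
      (fun p : ℝ × EuclideanSpace ℝ (Fin n) => hke (T - p.1 - k j) (X - p.2) *
        (M p.2 p.1 (k j) / ENNReal.ofReal (k j))) := by
      funext p
      simp only [Function.uncurry, hf, indicator, mem_prod, mem_univ, and_true]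
    rw [this]
    refine Measurable.indicator ?_ (measurableSet_Ioc.prod MeasurableSet.univ)
    refine (hke_measurable_comp (by fun_prop) (by fun_prop)).mul (Measurable.div_const ?_ _)
    exact (hMc.meas (k j) (k0 j)).comp measurable_swap
  have hpt : ∀ r ∈ Ioo t T, ∀ z, hke (T - r) (X - z) * H r z ≤ liminf (fun j => f j r z) atTop := by
    intro r hr z
    have hr0 : 0 < r := ht.trans hr.1
    set d := deriv (v z) r - laplacian (fun y => v y r) z with hd
    refine (mul_le_mul_right (hHv z r hr0) _).trans ?_
    have hke1 : Tendsto (fun j => hke (T - r - k j) (X - z)) atTop (𝓝 (hke (T - r) (X - z))) := by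
      refine (ENNReal.continuous_ofReal.tendsto _).comp ?_
      have := (hk_tendsto_time (r0 := r) (s := T) hr.2 (X - z))
      have h2 : Tendsto (fun j => r + k j) atTop (𝓝 r) := by
        simpa using (tendsto_const_nhds (x := r)).add klim
      refine (this.comp h2).congr fun j => ?_
      simp only [Function.comp, sub_add_eq_sub_sub]
    have hε : ∀ ε : ℝ, 0 < ε → hke (T - r) (X - z) * ENNReal.ofReal (d - ε) ≤
        liminf (fun j => f j r z) atTop := by
      intro ε hε
      have h1 : Tendsto (fun j => hke (T - r - k j) (X - z) * ENNReal.ofReal (d - ε)) atTop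
          (𝓝 (hke (T - r) (X - z) * ENNReal.ofReal (d - ε))) :=
        ENNReal.Tendsto.mul_const hke1 (Or.inr ENNReal.ofReal_ne_top)
      rw [← h1.liminf_eq]
      refine liminf_le_liminf ?_
      have hsm : ∀ᶠ j in atTop, 2 * k j < T - r := by
        have : Tendsto (fun j => 2 * k j) atTop (𝓝 (2 * 0)) := klim.const_mul 2
        rw [mul_zero] at this
        exact this.eventually (Iio_mem_nhds (by linarith [hr.2]))
      filter_upwards [klim'.eventually (M_lower hv hr0 z hε), hsm] with j hj1 hj2
      simp only [hf]
      rw [indicator_of_mem (show r ∈ Ioc t (T - 2 * k j) from ⟨hr.1, by linarith⟩)]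
      exact mul_le_mul_right hj1 _
    have hl : Tendsto (fun ε : ℝ => hke (T - r) (X - z) * ENNReal.ofReal (d - ε)) (𝓝[>] 0)
        (𝓝 (hke (T - r) (X - z) * ENNReal.ofReal (d - 0))) := by
      refine ENNReal.Tendsto.const_mul ?_ (Or.inr ENNReal.ofReal_ne_top)
      refine (ENNReal.continuous_ofReal.tendsto _).comp ?_
      exact (Continuous.tendsto (by fun_prop) 0).mono_left nhdsWithin_le_nhds
    rw [sub_zero] at hl
    exact le_of_tendsto hl (eventually_mem_nhdsWithin.mono fun ε h => hε ε h)
  have hbd : ∀ j, ∫⁻ r in Ioc t T, ∫⁻ z, f j r z ≤ M X t h := by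
    intro j
    rcases lt_or_ge (T - 2 * k j) t with hlt | hge
    · have : ∀ r z, f j r z = 0 := fun r z => by
        simp only [hf]; rw [Ioc_eq_empty (by linarith)]; simp
      simp [this]
    have e : ∀ r, ∫⁻ z, f j r z = (Ioc t (T - 2 * k j)).indicator
        (fun r => hS (T - r - k j) (fun z => M z r (k j)) X / ENNReal.ofReal (k j)) r := by
      intro r
      by_cases hr : r ∈ Ioc t (T - 2 * k j)
      · simp only [hf, indicator_of_mem hr, hS, div_eq_mul_inv, ← mul_assoc]
        rw [lintegral_mul_const']
        exact ENNReal.inv_ne_top.2 (by simpa using k0 j)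
      · simp only [hf, indicator_of_notMem hr, lintegral_zero]
    simp_rw [e]
    rw [lintegral_indicator measurableSet_Ioc, Measure.restrict_restrict measurableSet_Ioc,
      inter_eq_left.2 (Ioc_subset_Ioc_right (by linarith [k0 j]))]
    simp_rw [div_eq_mul_inv]
    rw [lintegral_mul_const' _ _ (ENNReal.inv_ne_top.2 (by simpa using k0 j)), ← div_eq_mul_inv]
    refine ENNReal.div_le_of_le_mul' ?_
    have := hMc.F1 (t1 := t) (t2 := T - 2 * k j) (h := k j) (T := T) ht hge (k0 j)
      (by linarith [k0 j]) X
    rwa [show T - t = h by rw [hT]; ring] at this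
  have hout : ∀ j, Measurable (fun r => ∫⁻ z, f j r z) := fun j =>
    Measurable.lintegral_prod_right' (hfm j)
  calc Dh H X t h = ∫⁻ r in Ioo t T, hS (T - r) (H r) X :=
        setLIntegral_congr Ioo_ae_eq_Ioc.symm
    _ ≤ ∫⁻ r in Ioo t T, liminf (fun j => ∫⁻ z, f j r z) atTop := by
        refine setLIntegral_mono' measurableSet_Ioo fun r hr => ?_
        refine (lintegral_mono (hpt r hr)).trans (lintegral_liminf_le fun j => ?_)
        exact (hfm j).of_uncurry_left
    _ = ∫⁻ r in Ioc t T, liminf (fun j => ∫⁻ z, f j r z) atTop := setLIntegral_congr Ioo_ae_eq_Ioc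
    _ ≤ liminf (fun j => ∫⁻ r in Ioc t T, ∫⁻ z, f j r z) atTop := lintegral_liminf_le hout
    _ ≤ liminf (fun _ : ℕ => M X t h) atTop := liminf_le_liminf (Eventually.of_forall hbd)
    _ = M X t h := liminf_const _

end duh
end

open MeasureTheory Set Filter Topology
open scoped ENNReal NNReal

noncomputable section

section duh2
variable {n : ℕ} {v : EuclideanSpace ℝ (Fin n) → ℝ → ℝ} {H : ℝ → EuclideanSpace ℝ (Fin n) → ℝ≥0∞}

lemma small_aux (hv : Supers v)
    (hHv : ∀ x t, 0 < t → H t x = ENNReal.ofReal (deriv (v x) t - laplacian (fun y => v y t) x))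
    (hr : ∀ x t, 0 < t → ∀ c : ℝ, 0 ≤ c → ENNReal.ofReal c < H t x → ∃ δ > 0, ∀ y r, dist y x < δ →
      t ≤ r → r < t + δ → ENNReal.ofReal c ≤ H r y)
    (x : EuclideanSpace ℝ (Fin n)) {t : ℝ} (ht : 0 < t) {ε : ℝ} (hε : 0 < ε) :
    ∀ᶠ h in 𝓝[>] (0:ℝ), Ve v (t + h) x - (hS h (Ve v t) x + Dh H x t h) ≤ ENNReal.ofReal (ε * h) := by
  set d := deriv (v x) t with hd0
  set L := laplacian (fun y => v y t) x with hL
  set g := d - L with hg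
  have hε3 : 0 < ε / 3 := by positivity
  have g1 := gen_lower (hv.space t ht) (fun z => (hv.pos z t ht).le) x hε3
  have hd : HasDerivAt (v x) d t := (hv.time x t ht).hasDerivAt
  have hd' : ∀ᶠ h in 𝓝[>] (0 : ℝ), v x (t + h) ≤ v x t + h * (d + ε / 3) := by
    rw [hasDerivAt_iff_isLittleO_nhds_zero] at hd
    have := (hd.def hε3).filter_mono (nhdsWithin_le_nhds (s := Ioi 0))
    filter_upwards [this, self_mem_nhdsWithin] with h h1 h2
    have h2 : 0 < h := h2
    rw [Real.norm_eq_abs, Real.norm_eq_abs, abs_of_pos h2, smul_eq_mul] at h1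
    have := (abs_le.1 h1).2
    nlinarith
  have hD : ∀ᶠ h in 𝓝[>] (0 : ℝ), ENNReal.ofReal (h * (g - ε / 3)) ≤ Dh H x t h := by
    rcases lt_or_ge (g - ε / 6) 0 with hneg | hpos
    · filter_upwards [self_mem_nhdsWithin] with h hh
      have hh : 0 < h := hh
      rw [ENNReal.ofReal_of_nonpos]
      · exact bot_le
      · nlinarith
    · set c := g - ε / 6 with hc
      have hgpos : 0 < g := by linarith
      have hcH : ENNReal.ofReal c < H t x := by
        rw [hHv x t ht]; exact (ENNReal.ofReal_lt_ofReal_iff hgpos).2 (by linarith)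
      obtain ⟨δ, hδ, hδH⟩ := hr x t ht c hpos hcH
      have hm2 := mtwo_nonneg (n := n)
      have hsm : ∀ᶠ h in 𝓝[>] (0 : ℝ), c * (mtwo n * h / δ ^ 2) < ε / 6 := by
        have : Tendsto (fun h : ℝ => c * (mtwo n * h / δ ^ 2)) (𝓝[>] 0)
            (𝓝 (c * (mtwo n * 0 / δ ^ 2))) :=
          (Continuous.tendsto (by fun_prop) 0).mono_left nhdsWithin_le_nhds
        refine this.eventually (Iio_mem_nhds ?_)
        rw [mul_zero, zero_div, mul_zero]; positivity
      filter_upwards [self_mem_nhdsWithin, hsm, mem_nhdsWithin_of_mem_nhds (Iio_mem_nhds hδ)]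
        with h h0 h1 h2
      have h0 : 0 < h := h0
      have h2 : h < δ := h2
      unfold Dh
      rw [setLIntegral_congr Ioo_ae_eq_Ioc.symm]
      calc ENNReal.ofReal (h * (g - ε / 3)) = ∫⁻ r in Ioo t (t + h), ENNReal.ofReal (g - ε / 3) := by
            rw [setLIntegral_const, Real.volume_Ioo, add_sub_cancel_left, ENNReal.ofReal_mul h0.le,
              mul_comm]
        _ ≤ _ := by
            refine setLIntegral_mono' measurableSet_Ioo fun r hr => ?_
            refine le_trans (ENNReal.ofReal_le_ofReal ?_) (hS_lower (c := c) (δ := δ) hpos hδ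
              (by linarith [hr.2]) fun z hz => hδH z r hz hr.1.le (by linarith [hr.2]))
            have : c * (mtwo n * (t + h - r) / δ ^ 2) ≤ c * (mtwo n * h / δ ^ 2) := by
              gcongr; linarith [hr.1]
            nlinarith
  filter_upwards [g1, hd', hD, self_mem_nhdsWithin] with h h1 h2 h3 h0
  have h0 : 0 < h := h0
  rw [tsub_le_iff_right, Ve_eq (by positivity), hS_Ve ht]
  calc ENNReal.ofReal (v x (t + h)) ≤ ENNReal.ofReal (v x t + h * (d + ε / 3)) :=
        ENNReal.ofReal_le_ofReal h2
    _ = ENNReal.ofReal (ε * h + ((v x t + h * (L - ε / 3)) + h * (g - ε / 3))) := by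
        rw [hg]; ring_nf
    _ ≤ ENNReal.ofReal (ε * h) + (ENNReal.ofReal (v x t + h * (L - ε / 3)) +
        ENNReal.ofReal (h * (g - ε / 3))) :=
        ENNReal.ofReal_add_le.trans (by gcongr; exact ENNReal.ofReal_add_le)
    _ ≤ _ := by gcongr

lemma back_aux (hv : Supers v)
    (x : EuclideanSpace ℝ (Fin n)) {t h : ℝ} (ht : 0 < t) (hh : 0 < h) (c : ℝ≥0∞)
    (hc : Ve v (t + h) x - (hS h (Ve v t) x + Dh H x t h) < c) :
    ∀ᶠ δ in 𝓝[>] (0:ℝ), Ve v (t - δ + (h + δ)) x -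
      (hS (h + δ) (Ve v (t - δ)) x + Dh H x (t - δ) (h + δ)) < c := by
  rw [eventually_iff_seq_eventually]
  intro δ hδ
  have hδ0 : Tendsto δ atTop (𝓝 0) := hδ.mono_right nhdsWithin_le_nhds
  have hδp : ∀ᶠ j in atTop, 0 < δ j := hδ.eventually eventually_mem_nhdsWithin
  have hδt : ∀ᶠ j in atTop, δ j < t := hδ0.eventually (Iio_mem_nhds ht)
  set w := hS h (Ve v t) x with hw
  set wj := fun j => hS (h + δ j) (Ve v (t - δ j)) x with hwj
  have hF : w ≤ liminf wj atTop := by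
    have hpt : ∀ z, Tendsto (fun j => hke (h + δ j) (x - z) * Ve v (t - δ j) z) atTop
        (𝓝 (hke h (x - z) * Ve v t z)) := by
      intro z
      refine ENNReal.Tendsto.mul ?_ (Or.inr (Ve_ne_top _ _)) ?_ (Or.inr ENNReal.ofReal_ne_top)
      · refine (ENNReal.continuous_ofReal.tendsto _).comp ?_
        have := (hk_tendsto_time (r0 := 0) (s := h) hh (x - z))
        have h2 : Tendsto (fun j => - δ j) atTop (𝓝 0) := by simpa using hδ0.neg
        have h3 := this.comp h2
        rw [sub_zero] at h3
        refine h3.congr fun j => ?_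
        simp only [Function.comp, sub_neg_eq_add]
      · rw [Ve_eq ht]
        have h2 : Tendsto (fun j => t - δ j) atTop (𝓝 t) := by
          simpa using (tendsto_const_nhds (x := t)).sub hδ0
        have h3 : Tendsto (fun j => ENNReal.ofReal (v z (t - δ j))) atTop
            (𝓝 (ENNReal.ofReal (v z t))) :=
          (ENNReal.continuous_ofReal.tendsto _).comp
            (((hv.time z t ht).continuousAt.tendsto).comp h2)
        refine h3.congr' ?_
        filter_upwards [hδt] with j hj
        rw [Ve_eq (by linarith)]
    calc w = ∫⁻ z, liminf (fun j => hke (h + δ j) (x - z) * Ve v (t - δ j) z) atTop :=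
          lintegral_congr fun z => (hpt z).liminf_eq.symm
      _ ≤ _ := lintegral_liminf_le fun j =>
          (hke_measurable_comp (by fun_prop) (by fun_prop)).mul (hv.meas_x _)
  have hmin : Tendsto (fun j => min (wj j) w) atTop (𝓝 w) :=
    tendsto_order.2 ⟨fun a ha => (eventually_lt_of_lt_liminf (ha.trans_le hF)).mono
      fun j hj => lt_min hj ha, fun a ha => Eventually.of_forall fun j =>
      (min_le_right _ _).trans_lt ha⟩
  have hlim : Tendsto (fun j => Ve v (t + h) x - (min (wj j) w + Dh H x t h)) atTop
      (𝓝 (Ve v (t + h) x - (w + Dh H x t h))) :=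
    ((ENNReal.continuous_sub_left (Ve_ne_top (v := v) (t + h) x)).tendsto _).comp
      (hmin.add tendsto_const_nhds)
  filter_upwards [hlim.eventually (Iio_mem_nhds hc), hδp] with j hj hjp
  refine lt_of_le_of_lt ?_ hj
  rw [show t - δ j + (h + δ j) = t + h by ring]
  refine tsub_le_tsub le_rfl (add_le_add (min_le_left _ _) ?_)
  unfold Dh
  rw [show t - δ j + (h + δ j) = t + h by ring]
  exact lintegral_mono_set (Ioc_subset_Ioc_left (by linarith))

theorem duhamel (hv : Supers v)
    (hH : Measurable (fun q : EuclideanSpace ℝ (Fin n) × ℝ => H q.2 q.1))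
    (hHv : ∀ x t, 0 < t → H t x = ENNReal.ofReal (deriv (v x) t - laplacian (fun y => v y t) x))
    (hr : ∀ x t, 0 < t → ∀ c : ℝ, 0 ≤ c → ENNReal.ofReal c < H t x → ∃ δ > 0, ∀ y r, dist y x < δ →
      t ≤ r → r < t + δ → ENNReal.ofReal c ≤ H r y) {t h : ℝ} (ht : 0 < t) (hh : 0 < h) :
    ∀ᵐ x, Ve v (t + h) x = hS h (Ve v t) x + Dh H x t h := by
  have hle : ∀ x t h, 0 < t → 0 < h → hS h (Ve v t) x + Dh H x t h ≤ Ve v (t + h) x :=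
    fun x t h ht hh => LCS hv hH (fun x t ht => (hHv x t ht).le) x ht hh
  have hc := coc_defect hv (D := Dh H) (fun h _ => Dh_meas hH h)
    (fun x t h₁ h₂ _ h1 h2 => Dh_coc hH x t h1 h2) hle
  have hz := hc.zero (fun x t ht ε hε => small_aux hv hHv hr x ht hε)
    (fun x t h ht hh c hc => back_aux hv x ht hh c hc) ht hh one_pos 0
  unfold hS at hz
  rw [lintegral_eq_zero_iff] at hz
  swap
  · exact (hke_measurable_comp (by fun_prop) (by fun_prop)).mul (hc.meas_x t hh)
  filter_upwards [hz] with x hx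
  refine le_antisymm ?_ (hle x t h ht hh)
  simp only [Pi.zero_apply, mul_eq_zero] at hx
  rcases hx with hx | hx
  · exfalso
    unfold hke at hx
    rw [ENNReal.ofReal_eq_zero] at hx
    exact absurd (hk_pos one_pos (0 - x)) (not_lt.2 hx)
  · exact tsub_eq_zero_iff_le.1 hx

end duh2
end

open MeasureTheory Set Filter Topology
open scoped ENNReal NNReal

noncomputable section

section logconv
variable {n : ℕ}

lemma cs_lint {α : Type*} [MeasurableSpace α] {ν : Measure α} {f g h : α → ℝ≥0∞} {E : ℝ≥0∞}
    (hg : AEMeasurable g ν) (hh : AEMeasurable h ν) (H : ∀ᵐ a ∂ν, f a ^ 2 ≤ E * g a * h a) :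
    (∫⁻ a, f a ∂ν) ^ 2 ≤ E * (∫⁻ a, g a ∂ν) * ∫⁻ a, h a ∂ν := by
  have sq : ∀ w : ℝ≥0∞, (w ^ (1/2 : ℝ)) ^ 2 = w := fun w => by
    rw [← ENNReal.rpow_natCast, ← ENNReal.rpow_mul]; norm_num
  have sq' : ∀ w : ℝ≥0∞, (w ^ 2) ^ (1/2 : ℝ) = w := fun w => by
    rw [← ENNReal.rpow_natCast, ← ENNReal.rpow_mul]; norm_num
  have h1 : ∀ᵐ a ∂ν, f a ≤ (E * g a) ^ (1/2 : ℝ) * h a ^ (1/2 : ℝ) := by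
    filter_upwards [H] with a ha
    rw [← ENNReal.mul_rpow_of_nonneg _ _ (by norm_num), ← sq' (f a)]
    exact ENNReal.rpow_le_rpow ha (by norm_num)
  have h2 := ENNReal.lintegral_mul_norm_pow_le (μ := ν) (f := fun a => E * g a) (g := h)
    (hg.const_mul E) hh (p := 1/2) (q := 1/2) (by norm_num) (by norm_num) (by norm_num)
  calc _ ≤ ((∫⁻ a, E * g a ∂ν) ^ (1/2 : ℝ) * (∫⁻ a, h a ∂ν) ^ (1/2 : ℝ)) ^ 2 := by
        gcongr
        exact (lintegral_mono_ae h1).trans h2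
    _ = _ := by rw [mul_pow, sq, sq, lintegral_const_mul'' E hg]

lemma cs_add {A B A1 B1 A2 B2 E : ℝ≥0∞} (h1 : A ^ 2 ≤ E * A1 * A2) (h2 : B ^ 2 ≤ E * B1 * B2) :
    (A + B) ^ 2 ≤ E * (A1 + B1) * (A2 + B2) := by
  have := cs_lint (ν := (Measure.count : Measure (Fin 2))) (f := ![A, B]) (g := ![A1, B1])
    (h := ![A2, B2]) (E := E) (Measurable.of_discrete.aemeasurable)
    (Measurable.of_discrete.aemeasurable) (Eventually.of_forall fun i => by
      fin_cases i
      · simpa using h1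
      · simpa using h2)
  simpa [lintegral_count, Fin.sum_univ_two] using this

lemma hke_shift {b : ℝ} (hb : 0 < b) (q w : EuclideanSpace ℝ (Fin n)) :
    hke b q ^ 2 = ENNReal.ofReal (Real.exp (‖w‖ ^ 2 / (2 * b))) * hke b (q + w) * hke b (q - w) := by
  unfold hke
  rw [← ENNReal.ofReal_pow (hk_pos hb q).le, ← ENNReal.ofReal_mul (by positivity),
    ← ENNReal.ofReal_mul (by have := hk_pos hb (q + w); positivity)]
  congr 1
  unfold hk
  have hp := parallelogram_law_with_norm ℝ q w
  set C := (4 * Real.pi * b) ^ (-(n : ℝ) / 2)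
  have e : Real.exp (-‖q‖ ^ 2 / (4 * b)) ^ 2 = Real.exp (‖w‖ ^ 2 / (2 * b)) *
      Real.exp (-‖q + w‖ ^ 2 / (4 * b)) * Real.exp (-‖q - w‖ ^ 2 / (4 * b)) := by
    rw [← Real.exp_nat_mul, ← Real.exp_add, ← Real.exp_add]
    congr 1
    field_simp
    push_cast
    nlinarith
  rw [mul_pow, e]; ring

lemma hS_logconv {b : ℝ} (hb : 0 < b) {f : EuclideanSpace ℝ (Fin n) → ℝ≥0∞} (hf : Measurable f)
    {α θ : ℝ} (z : EuclideanSpace ℝ (Fin n))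
    (H : ∀ p, f p ^ 2 ≤ ENNReal.ofReal (Real.exp α) * f (p + (1 - θ) • z) * f (p - (1 - θ) • z))
    (m : EuclideanSpace ℝ (Fin n)) :
    hS b f m ^ 2 ≤ ENNReal.ofReal (Real.exp (α + θ ^ 2 * ‖z‖ ^ 2 / (2 * b))) *
      hS b f (m + z) * hS b f (m - z) := by
  have e1 : hS b f (m + z) = ∫⁻ p, hke b (m - p + θ • z) * f (p + (1 - θ) • z) := by
    unfold hS
    rw [← lintegral_add_right_eq_self _ ((1 - θ) • z)]
    refine lintegral_congr fun p => ?_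
    congr 2
    module
  have e2 : hS b f (m - z) = ∫⁻ p, hke b (m - p - θ • z) * f (p - (1 - θ) • z) := by
    unfold hS
    rw [← lintegral_sub_right_eq_self _ ((1 - θ) • z)]
    refine lintegral_congr fun p => ?_
    congr 2
    module
  rw [e1, e2]
  unfold hS
  refine cs_lint ?_ ?_ (Eventually.of_forall fun p => ?_)
  · exact ((hke_measurable_comp (by fun_prop) (by fun_prop)).mul (hf.comp (by fun_prop))).aemeasurable
  · exact ((hke_measurable_comp (by fun_prop) (by fun_prop)).mul (hf.comp (by fun_prop))).aemeasurable
  · rw [mul_pow, hke_shift hb (m - p) (θ • z), Real.exp_add, ENNReal.ofReal_mul (by positivity),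
      norm_smul, mul_pow, Real.norm_eq_abs, sq_abs]
    calc _ ≤ ENNReal.ofReal (Real.exp (θ ^ 2 * ‖z‖ ^ 2 / (2 * b))) * hke b (m - p + θ • z) *
        hke b (m - p - θ • z) * (ENNReal.ofReal (Real.exp α) * f (p + (1 - θ) • z) * f (p - (1 - θ) • z)) := by
          gcongr; exact H p
      _ = _ := by ring

/-- Duhamel operator -/
def Du (s : ℝ) (A : ℝ → EuclideanSpace ℝ (Fin n) → ℝ≥0∞) (t : ℝ) (x : EuclideanSpace ℝ (Fin n)) :
    ℝ≥0∞ := ∫⁻ r in Ioo s t, hS (t - r) (A r) x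

lemma Du_meas {s : ℝ} {A : ℝ → EuclideanSpace ℝ (Fin n) → ℝ≥0∞} (hA : Measurable (Function.uncurry A)) :
    Measurable (Function.uncurry (Du s A)) := by
  have e : Function.uncurry (Du s A) = fun q : ℝ × EuclideanSpace ℝ (Fin n) =>
      ∫⁻ r, {w : (ℝ × EuclideanSpace ℝ (Fin n)) × ℝ | s < w.2 ∧ w.2 < w.1.1}.indicator
        (fun w => hS (w.1.1 - w.2) (A w.2) w.1.2) (q, r) := by
    funext q
    obtain ⟨t, x⟩ := q
    simp only [Function.uncurry, Du]
    rw [← lintegral_indicator measurableSet_Ioo]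
    refine lintegral_congr fun r => ?_
    simp only [indicator, mem_Ioo, mem_ofPred_eq]
  rw [e]
  refine Measurable.lintegral_prod_right' ?_
  refine Measurable.indicator (hS_meas (by fun_prop) (by fun_prop) ?_) ?_
  · exact hA.comp (f := fun w : ((ℝ × EuclideanSpace ℝ (Fin n)) × ℝ) × EuclideanSpace ℝ (Fin n) =>
      (w.1.2, w.2)) (by fun_prop)
  · exact (measurableSet_lt measurable_const measurable_snd).inter
      (measurableSet_lt measurable_snd (measurable_fst.comp measurable_fst))

/-- Picard iterates -/
def Wk (s : ℝ) (V0 : EuclideanSpace ℝ (Fin n) → ℝ≥0∞) (Φ : ℝ → ℝ≥0∞ → ℝ≥0∞) :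
    ℕ → ℝ → EuclideanSpace ℝ (Fin n) → ℝ≥0∞
  | 0 => fun _ _ => 0
  | k + 1 => fun t x => hS (t - s) V0 x + Du s (fun r z => Φ r (Wk s V0 Φ k r z)) t x

variable {s : ℝ} {V0 : EuclideanSpace ℝ (Fin n) → ℝ≥0∞} {Φ : ℝ → ℝ≥0∞ → ℝ≥0∞}

lemma Wk_meas (hV0 : Measurable V0) (hΦ : Measurable (Function.uncurry Φ)) (k : ℕ) :
    Measurable (Function.uncurry (Wk s V0 Φ k)) := by
  induction k with
  | zero => exact measurable_const
  | succ k ih =>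
    have h1 : Measurable (fun q : ℝ × EuclideanSpace ℝ (Fin n) => hS (q.1 - s) V0 q.2) :=
      hS_meas (by fun_prop) (by fun_prop) (hV0.comp measurable_snd)
    have h2 : Measurable (Function.uncurry (fun r z => Φ r (Wk s V0 Φ k r z))) :=
      hΦ.comp (f := fun q : ℝ × EuclideanSpace ℝ (Fin n) => (q.1, Wk s V0 Φ k q.1 q.2))
        (measurable_fst.prodMk ih)
    exact h1.add (Du_meas h2)

lemma Wk_logconv (hV0 : Measurable V0) (hΦ : Measurable (Function.uncurry Φ))
    (hlog : ∀ r, s < r → ∀ α : ℝ, 0 ≤ α → ∀ w w1 w2 : ℝ≥0∞, w ≠ ∞ → w1 ≠ ∞ → w2 ≠ ∞ → w ^ 2 ≤ ENNReal.ofReal (Real.exp α) * w1 * w2 →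
      Φ r w ^ 2 ≤ ENNReal.ofReal (Real.exp α) * Φ r w1 * Φ r w2) (k : ℕ)
    (hf : ∀ k t, s < t → ∀ x, Wk s V0 Φ k t x ≠ ∞) :
    ∀ t, s < t → ∀ m z : EuclideanSpace ℝ (Fin n), Wk s V0 Φ k t m ^ 2 ≤
      ENNReal.ofReal (Real.exp (‖z‖ ^ 2 / (2 * (t - s)))) *
      Wk s V0 Φ k t (m + z) * Wk s V0 Φ k t (m - z) := by
  induction k with
  | zero => intro t ht m z; simp [Wk]
  | succ k ih =>
    intro t ht m z
    have hts : 0 < t - s := sub_pos.2 ht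
    simp only [Wk]
    have hA : Measurable (Function.uncurry (fun r z => Φ r (Wk s V0 Φ k r z))) :=
      hΦ.comp (f := fun q : ℝ × EuclideanSpace ℝ (Fin n) => (q.1, Wk s V0 Φ k q.1 q.2))
        (measurable_fst.prodMk (Wk_meas hV0 hΦ k))
    refine cs_add ?_ ?_
    · have := hS_logconv hts hV0 (α := 0) (θ := 1) z (fun p => by simp [sq]) m
      simpa using this
    · unfold Du
      have hm : ∀ y : EuclideanSpace ℝ (Fin n), Measurable (fun r => hS (t - r)
          (fun z => Φ r (Wk s V0 Φ k r z)) y) := fun y => hS_meas (by fun_prop) (by fun_prop) hA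
      refine cs_lint (hm _).aemeasurable (hm _).aemeasurable ?_
      refine (ae_restrict_iff' measurableSet_Ioo).2 (Eventually.of_forall fun r hr => ?_)
      obtain ⟨hr1, hr2⟩ := hr
      have ha : 0 < r - s := sub_pos.2 hr1
      have hb : 0 < t - r := sub_pos.2 hr2
      have key := hS_logconv (f := fun z => Φ r (Wk s V0 Φ k r z)) hb (hA.of_uncurry_left)
        (α := ‖(1 - (t - r) / (t - s)) • z‖ ^ 2 / (2 * (r - s))) (θ := (t - r) / (t - s)) z
        (fun p => hlog r hr1 _ (by positivity) _ _ _ (hf k r hr1 _) (hf k r hr1 _)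
          (hf k r hr1 _) (ih r hr1 p _)) m
      have e : ‖(1 - (t - r) / (t - s)) • z‖ ^ 2 / (2 * (r - s)) +
          ((t - r) / (t - s)) ^ 2 * ‖z‖ ^ 2 / (2 * (t - r)) = ‖z‖ ^ 2 / (2 * (t - s)) := by
        rw [norm_smul, mul_pow, Real.norm_eq_abs, sq_abs]
        have : 1 - (t - r) / (t - s) = (r - s) / (t - s) := by field_simp; ring
        rw [this]
        field_simp
        ring
      rw [e] at key
      exact key

lemma Wk_le {V : ℝ → EuclideanSpace ℝ (Fin n) → ℝ≥0∞} (hmono : ∀ r w w', w' ≠ ∞ → w ≤ w' → Φ r w ≤ Φ r w')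
    (hle : ∀ t, s < t → ∀ x, hS (t - s) V0 x + Du s (fun r z => Φ r (V r z)) t x ≤ V t x)
    (hfin : ∀ t x, V t x ≠ ∞) (k : ℕ) :
    ∀ t, s < t → ∀ x, Wk s V0 Φ k t x ≤ V t x := by
  induction k with
  | zero => intro t ht x; simp [Wk]
  | succ k ih =>
    intro t ht x
    refine le_trans ?_ (hle t ht x)
    simp only [Wk]
    gcongr
    unfold Du
    exact setLIntegral_mono' measurableSet_Ioo fun r hr => hS_mono (fun z => hmono r _ _ (hfin r z) (ih r hr.1 z)) x

lemma pow_lint (L : ℝ) (hL : 0 ≤ L) {t : ℝ} (ht : s < t) (k : ℕ) :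
    ∫⁻ r in Ioo s t, ENNReal.ofReal (L * ((L * (r - s)) ^ k / k.factorial)) =
      ENNReal.ofReal ((L * (t - s)) ^ (k + 1) / (k + 1).factorial) := by
  rw [setLIntegral_congr Ioo_ae_eq_Ioc]
  rw [← ofReal_integral_eq_lintegral_ofReal]
  · rw [← intervalIntegral.integral_of_le ht.le]
    congr 1
    have : ∀ x : ℝ, HasDerivAt (fun r => (L * (r - s)) ^ (k + 1) / (k + 1).factorial)
        (L * ((L * (x - s)) ^ k / k.factorial)) x := fun x => by
      have h := ((((hasDerivAt_id x).sub_const s).const_mul L).pow (k + 1)).div_const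
        ((k + 1).factorial : ℝ)
      refine HasDerivAt.congr_deriv h ?_
      rw [Nat.factorial_succ]
      push_cast
      simp only [id, Nat.add_sub_cancel]
      field_simp
    rw [intervalIntegral.integral_eq_sub_of_hasDerivAt (fun x _ => this x)
      (Continuous.intervalIntegrable (by fun_prop) _ _)]
    simp
  · exact (Continuous.integrableOn_Icc (by fun_prop)).mono_set Ioc_subset_Icc_self
  · refine (ae_restrict_iff' measurableSet_Ioc).2 (Eventually.of_forall fun r hr => ?_)
    have : 0 ≤ r - s := sub_nonneg.2 hr.1.le
    simp only [Pi.zero_apply]; positivity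

lemma Wk_approx {V : ℝ → EuclideanSpace ℝ (Fin n) → ℝ≥0∞} (hV0 : Measurable V0)
    (hΦ : Measurable (Function.uncurry Φ)) (hV : Measurable (Function.uncurry V)) {L : ℝ} (hL : 0 ≤ L)
    (hmono : ∀ r w w', w' ≠ ∞ → w ≤ w' → Φ r w ≤ Φ r w')
    (hlip : ∀ r, s < r → ∀ w d : ℝ≥0∞, w ≠ ∞ → d ≠ ∞ → Φ r (w + d) ≤ Φ r w + ENNReal.ofReal L * d)
    (heq : ∀ t, s < t → ∀ᵐ x, V t x ≤ hS (t - s) V0 x + Du s (fun r z => Φ r (V r z)) t x)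
    (hS' : ∀ r t, s < r → r < t → ∀ x, hS (t - r) (V r) x ≤ V t x)
    (hfin : ∀ t x, V t x ≠ ∞) (hf : ∀ k t, s < t → ∀ x, Wk s V0 Φ k t x ≠ ∞) (k : ℕ) :
    ∀ t, s < t → ∀ᵐ x, V t x ≤ Wk s V0 Φ k t x +
      ENNReal.ofReal ((L * (t - s)) ^ k / k.factorial) * V t x := by
  induction k with
  | zero => intro t ht; simp [Wk]
  | succ k ih =>
    intro t ht
    filter_upwards [heq t ht] with x hx
    refine hx.trans ?_
    simp only [Wk]
    rw [add_assoc]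
    gcongr
    have hA : Measurable (Function.uncurry (fun r z => Φ r (Wk s V0 Φ k r z))) :=
      hΦ.comp (f := fun q : ℝ × EuclideanSpace ℝ (Fin n) => (q.1, Wk s V0 Φ k q.1 q.2))
        (measurable_fst.prodMk (Wk_meas hV0 hΦ k))
    unfold Du
    rw [← pow_lint L hL ht k, ← lintegral_mul_const _ (by fun_prop), ← lintegral_add_left]
    swap
    · exact hS_meas (by fun_prop) (by fun_prop) hA
    refine setLIntegral_mono' measurableSet_Ioo fun r hr => ?_
    have hVr : Measurable (V r) := hV.of_uncurry_left
    have hAr : Measurable (fun z => Φ r (Wk s V0 Φ k r z)) := hA.of_uncurry_left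
    have hrs : 0 ≤ r - s := sub_nonneg.2 hr.1.le
    calc hS (t - r) (fun z => Φ r (V r z)) x ≤ hS (t - r) (fun z => Φ r (Wk s V0 Φ k r z) +
          ENNReal.ofReal (L * ((L * (r - s)) ^ k / k.factorial)) * V r z) x := by
          unfold hS
          refine lintegral_mono_ae ?_
          filter_upwards [ih r hr.1] with z hz
          gcongr
          have hd : ENNReal.ofReal ((L * (r - s)) ^ k / k.factorial) * V r z ≠ ∞ :=
            ENNReal.mul_ne_top ENNReal.ofReal_ne_top (hfin r z)
          refine (hmono r _ _ (ENNReal.add_ne_top.2 ⟨hf k r hr.1 z, hd⟩) hz).trans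
            ((hlip r hr.1 _ _ (hf k r hr.1 z) hd).trans ?_)
          rw [ENNReal.ofReal_mul hL, mul_assoc]
      _ = hS (t - r) (fun z => Φ r (Wk s V0 Φ k r z)) x +
          ENNReal.ofReal (L * ((L * (r - s)) ^ k / k.factorial)) * hS (t - r) (V r) x := by
          rw [hS_add hAr, hS_const_mul _ hVr]
      _ ≤ _ := by
          gcongr
          exact hS' r t hr.1 hr.2 x

theorem logconv_ae {V : ℝ → EuclideanSpace ℝ (Fin n) → ℝ≥0∞} (hV0 : Measurable V0)
    (hΦ : Measurable (Function.uncurry Φ)) (hV : Measurable (Function.uncurry V)) {L : ℝ} (hL : 0 ≤ L)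
    (hmono : ∀ r w w', w' ≠ ∞ → w ≤ w' → Φ r w ≤ Φ r w')
    (hlip : ∀ r, s < r → ∀ w d : ℝ≥0∞, w ≠ ∞ → d ≠ ∞ → Φ r (w + d) ≤ Φ r w + ENNReal.ofReal L * d)
    (hlog : ∀ r, s < r → ∀ α : ℝ, 0 ≤ α → ∀ w w1 w2 : ℝ≥0∞, w ≠ ∞ → w1 ≠ ∞ → w2 ≠ ∞ → w ^ 2 ≤ ENNReal.ofReal (Real.exp α) * w1 * w2 →
      Φ r w ^ 2 ≤ ENNReal.ofReal (Real.exp α) * Φ r w1 * Φ r w2)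
    (hle : ∀ t, s < t → ∀ x, hS (t - s) V0 x + Du s (fun r z => Φ r (V r z)) t x ≤ V t x)
    (heq : ∀ t, s < t → ∀ᵐ x, V t x ≤ hS (t - s) V0 x + Du s (fun r z => Φ r (V r z)) t x)
    (hS' : ∀ r t, s < r → r < t → ∀ x, hS (t - r) (V r) x ≤ V t x)
    (hfin : ∀ t x, V t x ≠ ∞) {t : ℝ} (ht : s < t) (z : EuclideanSpace ℝ (Fin n)) :
    ∀ᵐ m, V t m ^ 2 ≤ ENNReal.ofReal (Real.exp (‖z‖ ^ 2 / (2 * (t - s)))) *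
      V t (m + z) * V t (m - z) := by
  have hf : ∀ k t, s < t → ∀ x, Wk s V0 Φ k t x ≠ ∞ := fun k t ht x =>
    ne_top_of_le_ne_top (hfin t x) (Wk_le hmono hle hfin k t ht x)
  have h1 := ae_all_iff.2 fun k => Wk_approx hV0 hΦ hV hL hmono hlip heq hS' hfin hf k t ht
  filter_upwards [h1] with m hm
  set B := ENNReal.ofReal (Real.exp (‖z‖ ^ 2 / (2 * (t - s)))) * V t (m + z) * V t (m - z) with hB
  have hW : ∀ k, Wk s V0 Φ k t m ^ 2 ≤ B := fun k => by
    refine (Wk_logconv hV0 hΦ hlog k hf t ht m z).trans ?_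
    have := Wk_le hmono hle hfin k t ht
    rw [hB]
    gcongr
    · exact this _
    · exact this _
  have hW' : ∀ k, Wk s V0 Φ k t m ≤ B ^ (1/2 : ℝ) := fun k => by
    have := ENNReal.rpow_le_rpow (hW k) (z := 1/2) (by norm_num)
    rwa [← ENNReal.rpow_natCast, ← ENNReal.rpow_mul, show ((2:ℕ):ℝ) * (1/2) = 1 by norm_num,
      ENNReal.rpow_one] at this
  have hlim : Tendsto (fun k : ℕ => B ^ (1/2 : ℝ) +
      ENNReal.ofReal ((L * (t - s)) ^ k / k.factorial) * V t m) atTop (𝓝 (B ^ (1/2 : ℝ) + 0 * V t m)) := by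
    refine tendsto_const_nhds.add (ENNReal.Tendsto.mul_const ?_ (Or.inr (hfin t m)))
    have := ENNReal.tendsto_ofReal (FloorSemiring.tendsto_pow_div_factorial_atTop (L * (t - s)))
    simpa using this
  have := ge_of_tendsto' hlim fun k => (hm k).trans (add_le_add (hW' k) le_rfl)
  rw [zero_mul, add_zero] at this
  calc V t m ^ 2 ≤ (B ^ (1/2 : ℝ)) ^ 2 := by gcongr
    _ = B := by rw [← ENNReal.rpow_natCast, ← ENNReal.rpow_mul]; norm_num

end logconv
end

open MeasureTheory Set Filter Topology
open scoped ENNReal NNReal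

noncomputable section

/-- admissible nonlinearities -/
structure NL (F : ℝ → ℝ) (L : ℝ) : Prop where
  hL : 0 ≤ L
  nonneg : ∀ w, 0 ≤ w → 0 ≤ F w
  mono : Monotone F
  lip : ∀ w d, 0 ≤ d → F (w + d) ≤ F w + L * d
  log : ∀ α : ℝ, 0 ≤ α → ∀ w w1 w2 : ℝ, 0 ≤ w → 0 ≤ w1 → 0 ≤ w2 →
    w ^ 2 ≤ Real.exp α * w1 * w2 → F w ^ 2 ≤ Real.exp α * F w1 * F w2

section nonlin
variable {n : ℕ} {F : ℝ → ℝ} {L : ℝ}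

lemma NL.continuous (hF : NL F L) : Continuous F := by
  have : LipschitzWith (Real.toNNReal L) F := by
    refine LipschitzWith.of_le_add_mul _ fun x y => ?_
    rw [Real.coe_toNNReal _ hF.hL, Real.dist_eq]
    calc F x ≤ F (y + |x - y|) := hF.mono (by have := le_abs_self (x - y); linarith)
      _ ≤ _ := hF.lip _ _ (abs_nonneg _)
  exact this.continuous

lemma laplacian_const_mul {f : EuclideanSpace ℝ (Fin n) → ℝ} (hf : ContDiff ℝ 2 f) (c : ℝ)
    (x : EuclideanSpace ℝ (Fin n)) : laplacian (fun y => c * f y) x = c * laplacian f x := by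
  unfold laplacian
  rw [Finset.mul_sum]
  refine Finset.sum_congr rfl fun i _ => ?_
  have h1 : ContDiff ℝ 1 (fun y => fderiv ℝ f y (EuclideanSpace.single i (1:ℝ))) :=
    (hf.fderiv_right (m := 1) (by norm_num)).clm_apply contDiff_const
  have e : (fun y => fderiv ℝ (fun y => c * f y) y (EuclideanSpace.single i (1:ℝ))) =
      fun y => c * fderiv ℝ f y (EuclideanSpace.single i (1:ℝ)) := by
    funext y
    rw [fderiv_const_mul (hf.differentiable (by norm_num) y)]
    simp
  rw [e, fderiv_const_mul (h1.differentiable (by norm_num) x)]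
  simp

/-- the nonlinearity after the exponential change of unknown -/
def Ph (F : ℝ → ℝ) (Λ : ℝ) (r : ℝ) (w : ℝ≥0∞) : ℝ≥0∞ :=
  ENNReal.ofReal (Real.exp (Λ * r) * F (Real.exp (-(Λ * r)) * w.toReal))

theorem logconv_NL {u : EuclideanSpace ℝ (Fin n) → ℝ → ℝ} (hF : NL F L) {Λ : ℝ}
    (hpos : ∀ x t, 0 < t → 0 < u x t) (hspace : ∀ t, 0 < t → ContDiff ℝ 2 (fun x => u x t))
    (htime : ∀ x t, 0 < t → DifferentiableAt ℝ (u x) t)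
    (heq : ∀ x t, 0 < t → deriv (u x) t = laplacian (fun y => u y t) x + (F (u x t) - Λ * u x t))
    {s t : ℝ} (hs : 0 < s) (hst : s < t) (m z : EuclideanSpace ℝ (Fin n)) :
    u m t ^ 2 ≤ Real.exp (‖z‖ ^ 2 / (2 * (t - s))) * u (m + z) t * u (m - z) t := by
  set v : EuclideanSpace ℝ (Fin n) → ℝ → ℝ := fun x t => Real.exp (Λ * t) * u x t with hvdef
  have hFc := hF.continuous
  have vinv : ∀ x t, Real.exp (-(Λ * t)) * v x t = u x t := fun x t => by
    simp only [hvdef]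
    rw [← mul_assoc, ← Real.exp_add]; simp
  have hvd : ∀ x t, 0 < t → HasDerivAt (v x)
      (Real.exp (Λ * t) * Λ * u x t + Real.exp (Λ * t) * deriv (u x) t) t := fun x t ht => by
    have h1 : HasDerivAt (fun t => Real.exp (Λ * t)) (Real.exp (Λ * t) * Λ) t := by
      simpa using ((hasDerivAt_id t).const_mul Λ).exp
    exact h1.mul (htime x t ht).hasDerivAt
  have hlap : ∀ x t, 0 < t → laplacian (fun y => v y t) x =
      Real.exp (Λ * t) * laplacian (fun y => u y t) x := fun x t ht =>
    laplacian_const_mul (hspace t ht) _ x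
  have hdiff : ∀ x t, 0 < t → deriv (v x) t - laplacian (fun y => v y t) x =
      Real.exp (Λ * t) * F (u x t) := fun x t ht => by
    rw [(hvd x t ht).deriv, hlap x t ht, heq x t ht]; ring
  have hv : Supers v := {
    pos := fun x t ht => by have := hpos x t ht; simp only [hvdef]; positivity
    space := fun t ht => contDiff_const.mul (hspace t ht)
    time := fun x t ht => (hvd x t ht).differentiableAt
    sup := fun x t ht => by
      have h1 := hdiff x t ht
      have h2 := hF.nonneg (u x t) (hpos x t ht).le
      have : 0 ≤ Real.exp (Λ * t) * F (u x t) := by positivity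
      linarith }
  have hVe : ∀ x t, 0 < t → (Ve v t x).toReal = v x t := fun x t ht => by
    rw [Ve_eq ht, ENNReal.toReal_ofReal (hv.pos x t ht).le]
  have hPh : Measurable (Function.uncurry (Ph F Λ)) := by
    unfold Ph Function.uncurry
    refine Measurable.ennreal_ofReal ?_
    refine Measurable.mul (by fun_prop) (hFc.measurable.comp ?_)
    exact Measurable.mul (by fun_prop) (ENNReal.measurable_toReal.comp measurable_snd)
  have hVm : Measurable (fun q : EuclideanSpace ℝ (Fin n) × ℝ => Ve v q.2 q.1) := hv.meas
  set H : ℝ → EuclideanSpace ℝ (Fin n) → ℝ≥0∞ := fun r x => Ph F Λ r (Ve v r x) with hHdef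
  have hH : Measurable (fun q : EuclideanSpace ℝ (Fin n) × ℝ => H q.2 q.1) :=
    hPh.comp (measurable_snd.prodMk hVm)
  have hHe : ∀ x t, 0 < t → H t x = ENNReal.ofReal (Real.exp (Λ * t) * F (u x t)) := fun x t ht => by
    simp only [hHdef, Ph]; rw [hVe x t ht, vinv]
  have hHv : ∀ x t, 0 < t → H t x = ENNReal.ofReal (deriv (v x) t - laplacian (fun y => v y t) x) :=
    fun x t ht => by rw [hHe x t ht, hdiff x t ht]
  have hr : ∀ x t, 0 < t → ∀ c : ℝ, 0 ≤ c → ENNReal.ofReal c < H t x → ∃ δ > 0, ∀ y r, dist y x < δ →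
      t ≤ r → r < t + δ → ENNReal.ofReal c ≤ H r y := by
    intro x t ht c hc hcH
    rw [hHe x t ht] at hcH
    have hc' : c < Real.exp (Λ * t) * F (u x t) := (ENNReal.ofReal_lt_ofReal_iff_of_nonneg hc).1 hcH
    have hcont : Continuous (fun q : ℝ × ℝ => Real.exp (Λ * q.1) * F (Real.exp (-(Λ * q.1)) * q.2)) := by
      fun_prop
    have hev : ∀ᶠ q in 𝓝 ((t, v x t) : ℝ × ℝ),
        c < Real.exp (Λ * q.1) * F (Real.exp (-(Λ * q.1)) * q.2) := by
      refine hcont.continuousAt.eventually (lt_mem_nhds ?_)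
      simp only [vinv]; exact hc'
    obtain ⟨η, hη, hη'⟩ := Metric.eventually_nhds_iff.1 hev
    obtain ⟨δ, hδ, hδ'⟩ := hv.rlsc ht x (show v x t - η / 2 < v x t by linarith)
    refine ⟨min δ η, lt_min hδ hη, fun y r hy htr hr => ?_⟩
    have h1 := hδ' y r (hy.trans_le (min_le_left _ _)) htr (hr.trans_le (by gcongr; exact min_le_left _ _))
    have hr2 : r < t + η := hr.trans_le (by gcongr; exact min_le_right _ _)
    have h2 := hη' (y := (r, v x t - η / 2)) (by
      rw [Prod.dist_eq]
      refine max_lt ?_ ?_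
      · simp only [Real.dist_eq]; rw [abs_lt]; constructor <;> linarith
      · simp only [Real.dist_eq]; rw [abs_lt]; constructor <;> linarith)
    rw [hHe y r (ht.trans_le htr)]
    refine ENNReal.ofReal_le_ofReal (h2.le.trans ?_)
    simp only
    rw [← vinv y r]
    have := hF.mono (a := Real.exp (-(Λ * r)) * (v x t - η / 2)) (b := Real.exp (-(Λ * r)) * v y r)
      (by gcongr)
    gcongr
  have hDu : ∀ t, s < t → ∀ x, Dh H x s (t - s) = Du s H t x := fun t ht x => by
    unfold Dh Du
    rw [show s + (t - s) = t by ring]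
    exact (setLIntegral_congr Ioo_ae_eq_Ioc).symm
  have hle : ∀ t, s < t → ∀ x, hS (t - s) (Ve v s) x + Du s H t x ≤ Ve v t x := fun t ht x => by
    have := LCS hv hH (fun x t ht => (hHv x t ht).le) x hs (sub_pos.2 ht)
    rw [hDu t ht, show s + (t - s) = t by ring] at this
    exact this
  have heq' : ∀ t, s < t → ∀ᵐ x, Ve v t x ≤ hS (t - s) (Ve v s) x + Du s H t x := fun t ht => by
    have := duhamel hv hH hHv hr hs (sub_pos.2 ht)
    rw [show s + (t - s) = t by ring] at this
    filter_upwards [this] with x hx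
    rw [hx, hDu t ht]
  have hS' : ∀ r t, s < r → r < t → ∀ x, hS (t - r) (Ve v r) x ≤ Ve v t x := fun r t hr ht x => by
    have := LC hv (hs.trans hr) (sub_pos.2 ht) x
    rwa [show r + (t - r) = t by ring] at this
  have hae := logconv_ae (s := s) (V0 := Ve v s) (Φ := Ph F Λ) (V := Ve v) (L := L) (hv.meas_x s) hPh
    (hVm.comp (f := fun q : ℝ × EuclideanSpace ℝ (Fin n) => (q.2, q.1)) (by fun_prop)) hF.hL
    (fun r w w' hw' hw => by
      unfold Ph
      have h1 := ENNReal.toReal_mono hw' hw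
      have := hF.mono (a := Real.exp (-(Λ * r)) * w.toReal) (b := Real.exp (-(Λ * r)) * w'.toReal)
        (by gcongr)
      gcongr)
    (fun r _ w d hw hd => by
      unfold Ph
      rw [ENNReal.toReal_add hw hd]
      nth_rewrite 2 [← ENNReal.ofReal_toReal hd]
      rw [← ENNReal.ofReal_mul hF.hL, ← ENNReal.ofReal_add]
      · refine ENNReal.ofReal_le_ofReal ?_
        rw [mul_add]
        have h1 := hF.lip (Real.exp (-(Λ * r)) * w.toReal) (Real.exp (-(Λ * r)) * d.toReal)
          (by positivity)
        calc _ ≤ Real.exp (Λ * r) * (F (Real.exp (-(Λ * r)) * w.toReal) +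
              L * (Real.exp (-(Λ * r)) * d.toReal)) := by gcongr
          _ = Real.exp (Λ * r) * F (Real.exp (-(Λ * r)) * w.toReal) +
              (Real.exp (Λ * r) * Real.exp (-(Λ * r))) * (L * d.toReal) := by ring
          _ = _ := by rw [← Real.exp_add]; simp
      · have := hF.nonneg (Real.exp (-(Λ * r)) * w.toReal) (by positivity)
        positivity
      · have := hF.hL
        positivity)
    (fun r _ α hα w w1 w2 hw hw1 hw2 hww => by
      unfold Ph
      have hww' : w.toReal ^ 2 ≤ Real.exp α * w1.toReal * w2.toReal := by
        have := ENNReal.toReal_mono (ENNReal.mul_ne_top (ENNReal.mul_ne_top ENNReal.ofReal_ne_top hw1) hw2) hww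
        rwa [ENNReal.toReal_pow, ENNReal.toReal_mul, ENNReal.toReal_mul,
          ENNReal.toReal_ofReal (by positivity)] at this
      have f0 := hF.nonneg (Real.exp (-(Λ * r)) * w.toReal) (by positivity)
      have f1 := hF.nonneg (Real.exp (-(Λ * r)) * w1.toReal) (by positivity)
      have h1 := hF.log α hα (Real.exp (-(Λ * r)) * w.toReal) (Real.exp (-(Λ * r)) * w1.toReal)
        (Real.exp (-(Λ * r)) * w2.toReal) (by positivity) (by positivity) (by positivity) (by
          have := mul_le_mul_of_nonneg_left hww' (show 0 ≤ Real.exp (-(Λ * r)) ^ 2 by positivity)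
          nlinarith)
      rw [← ENNReal.ofReal_pow (by positivity), ← ENNReal.ofReal_mul (by positivity),
        ← ENNReal.ofReal_mul (by positivity)]
      refine ENNReal.ofReal_le_ofReal ?_
      have := mul_le_mul_of_nonneg_left h1 (show 0 ≤ Real.exp (Λ * r) ^ 2 by positivity)
      nlinarith)
    hle heq' hS' (fun t x => Ve_ne_top t x) hst z
  have ht : 0 < t := hs.trans hst
  have hae' : ∀ᵐ m, u m t ^ 2 ≤ Real.exp (‖z‖ ^ 2 / (2 * (t - s))) * u (m + z) t * u (m - z) t := by
    filter_upwards [hae] with m hm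
    have := ENNReal.toReal_mono (ENNReal.mul_ne_top (ENNReal.mul_ne_top ENNReal.ofReal_ne_top
      (Ve_ne_top _ _)) (Ve_ne_top _ _)) hm
    rw [ENNReal.toReal_pow, ENNReal.toReal_mul, ENNReal.toReal_mul,
          ENNReal.toReal_ofReal (by positivity), hVe _ t ht, hVe _ t ht, hVe _ t ht] at this
    rw [← vinv m t, ← vinv (m + z) t, ← vinv (m - z) t]
    have := mul_le_mul_of_nonneg_left this (show 0 ≤ Real.exp (-(Λ * t)) ^ 2 by positivity)
    nlinarith
  have hd := Measure.dense_of_ae hae'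
  have hcu : Continuous (fun x => u x t) := (hspace t ht).continuous
  have hcl : IsClosed {m | u m t ^ 2 ≤ Real.exp (‖z‖ ^ 2 / (2 * (t - s))) * u (m + z) t * u (m - z) t} := by
    refine isClosed_le (hcu.pow 2) ?_
    exact (continuous_const.mul (hcu.comp (by fun_prop : Continuous fun m => m + z))).mul
      (hcu.comp (by fun_prop : Continuous fun m => m - z))
  have := hcl.closure_eq ▸ hd.closure_eq
  have hm : m ∈ {m | u m t ^ 2 ≤ Real.exp (‖z‖ ^ 2 / (2 * (t - s))) * u (m + z) t * u (m - z) t} := by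
    rw [this]; trivial
  exact hm

end nonlin
end

open MeasureTheory Set Filter Topology
open scoped ENNReal NNReal

noncomputable section

section final
variable {n : ℕ}

lemma NL_linear {A : ℝ} (hA : 0 ≤ A) : NL (fun w => A * w) A where
  hL := hA
  nonneg := fun w hw => by positivity
  mono := fun w w' h => by dsimp only; gcongr
  lip := fun w d _ => by rw [mul_add]
  log := fun α _ w w1 w2 _ _ _ h => by
    have := mul_le_mul_of_nonneg_left h (sq_nonneg A)
    nlinarith

lemma rpow_lip {c p w w' : ℝ} (hc : 0 < c) (hp : p ≤ 1) (hw : c ≤ w) (hww : w ≤ w') :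
    |w' ^ p - w ^ p| ≤ |p| * c ^ (p - 1) * (w' - w) := by
  have := Convex.norm_image_sub_le_of_norm_hasDerivWithin_le (f := fun x : ℝ => x ^ p)
    (f' := fun x => p * x ^ (p - 1)) (s := Ici c) (C := |p| * c ^ (p - 1)) (x := w) (y := w')
    (fun x hx => (Real.hasDerivAt_rpow_const (Or.inl (hc.trans_le hx).ne')).hasDerivWithinAt)
    (fun x hx => by
      have hx' : c ≤ x := hx
      have hx0 : 0 < x := hc.trans_le hx
      rw [norm_mul, Real.norm_eq_abs, Real.norm_eq_abs, abs_of_pos (Real.rpow_pos_of_pos hx0 _)]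
      exact mul_le_mul_of_nonneg_left (Real.rpow_le_rpow_of_nonpos hc hx' (by linarith))
        (abs_nonneg p)) (convex_Ici c) hw (hw.trans hww)
  rwa [Real.norm_eq_abs, Real.norm_eq_abs, abs_of_nonneg (sub_nonneg.2 hww)] at this

variable {N : ℕ} {a p : Fin N → ℝ}

lemma NL_trunc (ha : ∀ i, 0 ≤ a i) (hp : ∀ i, p i ≤ 1) {c Λ : ℝ} (hc : 0 < c)
    (hΛ : Λ = ∑ i, a i * (|p i| * c ^ (p i - 1))) :
    NL (fun w => ∑ i, a i * max w c ^ p i + Λ * max w c) (2 * Λ) := by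
  have hΛ0 : 0 ≤ Λ := by
    rw [hΛ]; exact Finset.sum_nonneg fun i _ => by have := ha i; positivity
  set G : ℝ → ℝ := fun w => ∑ i, a i * w ^ p i + Λ * w with hG
  have hdiff : ∀ w w', c ≤ w → w ≤ w' →
      |∑ i, a i * w' ^ p i - ∑ i, a i * w ^ p i| ≤ Λ * (w' - w) := fun w w' hw hww => by
    rw [← Finset.sum_sub_distrib, hΛ, Finset.sum_mul]
    refine (Finset.abs_sum_le_sum_abs _ _).trans (Finset.sum_le_sum fun i _ => ?_)
    rw [← mul_sub, abs_mul, abs_of_nonneg (ha i), mul_assoc]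
    exact mul_le_mul_of_nonneg_left (rpow_lip hc (hp i) hw hww) (ha i)
  have hGm : ∀ w w', c ≤ w → w ≤ w' → G w ≤ G w' := fun w w' hw hww => by
    have := abs_le.1 (hdiff w w' hw hww)
    simp only [hG]; linarith
  have hG0 : ∀ w, c ≤ w → 0 ≤ G w := fun w hw => by
    have hw0 : 0 < w := hc.trans_le hw
    have : 0 ≤ ∑ i, a i * w ^ p i := Finset.sum_nonneg fun i _ => by have := ha i; positivity
    simp only [hG]; positivity
  refine ⟨by positivity, fun w _ => hG0 _ (le_max_right _ _), fun w w' h =>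
    hGm _ _ (le_max_right _ _) (max_le_max_right c h), fun w d hd => ?_, ?_⟩
  · have h1 : max w c ≤ max (w + d) c := max_le_max_right c (by linarith)
    have h2 : max (w + d) c ≤ max w c + d :=
      max_le (by linarith [le_max_left w c]) (by linarith [le_max_right w c])
    have := abs_le.1 (hdiff _ _ (le_max_right w c) h1)
    nlinarith
  · intro α hα w w1 w2 hw hw1 hw2 h
    have hM1 : c ≤ max w1 c := le_max_right _ _
    have hM2 : c ≤ max w2 c := le_max_right _ _
    have hE : 1 ≤ Real.exp α := Real.one_le_exp hα
    have hM : max w c ^ 2 ≤ Real.exp α * max w1 c * max w2 c := by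
      rcases max_cases w c with h' | h'
      · rw [h'.1]
        refine h.trans ?_
        gcongr
        · exact le_max_left _ _
        · exact le_max_left _ _
      · rw [h'.1]
        calc c ^ 2 = 1 * c * c := by ring
          _ ≤ _ := by gcongr
    have hMc : c ≤ max w c := le_max_right _ _
    change G (max w c) ^ 2 ≤ Real.exp α * G (max w1 c) * G (max w2 c)
    generalize max w c = M at *
    generalize max w1 c = M1 at *
    generalize max w2 c = M2 at *
    have h10 : 0 < M1 := hc.trans_le hM1
    have h20 : 0 < M2 := hc.trans_le hM2
    set R := Real.sqrt (M1 * M2) with hR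
    have hR2 : R ^ 2 = M1 * M2 := Real.sq_sqrt (by positivity)
    have hR0 : 0 < R := by positivity
    have hcR : c ≤ R := by
      refine Real.le_sqrt_of_sq_le ?_
      nlinarith
    set l := Real.exp (α / 2) with hl
    have hl2 : l ^ 2 = Real.exp α := by rw [hl, ← Real.exp_nat_mul]; congr 1; push_cast; ring
    have hl1 : 1 ≤ l := Real.one_le_exp (by positivity)
    have hl0 : 0 < l := by positivity
    have hMl : M ≤ l * R := by
      refine (sq_le_sq₀ (hc.le.trans hMc) (by positivity)).1 ?_
      rw [mul_pow, hl2, hR2]; linarith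
    have s1 : G M ≤ G (l * R) := hGm _ _ hMc hMl
    have s2 : G (l * R) ≤ l * G R := by
      simp only [hG]
      rw [mul_add, Finset.mul_sum]
      have : ∑ i, a i * (l * R) ^ p i ≤ ∑ i, l * (a i * R ^ p i) := by
        refine Finset.sum_le_sum fun i _ => ?_
        rw [Real.mul_rpow hl0.le hR0.le]
        have h1 : l ^ p i ≤ l := by
          calc l ^ p i ≤ l ^ (1:ℝ) := Real.rpow_le_rpow_of_exponent_le hl1 (hp i)
            _ = l := Real.rpow_one l
        have h2 : 0 ≤ a i * R ^ p i := by have := ha i; positivity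
        nlinarith
      nlinarith
    have s3 : G R ^ 2 ≤ G M1 * G M2 := by
      have e1 : ∀ w, G w = ∑ o : Option (Fin N), o.elim (Λ * w) (fun i => a i * w ^ p i) := fun w => by
        rw [Fintype.sum_option]; simp only [hG, Option.elim]; ring
      rw [e1, e1, e1]
      refine Finset.sum_sq_le_sum_mul_sum_of_sq_le_mul _ (fun o _ => ?_) (fun o _ => ?_) (fun o _ => le_of_eq ?_)
      · cases o with
        | none => simp only [Option.elim]; positivity
        | some i => simp only [Option.elim]; have := ha i; positivity
      · cases o with
        | none => simp only [Option.elim]; positivity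
        | some i => simp only [Option.elim]; have := ha i; positivity
      · cases o with
        | none => simp only [Option.elim]; rw [mul_pow, hR2]; ring
        | some i =>
          simp only [Option.elim]
          have : (R ^ p i) ^ 2 = M1 ^ p i * M2 ^ p i := by
            rw [← Real.mul_rpow h10.le h20.le, ← hR2, ← Real.rpow_natCast, ← Real.rpow_natCast,
              ← Real.rpow_mul hR0.le, ← Real.rpow_mul hR0.le, mul_comm]
          rw [mul_pow, this]; ring
    have g0 := hG0 M hMc
    calc G M ^ 2 ≤ (l * G R) ^ 2 := by gcongr; exact s1.trans s2
      _ = Real.exp α * G R ^ 2 := by rw [mul_pow, hl2]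
      _ ≤ Real.exp α * (G M1 * G M2) := by gcongr
      _ = _ := by ring

lemma laplacian_rpow_le {f : EuclideanSpace ℝ (Fin n) → ℝ} (hf : ContDiff ℝ 2 f) (hpos : ∀ x, 0 < f x)
    {κ : ℝ} (h0 : 0 ≤ κ) (h1 : κ ≤ 1) (x : EuclideanSpace ℝ (Fin n)) :
    laplacian (fun y => f y ^ κ) x ≤ κ * f x ^ (κ - 1) * laplacian f x := by
  have hg : ContDiff ℝ 2 (fun y => f y ^ κ) := hf.rpow_const_of_ne fun y => (hpos y).ne'
  rw [← laplacian_const_mul hf]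
  unfold laplacian
  refine Finset.sum_le_sum fun i _ => ?_
  have L1 := LineSecond.of_contDiff hg x (EuclideanSpace.single i (1:ℝ))
  have L2 := LineSecond.of_contDiff (contDiff_const.mul hf :
    ContDiff ℝ 2 (fun y => κ * f x ^ (κ - 1) * f y)) x (EuclideanSpace.single i (1:ℝ))
  have := (L2.sub L1).nonneg_of_min (Eventually.of_forall fun y => ?_)
  · linarith
  · dsimp only
    have hx := hpos x
    have hy := hpos y
    have hb := rpow_one_add_le_one_add_mul_self (s := f y / f x - 1) (by
      have : 0 < f y / f x := by positivity
      linarith) h0 h1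
    rw [add_sub_cancel, Real.div_rpow hy.le hx.le] at hb
    have hk1 : f x ^ κ = f x ^ (κ - 1) * f x := by
      rw [Real.rpow_sub_one hx.ne']; field_simp
    have hxk : 0 < f x ^ κ := Real.rpow_pos_of_pos hx _
    rw [div_le_iff₀ hxk] at hb
    have : (1 + κ * (f y / f x - 1)) * f x ^ κ = f x ^ κ + κ * f x ^ (κ - 1) * (f y - f x) := by
      rw [hk1]; field_simp
    nlinarith

variable {u : EuclideanSpace ℝ (Fin n) → ℝ → ℝ}

lemma u_supers (ha : ∀ i, 0 ≤ a i)
    (hpos : ∀ x t, 0 < t → 0 < u x t) (hspace : ∀ t, 0 < t → ContDiff ℝ 2 (fun x => u x t))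
    (htime : ∀ x t, 0 < t → DifferentiableAt ℝ (u x) t)
    (heq : ∀ x t, 0 < t →
      deriv (u x) t = laplacian (fun y => u y t) x + ∑ i, a i * u x t ^ p i) : Supers u where
  pos := hpos
  space := hspace
  time := htime
  sup := fun x t ht => by
    rw [heq x t ht]
    have : 0 ≤ ∑ i, a i * u x t ^ p i := Finset.sum_nonneg fun i _ => by
      have := ha i; have := hpos x t ht; positivity
    linarith

lemma u_lower (ha : ∀ i, 0 ≤ a i)
    (hpos : ∀ x t, 0 < t → 0 < u x t) (hspace : ∀ t, 0 < t → ContDiff ℝ 2 (fun x => u x t))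
    (htime : ∀ x t, 0 < t → DifferentiableAt ℝ (u x) t)
    (heq : ∀ x t, 0 < t →
      deriv (u x) t = laplacian (fun y => u y t) x + ∑ i, a i * u x t ^ p i)
    (i : Fin N) (hai : 0 < a i) (hpi : p i < 1) {s : ℝ} (hs : 0 < s) :
    ∃ c > 0, ∀ x, c ≤ u x s := by
  set q := max (p i) 0 with hq
  have hq0 : 0 ≤ q := le_max_right _ _
  have hqp : p i ≤ q := le_max_left _ _
  have hq1 : q < 1 := max_lt hpi one_pos
  obtain ⟨κ, hκ⟩ : ∃ κ, κ = 1 - q := ⟨_, rfl⟩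
  have hκ0 : 0 < κ := by linarith
  have hκ1 : κ ≤ 1 := by linarith
  set z : EuclideanSpace ℝ (Fin n) → ℝ → ℝ := fun x t => Real.exp (κ * t) * u x t ^ κ with hz
  have hzd : ∀ x t, 0 < t → HasDerivAt (z x) (Real.exp (κ * t) * κ * u x t ^ κ +
      Real.exp (κ * t) * (deriv (u x) t * κ * u x t ^ (κ - 1))) t := fun x t ht => by
    have h1 : HasDerivAt (fun t => Real.exp (κ * t)) (Real.exp (κ * t) * κ) t := by
      simpa using ((hasDerivAt_id t).const_mul κ).exp
    exact h1.mul ((htime x t ht).hasDerivAt.rpow_const (Or.inl (hpos x t ht).ne'))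
  have hup : ∀ t, 0 < t → ContDiff ℝ 2 (fun x => u x t ^ κ) := fun t ht =>
    (hspace t ht).rpow_const_of_ne fun x => (hpos x t ht).ne'
  set b := κ * min (a i) 1 with hb
  have hb0 : 0 < b := by positivity
  have hdiff : ∀ x t, 0 < t → b ≤ deriv (z x) t - laplacian (fun y => z y t) x := fun x t ht => by
    have hu := hpos x t ht
    have l1 : laplacian (fun y => z y t) x = Real.exp (κ * t) * laplacian (fun y => u y t ^ κ) x :=
      laplacian_const_mul (hup t ht) _ x
    have l2 := laplacian_rpow_le (hspace t ht) (fun y => hpos y t ht) hκ0.le hκ1 x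
    have hsum : a i * u x t ^ p i ≤ ∑ i, a i * u x t ^ p i :=
      Finset.single_le_sum (f := fun i => a i * u x t ^ p i)
        (fun j _ => by have := ha j; positivity) (Finset.mem_univ i)
    rw [(hzd x t ht).deriv, l1, heq x t ht]
    have hE : 1 ≤ Real.exp (κ * t) := Real.one_le_exp (by positivity)
    have hk1 : 0 < u x t ^ (κ - 1) := by positivity
    have e1 : u x t ^ (κ - 1) * u x t ^ p i = u x t ^ (p i - q) := by
      rw [← Real.rpow_add hu, hκ]; congr 1; ring
    have key : min (a i) 1 ≤ u x t ^ κ + a i * u x t ^ (p i - q) := by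
      rcases le_total 1 (u x t) with h | h
      · have := Real.one_le_rpow h hκ0.le
        have h2 : 0 ≤ a i * u x t ^ (p i - q) := by positivity
        linarith [min_le_right (a i) 1]
      · have := Real.one_le_rpow_of_pos_of_le_one_of_nonpos hu h (z := p i - q) (by linarith)
        have h2 : 0 ≤ u x t ^ κ := by positivity
        nlinarith [min_le_left (a i) 1]
    have k2 : κ * u x t ^ (κ - 1) * (a i * u x t ^ p i) ≤
        κ * u x t ^ (κ - 1) * ∑ i, a i * u x t ^ p i := by gcongr
    have k3 : κ * u x t ^ (κ - 1) * (a i * u x t ^ p i) = κ * (a i * u x t ^ (p i - q)) := by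
      rw [← e1]; ring
    have k4 : b ≤ κ * (u x t ^ κ + a i * u x t ^ (p i - q)) := by rw [hb]; gcongr
    set S := ∑ i, a i * u x t ^ p i
    set D := laplacian (fun y => u y t) x
    set D' := laplacian (fun y => u y t ^ κ) x
    have k5 : b ≤ κ * u x t ^ κ + κ * u x t ^ (κ - 1) * (D + S) - D' := by nlinarith
    calc b ≤ Real.exp (κ * t) * b := by nlinarith
      _ ≤ Real.exp (κ * t) * (κ * u x t ^ κ + κ * u x t ^ (κ - 1) * (D + S) - D') := by gcongr
      _ = _ := by ring
  have hzs : Supers z := {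
    pos := fun x t ht => by have := hpos x t ht; simp only [hz]; positivity
    space := fun t ht => contDiff_const.mul (hup t ht)
    time := fun x t ht => (hzd x t ht).differentiableAt
    sup := fun x t ht => by have := hdiff x t ht; linarith }
  have hzl : ∀ x, b * (s / 2) ≤ z x s := fun x => by
    have h2 : 0 < s / 2 := by positivity
    have h := LCS hzs (H := fun _ _ => ENNReal.ofReal b) measurable_const
      (fun x t ht => ENNReal.ofReal_le_ofReal (hdiff x t ht)) x h2 h2
    rw [add_halves, Ve_eq hs] at h
    have e : Dh (fun _ _ => ENNReal.ofReal b) x (s / 2) (s / 2) = ENNReal.ofReal (b * (s / 2)) := by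
      unfold Dh
      rw [add_halves, ← setLIntegral_congr Ioo_ae_eq_Ioc]
      rw [setLIntegral_congr_fun (g := fun _ => ENNReal.ofReal b) measurableSet_Ioo
        (fun r hr => hS_const (sub_pos.2 hr.2) _ x)]
      rw [setLIntegral_const, Real.volume_Ioo, ← ENNReal.ofReal_mul hb0.le]
      congr 2; ring
    rw [e] at h
    exact (ENNReal.ofReal_le_ofReal_iff (hzs.pos x s hs).le).1 (le_add_self.trans h)
  refine ⟨(b * (s / 2) * Real.exp (-(κ * s))) ^ (1 / κ), by positivity, fun x => ?_⟩
  have h1 : b * (s / 2) * Real.exp (-(κ * s)) ≤ u x s ^ κ := by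
    have := mul_le_mul_of_nonneg_right (hzl x) (Real.exp_pos (-(κ * s))).le
    refine this.trans (le_of_eq ?_)
    simp only [hz]
    rw [mul_right_comm, ← Real.exp_add]; simp
  have hu := hpos x s hs
  calc _ ≤ (u x s ^ κ) ^ (1 / κ) := Real.rpow_le_rpow (by positivity) h1 (by positivity)
    _ = u x s := by rw [← Real.rpow_mul hu.le, mul_one_div_cancel hκ0.ne', Real.rpow_one]

lemma u_lower' (hu : Supers u) {s c : ℝ} (hs : 0 < s) (hc : 0 < c) (h : ∀ x, c ≤ u x s) {t : ℝ}
    (hst : s ≤ t) (x : EuclideanSpace ℝ (Fin n)) : c ≤ u x t := by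
  rcases hst.eq_or_lt with rfl | hlt
  · exact h x
  have h1 := LC hu hs (sub_pos.2 hlt) x
  rw [add_sub_cancel, Ve_eq (hs.trans hlt)] at h1
  have h2 : hS (t - s) (fun _ => ENNReal.ofReal c) x ≤ hS (t - s) (Ve u s) x :=
    hS_mono (fun z => by rw [Ve_eq hs]; exact ENNReal.ofReal_le_ofReal (h z)) x
  rw [hS_const (sub_pos.2 hlt)] at h2
  exact (ENNReal.ofReal_le_ofReal_iff (hu.pos x t (hs.trans hlt)).le).1 (h2.trans h1)

lemma logconv_s (ha : ∀ i, 0 ≤ a i) (hp : ∀ i, p i ≤ 1)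
    (hpos : ∀ x t, 0 < t → 0 < u x t) (hspace : ∀ t, 0 < t → ContDiff ℝ 2 (fun x => u x t))
    (htime : ∀ x t, 0 < t → DifferentiableAt ℝ (u x) t)
    (heq : ∀ x t, 0 < t →
      deriv (u x) t = laplacian (fun y => u y t) x + ∑ i, a i * u x t ^ p i)
    {s t : ℝ} (hs : 0 < s) (hst : s < t) (m z : EuclideanSpace ℝ (Fin n)) :
    u m t ^ 2 ≤ Real.exp (‖z‖ ^ 2 / (2 * (t - s))) * u (m + z) t * u (m - z) t := by
  by_cases hcase : ∃ i, 0 < a i ∧ p i < 1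
  · obtain ⟨i, hai, hpi⟩ := hcase
    have h2 : 0 < s / 2 := by positivity
    obtain ⟨c, hc, hcu⟩ := u_lower ha hpos hspace htime heq i hai hpi h2
    have hu := u_supers ha hpos hspace htime heq
    have hF := NL_trunc ha hp hc rfl
    have key := logconv_NL (u := fun x τ => u x (τ + s / 2)) hF
      (Λ := ∑ i, a i * (|p i| * c ^ (p i - 1)))
      (fun x t ht => hpos x _ (by linarith)) (fun t ht => hspace _ (by linarith))
      (fun x t ht => (htime x (t + s / 2) (by linarith)).comp t (by fun_prop))
      (fun x t ht => by
        rw [deriv_comp_add_const, heq x _ (by linarith)]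
        have := u_lower' hu h2 hc hcu (t := t + s / 2) (by linarith) x
        rw [max_eq_left this]
        ring) (s := s / 2) (t := t - s / 2) h2 (by linarith) m z
    rw [sub_add_cancel, show t - s / 2 - s / 2 = t - s by ring] at key
    exact key
  · push Not at hcase
    refine logconv_NL (NL_linear (Finset.sum_nonneg fun i _ => ha i : 0 ≤ ∑ i, a i)) (Λ := 0)
      hpos hspace htime (fun x t ht => ?_) hs hst m z
    rw [heq x t ht, Finset.sum_mul, zero_mul, sub_zero]
    congr 1
    refine Finset.sum_congr rfl fun i _ => ?_
    rcases (ha i).eq_or_lt with h | h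
    · rw [← h]; simp
    · rw [le_antisymm (hp i) (hcase i h), Real.rpow_one]

lemma LineSecond.sym {f : EuclideanSpace ℝ (Fin n) → ℝ} {x e : EuclideanSpace ℝ (Fin n)} {c : ℝ}
    (hf : LineSecond f x e c) (he : ‖e‖ = 1) (T : ℝ) :
    LineSecond (fun z => f (x + z) + f (x - z) + ‖z‖ ^ 2 / (2 * T)) 0 e (2 * c + 1 / T) := by
  obtain ⟨g, h1, h2⟩ := hf
  refine ⟨fun s => g s - g (-s) + s / T, ?_, ?_⟩
  · have h1' : ∀ᶠ s in 𝓝 (0:ℝ), HasDerivAt (fun s : ℝ => f (x + s • e)) (g (-s)) (-s) := by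
      have : Tendsto (fun s : ℝ => -s) (𝓝 0) (𝓝 0) := by simpa using (continuous_neg (G := ℝ)).tendsto 0
      exact this.eventually h1
    filter_upwards [h1, h1'] with s hs hs'
    have k1 : HasDerivAt (fun s : ℝ => f (x - s • e)) (-g (-s)) s := by
      have := hs'.scomp s (hasDerivAt_neg s)
      simpa [Function.comp_def, sub_eq_add_neg] using this
    have k2 : HasDerivAt (fun s : ℝ => s ^ 2 / (2 * T)) (s / T) s := by
      have := (hasDerivAt_pow 2 s).div_const (2 * T)
      refine this.congr_deriv ?_
      by_cases hT : T = 0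
      · simp [hT]
      · field_simp; simp
    have := (hs.add k1).add k2
    rw [← sub_eq_add_neg] at this
    refine this.congr_of_eventuallyEq (Eventually.of_forall fun r => ?_)
    simp [norm_smul, he]
  · have k1 : HasDerivAt (fun s : ℝ => g (-s)) (-c) 0 := by
      have h2' : HasDerivAt g c (-0) := by simpa using h2
      have := h2'.scomp (0:ℝ) (hasDerivAt_neg 0)
      simpa [Function.comp_def] using this
    have := (h2.sub k1).add ((hasDerivAt_id (0:ℝ)).div_const T)
    refine (this.congr_deriv (by ring)).congr_of_eventuallyEq (Eventually.of_forall fun r => ?_)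
    simp

end final
end

theorem stmt_7 (n : ℕ) (hn : 1 ≤ n) (N : ℕ) (hN : 1 ≤ N)
    (a p : Fin N → ℝ) (ha : ∀ i, 0 ≤ a i) (hp : ∀ i, p i ≤ 1)
    (u : EuclideanSpace ℝ (Fin n) → ℝ → ℝ)
    (hpos : ∀ x t, 0 < t → 0 < u x t)
    (hspace : ∀ t, 0 < t → ContDiff ℝ 2 (fun x => u x t))
    (htime : ∀ x, ContDiffOn ℝ 1 (u x) (Set.Ioi 0))
    (heq : ∀ x t, 0 < t →
      deriv (u x) t = laplacian (fun y => u y t) x + ∑ i, a i * u x t ^ p i) :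
    ∀ x t, 0 < t →
      0 ≤ laplacian (fun y => Real.log (u y t)) x + n / (2 * t) := by
  intro x t ht
  have htime' : ∀ x t, 0 < t → DifferentiableAt ℝ (u x) t := fun x t ht =>
    ((htime x).differentiableOn (by norm_num)).differentiableAt (Ioi_mem_nhds ht)
  have hlog : ContDiff ℝ 2 (fun y => Real.log (u y t)) :=
    (hspace t ht).log fun y => (hpos y t ht).ne'
  have hlc : ∀ z, u x t ^ 2 ≤ Real.exp (‖z‖ ^ 2 / (2 * t)) * u (x + z) t * u (x - z) t := fun z => by
    have hlim : Tendsto (fun s : ℝ => Real.exp (‖z‖ ^ 2 / (2 * (t - s))) * u (x + z) t * u (x - z) t)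
        (𝓝[>] 0) (𝓝 (Real.exp (‖z‖ ^ 2 / (2 * (t - 0))) * u (x + z) t * u (x - z) t)) := by
      refine Tendsto.mono_left ?_ nhdsWithin_le_nhds
      have : ContinuousAt (fun s : ℝ => Real.exp (‖z‖ ^ 2 / (2 * (t - s))) * u (x + z) t * u (x - z) t) 0 := by
        have : 2 * (t - 0) ≠ 0 := by rw [sub_zero]; positivity
        fun_prop (disch := assumption)
      exact this
    rw [sub_zero] at hlim
    refine ge_of_tendsto hlim ?_
    filter_upwards [Ioo_mem_nhdsGT ht] with s hs
    exact logconv_s ha hp hpos hspace htime' heq hs.1 hs.2 x z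
  have hi : ∀ i : Fin n, -(1 / (2 * t)) ≤ fderiv ℝ (fun y => fderiv ℝ (fun y => Real.log (u y t)) y
      (EuclideanSpace.single i 1)) x (EuclideanSpace.single i 1) := fun i => by
    have h1 := (LineSecond.of_contDiff hlog x (EuclideanSpace.single i (1:ℝ))).sym (by simp) t
    have h2 := h1.nonneg_of_min (Eventually.of_forall fun z => by
      have hx := hpos x t ht
      have hy := hpos (x + z) t ht
      have hy' := hpos (x - z) t ht
      have h := Real.log_le_log (by positivity) (hlc z)
      rw [Real.log_mul (by positivity) hy'.ne', Real.log_mul (by positivity) hy.ne', Real.log_exp,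
        Real.log_pow] at h
      simp only [add_zero, sub_zero, norm_zero]
      push_cast at h
      simp only [ne_eq, OfNat.ofNat_ne_zero, not_false_eq_true, zero_pow, zero_div]
      linarith)
    have e : 1 / t = 2 * (1 / (2 * t)) := by field_simp
    linarith
  have : ∑ _i : Fin n, -(1 / (2 * t)) ≤ laplacian (fun y => Real.log (u y t)) x :=
    Finset.sum_le_sum fun i _ => hi i
  rw [Finset.sum_const, Finset.card_univ, Fintype.card_fin, nsmul_eq_mul] at this
  have e : (n : ℝ) / (2 * t) = n * (1 / (2 * t)) := by ring
  linarith
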